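/- Let G=(V,E) be a sparse graph with max-tight decomposition {G_i=(V_i,E_i)}_{i∈I}. Then there exists a nonzero polynomial F in the variables (x_e)_{e∈E} over ℂ such that for every λ ∈ ℂ^E with F(λ) ≠ 0 and all realizations r,s ∈ E_G⁻¹(λ), the following are equivalent: (i) there exists a minimal prime ideal P over the vanishing ideal of E_G⁻¹(λ) such that every polynomial in P vanishes at both r and s (i.e. r and s belong to a common irreducible component of E_G⁻¹(λ)); (ii) for every i∈I there exists t ∈ T such that t∘(r restricted to V_i) equals s restricted to V_i. -/

import Mathlib

open scoped Classical

noncomputable section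

/-- The squared distance function on `ℂ²`. -/
def sd (x y : ℂ × ℂ) : ℂ := (x.1 - y.1) ^ 2 + (x.2 - y.2) ^ 2

/-- Membership in the transformation group `T`. -/
def IsTransf (t : ℂ × ℂ → ℂ × ℂ) : Prop :=
  ∃ c s u v : ℂ, c ^ 2 + s ^ 2 = 1 ∧
    ∀ x, t x = (c * x.1 - s * x.2 + u, s * x.1 + c * x.2 + v)

variable {α : Type*} [DecidableEq α]

/-- `(V, E)` is a finite simple undirected graph: edges are non-diagonal
unordered pairs with both endpoints in `V`. -/
def IsGraph (V : Finset α) (E : Finset (Sym2 α)) : Prop :=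
  ∀ e ∈ E, ¬ e.IsDiag ∧ ∀ v ∈ e, v ∈ V

/-- `(V', E')` is a subgraph of `(V, E)`. -/
def IsSubgraph (V' : Finset α) (E' : Finset (Sym2 α))
    (V : Finset α) (E : Finset (Sym2 α)) : Prop :=
  IsGraph V' E' ∧ V' ⊆ V ∧ E' ⊆ E

/-- A graph is sparse if every subgraph `(V', E')` with `|V'| ≥ 2`
satisfies `|E'| ≤ 2|V'| - 3`. -/
def IsSparse (V : Finset α) (E : Finset (Sym2 α)) : Prop :=
  IsGraph V E ∧ ∀ V' E', IsSubgraph V' E' V E → 2 ≤ V'.card →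
    (E'.card : ℤ) ≤ 2 * V'.card - 3

/-- A graph is tight if it is sparse and `|V| = 1` or `|E| = 2|V| - 3`. -/
def IsTight (V : Finset α) (E : Finset (Sym2 α)) : Prop :=
  IsSparse V E ∧ (V.card = 1 ∨ (E.card : ℤ) = 2 * V.card - 3)

/-- `(V', E')` is a max-tight subgraph of `(V, E)`. -/
def IsMaxTight (V' : Finset α) (E' : Finset (Sym2 α))
    (V : Finset α) (E : Finset (Sym2 α)) : Prop :=
  IsSubgraph V' E' V E ∧ IsTight V' E' ∧
    ∀ V'' E'', IsSubgraph V'' E'' V E → IsTight V'' E'' →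
      V' ⊆ V'' → E' ⊆ E'' → V' = V'' ∧ E' = E''

/-- `{(Vi i, Ei i)}_{i ∈ I}` is a max-tight decomposition of `(V, E)`. -/
def IsMaxTightDecomp {I : Type*} (V : Finset α) (E : Finset (Sym2 α))
    (Vi : I → Finset α) (Ei : I → Finset (Sym2 α)) : Prop :=
  (∀ i, IsMaxTight (Vi i) (Ei i) V E) ∧
  (∀ v ∈ V, ∃ i, v ∈ Vi i) ∧
  (∀ e ∈ E, ∃ i, e ∈ Ei i) ∧
  (∀ i j, i ≠ j → ∀ e, ¬ (e ∈ Ei i ∧ e ∈ Ei j))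

/-- Extend a realization of `V` to all of `α` (by zero off `V`). -/
def extendR (V : Finset α) (r : ↥V → ℂ × ℂ) : α → ℂ × ℂ :=
  fun a => if h : a ∈ V then r ⟨a, h⟩ else 0

/-- The squared distance along an unordered pair of vertices. -/
def edgeVal (r : α → ℂ × ℂ) : Sym2 α → ℂ :=
  Sym2.lift ⟨fun u v => sd (r u) (r v), fun u v => by simp only [sd]; ring⟩

/-- The edge map `E_G : (ℂ²)^V → ℂ^E`. -/
def edgeMap (V : Finset α) (E : Finset (Sym2 α)) (r : ↥V → ℂ × ℂ) :
    {e // e ∈ E} → ℂ :=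
  fun e => edgeVal (extendR V r) e.1

/-- The set `E_G⁻¹(λ)` of `λ`-compatible realizations. -/
def fiber (V : Finset α) (E : Finset (Sym2 α)) (lam : {e // e ∈ E} → ℂ) :
    Set (↥V → ℂ × ℂ) :=
  {r | edgeMap V E r = lam}

/-- The set of equivalence classes of `S` under `r ∼ s ↔ ∃ t ∈ T, s = t ∘ r`. -/
def TClasses {β : Type*} (S : Set (β → ℂ × ℂ)) : Set (Set (β → ℂ × ℂ)) :=
  {C | ∃ r ∈ S, C = {s | s ∈ S ∧ ∃ t, IsTransf t ∧ s = fun v => t (r v)}}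

/-- The coordinates of a realization, as a point of affine space with
coordinate ring `ℂ[x_v, y_v : v ∈ β]`. -/
def coords {β : Type*} (r : β → ℂ × ℂ) : β × Fin 2 → ℂ :=
  fun p => if p.2 = 0 then (r p.1).1 else (r p.1).2

/-- The vanishing ideal of a set of realizations in `ℂ[x_v, y_v : v ∈ β]`. -/
def vanishingIdeal {β : Type*} (S : Set (β → ℂ × ℂ)) :
    Ideal (MvPolynomial (β × Fin 2) ℂ) where
  carrier := {f | ∀ r ∈ S, MvPolynomial.eval (coords r) f = 0}
  add_mem' := by
    intro a b ha hb r hr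
    simp only [Set.mem_setOf_eq] at ha hb ⊢
    simp [map_add, ha r hr, hb r hr]
  zero_mem' := by intro r hr; simp
  smul_mem' := by
    intro c f hf r hr
    simp only [Set.mem_setOf_eq] at hf ⊢
    simp [smul_eq_mul, map_mul, hf r hr]

end

noncomputable section

/-- Lifting the identity of a formally smooth algebra along a square-zero extension. -/
theorem Algebra.FormallySmooth.exists_ringHom_lift {R M B : Type*} [CommRing R] [CommRing M]
    [CommRing B] [Algebra R M] [Algebra.FormallySmooth R M] (p : B →+* M)
    (hp : Function.Surjective p) (hker : IsNilpotent (RingHom.ker p)) (g : R →+* B)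
    (hg : ∀ x, p (g x) = algebraMap R M x) :
    ∃ h : M →+* B, (∀ x, h (algebraMap R M x) = g x) ∧ ∀ x, p (h x) = x := by
  let _ := g.toAlgebra
  let pa : B →ₐ[R] M := { p with commutes' := hg }
  refine ⟨(Algebra.FormallySmooth.liftOfSurjective (AlgHom.id R M) pa hp hker : M →ₐ[R] B),
    fun x => ?_, fun x => ?_⟩
  · exact AlgHom.commutes _ x
  · exact Algebra.FormallySmooth.liftOfSurjective_apply (AlgHom.id R M) pa hp hker x

open scoped IntermediateField.algebraAdjoinAdjoin in
/-- In characteristic zero, a derivation may take arbitrary values on an algebraically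
independent family. -/
theorem AlgebraicIndependent.exists_derivation {k M ι : Type*} [Field k] [CharZero k] [Field M]
    [Algebra k M] {v : ι → M} (hv : AlgebraicIndependent k v) (c : ι → M) :
    ∃ D : Derivation k M M, ∀ i, D (v i) = c i := by
  obtain ⟨s, hs, hb⟩ := exists_isTranscendenceBasis_superset (s := Set.range v) (R := k)
    ((algebraicIndependent_subtype_range hv.injective).2 hv)
  let c' : M → M := Function.extend v c 0
  have hc' : ∀ i, c' (v i) = c i := fun i => hv.injective.extend_apply c 0 i
  have hr : Set.range ((↑) : s → M) = s := Subtype.range_coe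
  let R0 := Algebra.adjoin k (Set.range ((↑) : s → M))
  let K0 := IntermediateField.adjoin k (Set.range ((↑) : s → M))
  have : Algebra.FormallySmooth R0 M := by
    have h1 : Algebra.FormallySmooth R0 K0 := .of_isLocalization (nonZeroDivisors _)
    have : Algebra.IsAlgebraic K0 M := hb.isAlgebraic_field
    have h2 : Algebra.FormallyEtale K0 M := Algebra.FormallyEtale.of_isSeparable _ _
    exact .comp R0 K0 M
  let e := hb.1.aevalEquiv
  let φ : MvPolynomial s k →ₐ[k] DualNumber M :=
    MvPolynomial.aeval (fun i => TrivSqZeroExt.inl (i : M) + TrivSqZeroExt.inr (c' i))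
  let g : R0 →ₐ[k] DualNumber M := φ.comp e.symm.toAlgHom
  have hg1 : ∀ p : MvPolynomial s k, (φ p).fst = MvPolynomial.aeval ((↑) : s → M) p := by
    intro p
    have : ((TrivSqZeroExt.fstHom k M M).comp φ) = MvPolynomial.aeval ((↑) : s → M) := by
      apply MvPolynomial.algHom_ext; intro i; simp [φ]
    exact DFunLike.congr_fun this p
  have hg : ∀ x, (g x).fst = algebraMap R0 M x := by
    intro x
    have h2 : e (e.symm x) = x := e.apply_symm_apply x
    conv_rhs => rw [← h2]
    change (φ (e.symm x)).fst = _
    rw [hg1]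
    exact (hb.1.algebraMap_aevalEquiv _).symm
  obtain ⟨h, hh1, hh2⟩ := Algebra.FormallySmooth.exists_ringHom_lift (R := R0)
    (TrivSqZeroExt.fstHom k M M : DualNumber M →+* M)
    (fun x => ⟨TrivSqZeroExt.inl x, by simp⟩)
    ⟨2, by
      rw [Submodule.zero_eq_bot, eq_bot_iff, pow_two, Ideal.mul_le]
      intro x hx y hy
      simp only [RingHom.mem_ker] at hx hy
      have hx' : x.fst = 0 := hx
      have hy' : y.fst = 0 := hy
      rw [Ideal.mem_bot]
      ext <;> simp [hx', hy']⟩ (g : R0 →+* DualNumber M) hg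
  have hh2' : ∀ x, (h x).fst = x := hh2
  refine ⟨Derivation.mk' (R := k) (A := M) (M := M)
    { toFun := fun x => (h x).snd
      map_add' := fun x y => by simp
      map_smul' := fun a x => ?_ } ?_, fun i => ?_⟩
  · have : h (algebraMap k M a) = TrivSqZeroExt.inl (algebraMap k M a) := by
      rw [IsScalarTower.algebraMap_apply k R0 M, hh1]
      change g (algebraMap k R0 a) = _
      rw [AlgHom.commutes]; rfl
    rw [Algebra.smul_def, map_mul, this]
    simp [Algebra.smul_def]
  · intro a b
    simp [hh2', mul_comm]
  · have hi : v i ∈ s := hs ⟨i, rfl⟩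
    change (h (v i)).snd = _
    have h3 : e (MvPolynomial.X ⟨v i, hi⟩) = (⟨v i, Algebra.subset_adjoin (Set.mem_range_self (⟨v i, hi⟩ : s))⟩ : R0) := by
      apply Subtype.ext
      exact (hb.1.algebraMap_aevalEquiv (MvPolynomial.X ⟨v i, hi⟩)).trans (MvPolynomial.aeval_X _ _)
    have h4 : v i = algebraMap R0 M (e (MvPolynomial.X ⟨v i, hi⟩)) := by rw [h3]; rfl
    rw [h4, hh1]
    change (φ (e.symm (e _))).snd = _
    rw [AlgEquiv.symm_apply_apply]
    simp [φ, hc']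
end

noncomputable section

namespace MvPolynomial

attribute [local instance] MvPolynomial.algebraMvPolynomial

section
variable {k M σ : Type*} [Field k] [Field M] [Algebra k M]

/-- The coefficientwise extension of a derivation to a polynomial ring. -/
def mapDerivation (D : Derivation k M M) :
    Derivation (MvPolynomial σ k) (MvPolynomial σ M) (MvPolynomial σ M) := by
  have hc : ∀ (p : MvPolynomial σ M) (n : σ →₀ ℕ),
      coeff n (∑ m ∈ p.support, monomial m (D (coeff m p))) = D (coeff n p) := by
    intro p n
    simp only [coeff_sum, coeff_monomial, Finset.sum_ite_eq', mem_support_iff]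
    split_ifs with h
    · rfl
    · rw [not_not.1 h, map_zero]
  refine Derivation.mk'
    { toFun := fun p => ∑ m ∈ p.support, monomial m (D (coeff m p))
      map_add' := fun p q => by ext n; rw [coeff_add, hc, hc, hc, coeff_add, map_add]
      map_smul' := fun c p => ?_ } fun p q => ?_
  · ext n
    rw [hc, RingHom.id_apply, Algebra.smul_def, Algebra.smul_def, coeff_mul, coeff_mul, map_sum]
    refine Finset.sum_congr rfl fun x _ => ?_
    rw [hc, algebraMap_def, coeff_map, ← Algebra.smul_def, D.map_smul, Algebra.smul_def]
  · ext n
    simp only [LinearMap.coe_mk, AddHom.coe_mk, smul_eq_mul]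
    rw [hc, coeff_add, mul_comm q, coeff_mul, coeff_mul, coeff_mul, map_sum, 
      ← Finset.sum_add_distrib]
    refine Finset.sum_congr rfl fun x _ => ?_
    rw [hc, hc, D.leibniz, smul_eq_mul, smul_eq_mul, mul_comm (coeff x.2 q)]

theorem coeff_mapDerivation (D : Derivation k M M) (p : MvPolynomial σ M) (n : σ →₀ ℕ) :
    coeff n (mapDerivation D p) = D (coeff n p) := by
  change coeff n (∑ m ∈ p.support, monomial m (D (coeff m p))) = D (coeff n p)
  simp only [coeff_sum, coeff_monomial, Finset.sum_ite_eq', mem_support_iff]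
  split_ifs with h
  · rfl
  · rw [not_not.1 h, map_zero]

theorem mapDerivation_C (D : Derivation k M M) (a : M) :
    mapDerivation (σ := σ) D (C a) = C (D a) := by
  ext n
  rw [coeff_mapDerivation, coeff_C, coeff_C]
  split_ifs <;> simp

theorem mapDerivation_X (D : Derivation k M M) (i : σ) : mapDerivation D (X i) = 0 := by
  have := (mapDerivation (σ := σ) D).map_algebraMap (X i)
  rwa [algebraMap_def, map_X] at this

theorem totalDegree_mapDerivation_le (D : Derivation k M M) (p : MvPolynomial σ M) :
    (mapDerivation D p).totalDegree ≤ p.totalDegree := by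
  refine Finset.sup_mono fun n hn => ?_
  rw [mem_support_iff, coeff_mapDerivation] at hn
  rw [mem_support_iff]
  rintro h
  rw [h, map_zero] at hn
  exact hn rfl

/-- A polynomial all of whose derivatives vanish has coefficients in the base field. -/
theorem exists_map_eq_of_mapDerivation_eq_zero [CharZero k]
    (hk : ∀ x : M, IsAlgebraic k x → x ∈ (algebraMap k M).range) (p : MvPolynomial σ M)
    (hp : ∀ D : Derivation k M M, mapDerivation D p = 0) :
    ∃ c : MvPolynomial σ k, algebraMap _ (MvPolynomial σ M) c = p := by
  have h1 : ∀ n, coeff n p ∈ (algebraMap k M).range := by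
    intro n
    by_contra hn
    have ht : Transcendental k (coeff n p) := fun h => hn (hk _ h)
    have ha : AlgebraicIndependent k (fun _ : Unit => coeff n p) := by
      rwa [algebraicIndependent_unique_type_iff]
    obtain ⟨D, hD⟩ := ha.exists_derivation (fun _ => 1)
    have := coeff_mapDerivation D p n
    rw [hp, hD ()] at this
    simp at this
  choose g hg using h1
  refine ⟨∑ m ∈ p.support, monomial m (g m), ?_⟩
  rw [algebraMap_def, map_sum]
  conv_rhs => rw [p.as_sum]
  exact Finset.sum_congr rfl fun m _ => by rw [map_monomial, hg]

/-- Elements algebraic over a subring on which all derivations are proportional to a given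
one have proportional derivatives. -/
theorem exists_mul_derivation_eq {C R : Type*} [CommRing C] [CommRing R] [IsDomain R]
    [IsDomain C] [CharZero R] [Algebra C R] (q a : R) (ha : IsAlgebraic (Algebra.adjoin C {q}) a) :
    ∃ u n : R, u ≠ 0 ∧ IsAlgebraic (Algebra.adjoin C {q}) u ∧
      IsAlgebraic (Algebra.adjoin C {q}) n ∧
      ∀ D : Derivation C R R, u * D a = n * D q := by
  set S := Algebra.adjoin C {q}
  have hex : ∃ d : ℕ, ∃ P : Polynomial S, P ≠ 0 ∧ Polynomial.aeval a P = 0 ∧ P.natDegree = d :=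
    let ⟨P, h1, h2⟩ := ha; ⟨_, P, h1, h2, rfl⟩
  obtain ⟨P, hP0, hPa, hPd⟩ := Nat.find_spec hex
  have hmin := fun {m : ℕ} => Nat.find_min hex (m := m)
  rw [← hPd] at hmin
  have hlift : ∀ s : S, ∃ f : Polynomial C, Polynomial.aeval q f = (s : R) := by
    intro s
    have hS : S = (Polynomial.aeval q).range := Algebra.adjoin_singleton_eq_range_aeval C q
    have h : (s : R) ∈ (Polynomial.aeval (R := C) q).range := by rw [← hS]; exact s.2
    exact h
  choose f hf using hlift
  have hdeg : P.natDegree ≠ 0 := by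
    intro h0
    rw [Polynomial.eq_C_of_natDegree_eq_zero h0] at hPa hP0
    rw [Polynomial.aeval_C] at hPa
    have h0 : (P.coeff 0 : R) = 0 := hPa
    have h1 : P.coeff 0 = 0 := Subtype.ext h0
    rw [h1, map_zero] at hP0
    exact hP0 rfl
  have hchar : CharZero S := ⟨fun m n h => Nat.cast_injective (R := R) (by
    simpa using congrArg Subtype.val h)⟩
  have hd0 : Polynomial.derivative P ≠ 0 := fun h =>
    hdeg (Polynomial.derivative_eq_zero.1 h)
  have hu0 : Polynomial.aeval a (Polynomial.derivative P) ≠ 0 := fun h =>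
    hmin (Polynomial.natDegree_derivative_lt hdeg) ⟨_, hd0, h, rfl⟩
  have hSalg : ∀ Q : Polynomial S, IsAlgebraic S (Polynomial.aeval a Q) := by
    intro Q
    exact Algebra.isAlgebraic_adjoin_singleton_iff.2 ha _ (Polynomial.aeval_mem_adjoin_singleton S a)
  refine ⟨Polynomial.aeval a (Polynomial.derivative P),
    -∑ i ∈ Finset.range (P.natDegree + 1),
      Polynomial.aeval q (Polynomial.derivative (f (P.coeff i))) * a ^ i, hu0, hSalg _, ?_, ?_⟩
  · refine IsAlgebraic.neg ?_
    have := hSalg (∑ i ∈ Finset.range (P.natDegree + 1), Polynomial.C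
      (⟨Polynomial.aeval q (Polynomial.derivative (f (P.coeff i))),
        Polynomial.aeval_mem_adjoin_singleton C q⟩ : S) * Polynomial.X ^ i)
    rw [map_sum] at this
    convert this using 2 with i
    rw [map_mul, map_pow, Polynomial.aeval_X, Polynomial.aeval_C]
    rfl
  · intro D
    have h1 : D (Polynomial.aeval a P) = 0 := by rw [hPa, map_zero]
    rw [Polynomial.aeval_eq_sum_range, map_sum] at h1
    have h2 : Polynomial.aeval a (Polynomial.derivative P) =
        ∑ i ∈ Finset.range (P.natDegree + 1), (P.coeff i : R) * (i * a ^ (i - 1)) := by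
      rw [Polynomial.derivative_apply, Polynomial.sum_over_range _ (by simp), map_sum]
      refine Finset.sum_congr rfl fun i _ => ?_
      rw [map_mul, map_pow, Polynomial.aeval_X, Polynomial.aeval_C, map_mul, map_natCast, mul_assoc]
      rfl
    rw [h2, neg_mul, eq_neg_iff_add_eq_zero, Finset.sum_mul, Finset.sum_mul,
      ← Finset.sum_add_distrib, ← h1]
    refine Finset.sum_congr rfl fun i _ => ?_
    have h3 : D (P.coeff i : R) =
        Polynomial.aeval q (Polynomial.derivative (f (P.coeff i))) * D q := by
      conv_lhs => rw [← hf (P.coeff i)]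
      rw [D.map_aeval, smul_eq_mul]
    rw [Subalgebra.smul_def, smul_eq_mul, D.leibniz, h3, D.leibniz_pow]
    simp only [smul_eq_mul, nsmul_eq_mul]
    ring

/-- Polynomials algebraic over `k[X, q]` lie in `k[X, q]`, provided two of the derivatives of `q`
are relatively prime. -/
theorem exists_aeval_eq_of_isRelPrime [CharZero k]
    (hk : ∀ x : M, IsAlgebraic k x → x ∈ (algebraMap k M).range) (q : MvPolynomial σ M)
    (D₁ D₂ : Derivation k M M) (hrel : IsRelPrime (mapDerivation D₁ q) (mapDerivation D₂ q))
    (hdeg : (mapDerivation D₁ q).totalDegree ≠ 0) (a : MvPolynomial σ M)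
    (ha : IsAlgebraic (Algebra.adjoin (MvPolynomial σ k) {q}) a) :
    ∃ f : Polynomial (MvPolynomial σ k), Polynomial.aeval q f = a := by
  have : CharZero M := charZero_of_injective_algebraMap (algebraMap k M).injective
  have : CharZero (MvPolynomial σ M) := charZero_of_injective_algebraMap (C_injective σ M)
  induction hn : a.totalDegree using Nat.strong_induction_on generalizing a with
  | _ n ih =>
  obtain ⟨u, v, hu0, hu, hv, h⟩ := exists_mul_derivation_eq q a ha
  have h0 : mapDerivation D₁ q ≠ 0 := by
    intro h; rw [h] at hdeg; exact hdeg totalDegree_zero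
  have h1 : mapDerivation D₁ q * mapDerivation D₂ a = mapDerivation D₂ q * mapDerivation D₁ a := by
    apply mul_left_cancel₀ hu0
    linear_combination (mapDerivation D₁ q) * h (mapDerivation D₂) -
      (mapDerivation D₂ q) * h (mapDerivation D₁)
  obtain ⟨w, hw⟩ : mapDerivation D₁ q ∣ mapDerivation D₁ a :=
    hrel.dvd_of_dvd_mul_left ⟨_, h1.symm⟩
  have huw : u * w = v := by
    apply mul_right_cancel₀ h0
    rw [← h, hw]; ring
  have hw' : ∀ D : Derivation k M M, mapDerivation D a = w * mapDerivation D q := by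
    intro D
    apply mul_left_cancel₀ hu0
    rw [h, ← huw]; ring
  have hwalg : IsAlgebraic (Algebra.adjoin (MvPolynomial σ k) {q}) w :=
    IsAlgebraic.of_mul (mem_nonZeroDivisors_of_ne_zero hu0) hu (huw ▸ hv)
  obtain ⟨g, hg⟩ : ∃ g : Polynomial (MvPolynomial σ k), Polynomial.aeval q g = w := by
    by_cases hw0 : w = 0
    · exact ⟨0, by rw [map_zero, hw0]⟩
    · refine ih _ ?_ w hwalg rfl
      have := totalDegree_mul_of_isDomain h0 hw0
      rw [← hw] at this
      have := totalDegree_mapDerivation_le D₁ a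
      omega
  let G : Polynomial (MvPolynomial σ k) := ∑ i ∈ Finset.range (g.natDegree + 1),
    Polynomial.C (C ((i + 1 : k)⁻¹) * g.coeff i) * Polynomial.X ^ (i + 1)
  have hG : Polynomial.derivative G = g := by
    conv_rhs => rw [g.as_sum_range_C_mul_X_pow]
    rw [Polynomial.derivative_sum]
    refine Finset.sum_congr rfl fun i _ => ?_
    rw [Polynomial.derivative_C_mul_X_pow, Nat.add_sub_cancel]
    congr 2
    have h1 : (((i + 1 : ℕ) : MvPolynomial σ k)) = C (i + 1 : k) := by simp
    have h2 : (i + 1 : k) ≠ 0 := by exact_mod_cast Nat.succ_ne_zero i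
    rw [h1, mul_right_comm, ← C_mul, inv_mul_cancel₀ h2, C_1, one_mul]
  obtain ⟨c, hc⟩ := exists_map_eq_of_mapDerivation_eq_zero hk (a - Polynomial.aeval q G) (by
    intro D
    rw [map_sub, (mapDerivation D).map_aeval, hG, hg, hw', smul_eq_mul, sub_self])
  refine ⟨Polynomial.C c + G, ?_⟩
  rw [map_add, Polynomial.aeval_C, hc, sub_add_cancel]

/-- Polynomials algebraic over `k[X]` have coefficients in `k` if `k` is algebraically closed in
the coefficient field. -/
theorem exists_map_eq_of_isAlgebraic [CharZero k]
    (hk : ∀ x : M, IsAlgebraic k x → x ∈ (algebraMap k M).range) (a : MvPolynomial σ M)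
    (ha : IsAlgebraic (MvPolynomial σ k) a) :
    ∃ c : MvPolynomial σ k, algebraMap _ (MvPolynomial σ M) c = a := by
  have : CharZero M := charZero_of_injective_algebraMap (algebraMap k M).injective
  have : CharZero (MvPolynomial σ M) := charZero_of_injective_algebraMap (C_injective σ M)
  refine exists_map_eq_of_mapDerivation_eq_zero hk a fun D => ?_
  have hinj : Function.Injective (algebraMap (MvPolynomial σ k) (MvPolynomial σ M)) := by
    rw [algebraMap_def]; exact map_injective _ (algebraMap k M).injective
  obtain ⟨u, v, hu0, -, -, h⟩ := exists_mul_derivation_eq (C := MvPolynomial σ k) 0 a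
    (ha.extendScalars fun x y hxy => hinj (congrArg Subtype.val hxy))
  have := h (mapDerivation D)
  rw [map_zero, mul_zero] at this
  exact (mul_eq_zero.1 this).resolve_left hu0
end
end MvPolynomial
end

noncomputable section

section
variable (k : Type*) {Ω : Type*} [Field k] [Field Ω] [Algebra k Ω]

/-- The algebraic closure, inside an ambient field, of the field generated by a set. -/
def acl (S : Set Ω) : IntermediateField k Ω where
  carrier := {x | IsAlgebraic (Algebra.adjoin k S) x}
  mul_mem' ha hb := IsAlgebraic.mul ha hb
  add_mem' ha hb := IsAlgebraic.add ha hb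
  algebraMap_mem' c := isAlgebraic_algebraMap (R := Algebra.adjoin k S) (A := Ω) (algebraMap k _ c)
  inv_mem' _ hx := IsAlgebraic.inv hx

variable {k}

theorem mem_acl {S : Set Ω} {x : Ω} : x ∈ acl k S ↔ IsAlgebraic (Algebra.adjoin k S) x := Iff.rfl

theorem subset_acl (S : Set Ω) : S ⊆ acl k S := fun x hx =>
  isAlgebraic_algebraMap (R := Algebra.adjoin k S) (A := Ω) ⟨x, Algebra.subset_adjoin hx⟩

theorem mem_acl_of_mem {S : Set Ω} {x : Ω} (hx : x ∈ S) : x ∈ acl k S := subset_acl S hx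

theorem acl_le {S T : Set Ω} (h : S ⊆ acl k T) : acl k S ≤ acl k T := fun _ hx =>
  IsAlgebraic.adjoin_of_forall_isAlgebraic (fun _ hy => h hy.1) hx

theorem acl_mono {S T : Set Ω} (h : S ⊆ T) : acl k S ≤ acl k T :=
  acl_le (h.trans (subset_acl T))

theorem acl_insert_le {S T : Set Ω} {x : Ω} (h : S ⊆ T) (hx : x ∈ acl k T) :
    acl k (insert x S) ≤ acl k T :=
  acl_le (Set.insert_subset hx (h.trans (subset_acl T)))

theorem algebraAdjoin_le_acl (S : Set Ω) : Algebra.adjoin k S ≤ (acl k S).toSubalgebra :=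
  Algebra.adjoin_le (subset_acl S)

theorem matroid_closure_eq_acl (S : Set Ω) :
    (AlgebraicIndependent.matroid k Ω).closure S = acl k S := by
  rw [AlgebraicIndependent.matroid_closure_eq]; rfl

theorem acl_exchange {S : Set Ω} {x y : Ω} (h : y ∈ acl k (insert x S)) (hy : y ∉ acl k S) :
    x ∈ acl k (insert y S) := by
  have := Matroid.closure_exchange (M := AlgebraicIndependent.matroid k Ω) (X := S) (e := y)
    (f := x) (by rw [matroid_closure_eq_acl, matroid_closure_eq_acl]; exact ⟨h, hy⟩)
  rw [matroid_closure_eq_acl] at this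
  exact this.1

theorem not_both_mem_acl_insert {S : Set Ω} {x y v : Ω} (hx : x ∉ acl k S)
    (hy : y ∉ acl k (insert x S)) (hxv : x ∈ acl k (insert v S)) (hyv : y ∈ acl k (insert v S)) :
    False :=
  hy (acl_insert_le (Set.subset_insert _ _) (acl_exchange hxv hx) hyv)

/-- Elements algebraic over an algebraically closed subset stay inside it. -/
theorem mem_acl_of_isAlgebraic {S : Set Ω} {R : Type*} [CommRing R] [Algebra R Ω]
    [IsDomain R] [FaithfulSMul R Ω] (h : ∀ r : R, algebraMap R Ω r ∈ acl k S) {x : Ω}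
    (hx : IsAlgebraic R x) : x ∈ acl k S := by
  have h1 : IsAlgebraic (acl k S) x := by
    let f : R →+* acl k S := (algebraMap R Ω).codRestrict (acl k S) h
    refine hx.ringHom_of_comp_eq f (RingHom.id Ω) ?_ rfl
    intro a b hab
    exact FaithfulSMul.algebraMap_injective R Ω (congrArg Subtype.val hab)
  obtain ⟨p, hp, hpx⟩ := h1
  have h2 : IsAlgebraic (Algebra.adjoin k (acl k S : Set Ω)) x := by
    have : (acl k S).toSubalgebra = Algebra.adjoin k (acl k S : Set Ω) :=
      (Algebra.adjoin_eq (acl k S).toSubalgebra).symm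
    rw [← this]
    exact ⟨p, hp, hpx⟩
  exact acl_le le_rfl h2

theorem mem_acl_union_of_mem_acl_acl {S T : Set Ω} {x : Ω} (hx : x ∈ acl (acl k T) S) :
    x ∈ acl k (T ∪ S) := by
  refine mem_acl_of_isAlgebraic (R := Algebra.adjoin (acl k T) S) (fun r => ?_) hx
  refine Algebra.adjoin_induction (p := fun y _ => y ∈ acl k (T ∪ S)) ?_ ?_ ?_ ?_ r.2
  · intro y hy
    exact mem_acl_of_mem (Or.inr hy)
  · intro c
    exact acl_mono Set.subset_union_left c.2
  · intro y z _ _ hy hz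
    exact add_mem hy hz
  · intro y z _ _ hy hz
    exact mul_mem hy hz

theorem acl_restrictScalars_le {K : IntermediateField k Ω} {S T : Set Ω}
    (h : ∀ y ∈ T, y ∈ acl K S) {x : Ω} (hx : x ∈ acl k T) : x ∈ acl K S := by
  refine mem_acl_of_isAlgebraic (R := Algebra.adjoin k T) (fun r => ?_) hx
  refine Algebra.adjoin_induction (p := fun y _ => y ∈ acl K S) ?_ ?_ ?_ ?_ r.2
  · exact h
  · intro c
    exact (acl K S).algebraMap_mem (algebraMap k K c)
  · intro y z _ _ hy hz
    exact add_mem hy hz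
  · intro y z _ _ hy hz
    exact mul_mem hy hz

theorem mem_acl_acl {S T : Set Ω} {x : Ω} : x ∈ acl (acl k T) S ↔ x ∈ acl k (T ∪ S) := by
  refine ⟨mem_acl_union_of_mem_acl_acl, acl_restrictScalars_le ?_⟩
  rintro y (hy | hy)
  · exact (acl (acl k T) S).algebraMap_mem ⟨y, mem_acl_of_mem hy⟩
  · exact mem_acl_of_mem hy

/-- Elements of `Ω` algebraic over `acl k T` belong to it. -/
theorem exists_algebraMap_acl_eq {T : Set Ω} {x : Ω} (hx : IsAlgebraic (acl k T) x) :
    x ∈ (algebraMap (acl k T) Ω).range :=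
  ⟨⟨x, mem_acl_of_isAlgebraic (fun r => r.2) hx⟩, rfl⟩

theorem transcendental_acl_iff {T : Set Ω} {x : Ω} :
    Transcendental (acl k T) x ↔ x ∉ acl k T := by
  rw [Transcendental, not_iff_not]
  exact ⟨fun hx => mem_acl_of_isAlgebraic (fun r => r.2) hx,
    fun hx => isAlgebraic_algebraMap (R := acl k T) (A := Ω) ⟨x, hx⟩⟩

theorem algebraicIndependent_singleton_acl {T : Set Ω} {x : Ω} (hx : x ∉ acl k T) :
    AlgebraicIndependent (acl k T) ![x] :=
  algebraicIndependent_unique_type_iff.2 (transcendental_acl_iff.2 hx)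

theorem algebraicIndependent_pair {x y : Ω} (hx : Transcendental k x)
    (hy : y ∉ acl k {x}) : AlgebraicIndependent k ![x, y] := by
  have h1 : AlgebraicIndependent k ![x] := algebraicIndependent_unique_type_iff.2 hx
  have h2 := (h1.option_iff_transcendental y).2 (by rw [show Set.range ![x] = {x} by simp]; exact hy)
  have := h2.comp (![some 0, none]) (by decide)
  convert this using 1
  ext i; fin_cases i <;> rfl

theorem algebraicIndependent_pair_acl {T : Set Ω} {x y : Ω} (hx : x ∉ acl k T)
    (hy : y ∉ acl k (insert x T)) : AlgebraicIndependent (acl k T) ![x, y] := by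
  refine algebraicIndependent_pair (transcendental_acl_iff.2 hx) fun h => hy ?_
  have := mem_acl_acl.1 h
  rwa [Set.union_singleton] at this

end

section
variable {k Ω σ : Type*} [Field k] [CharZero k] [Field Ω] [Algebra k Ω] {M : IntermediateField k Ω}

attribute [local instance] MvPolynomial.algebraMvPolynomial

theorem mem_algebraAdjoin_of_mem_acl
    (hk : ∀ x : Ω, IsAlgebraic k x → x ∈ (algebraMap k Ω).range)
    {x : σ → Ω} (hx : AlgebraicIndependent M x) {a : Ω}
    (haM : a ∈ Algebra.adjoin M (Set.range x)) (ha : a ∈ acl k (Set.range x)) :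
    a ∈ Algebra.adjoin k (Set.range x) := by
  rw [Algebra.adjoin_range_eq_range_aeval] at haM
  obtain ⟨P, rfl⟩ := haM
  have hk' : ∀ x : M, IsAlgebraic k x → x ∈ (algebraMap k M).range := by
    intro x hx
    obtain ⟨c, hc⟩ := hk x (hx.algebraMap (A := Ω))
    exact ⟨c, Subtype.ext hc⟩
  have halg : IsAlgebraic (MvPolynomial σ k) P := by
    refine IsAlgebraic.of_ringHom_of_comp_eq (S := (MvPolynomial.aeval (R := k) x).range) (B := Ω)
      (MvPolynomial.aeval (R := k) x).rangeRestrict (MvPolynomial.aeval (R := M) x) ?_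
      (AlgHom.rangeRestrict_surjective _) hx ?_
    · rw [← Algebra.adjoin_range_eq_range_aeval]
      exact ha
    · ext i <;> simp
  obtain ⟨c, rfl⟩ := MvPolynomial.exists_map_eq_of_isAlgebraic hk' P halg
  rw [Algebra.adjoin_range_eq_range_aeval]
  exact ⟨c, (MvPolynomial.aeval_map_algebraMap M x c).symm⟩

theorem mem_algebraAdjoin_of_isRelPrime
    (hk : ∀ x : Ω, IsAlgebraic k x → x ∈ (algebraMap k Ω).range)
    {x : σ → Ω} (hx : AlgebraicIndependent M x) {a : Ω} (Q : MvPolynomial σ M)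
    (D₁ D₂ : Derivation k M M)
    (hrel : IsRelPrime (MvPolynomial.mapDerivation D₁ Q) (MvPolynomial.mapDerivation D₂ Q))
    (hdeg : (MvPolynomial.mapDerivation D₁ Q).totalDegree ≠ 0)
    (haM : a ∈ Algebra.adjoin M (Set.range x))
    (ha : a ∈ acl k (insert (MvPolynomial.aeval x Q) (Set.range x))) :
    a ∈ Algebra.adjoin k (insert (MvPolynomial.aeval x Q) (Set.range x)) := by
  rw [Algebra.adjoin_range_eq_range_aeval] at haM
  obtain ⟨P, rfl⟩ := haM
  have hk' : ∀ x : M, IsAlgebraic k x → x ∈ (algebraMap k M).range := by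
    intro x hx
    obtain ⟨c, hc⟩ := hk x (hx.algebraMap (A := Ω))
    exact ⟨c, Subtype.ext hc⟩
  set q := MvPolynomial.aeval x Q with hq
  have hmap : ∀ c : MvPolynomial σ k, MvPolynomial.aeval (R := M) x
      (algebraMap _ (MvPolynomial σ M) c) = MvPolynomial.aeval x c := by
    intro c
    exact MvPolynomial.aeval_map_algebraMap M x c
  have hmem : ∀ c : MvPolynomial σ k, MvPolynomial.aeval x c ∈
      Algebra.adjoin k (insert q (Set.range x)) := by
    intro c
    refine Algebra.adjoin_mono (Set.subset_insert _ _) ?_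
    rw [Algebra.adjoin_range_eq_range_aeval]
    exact ⟨c, rfl⟩
  have hf : ∀ y ∈ Algebra.adjoin (MvPolynomial σ k) {Q}, MvPolynomial.aeval (R := M) x y ∈
      Algebra.adjoin k (insert q (Set.range x)) := by
    intro y hy
    refine Algebra.adjoin_induction (p := fun y _ => MvPolynomial.aeval (R := M) x y ∈
      Algebra.adjoin k (insert q (Set.range x))) ?_ ?_ ?_ ?_ hy
    · rintro _ rfl
      exact Algebra.subset_adjoin (Set.mem_insert _ _)
    · intro c
      rw [hmap]
      exact hmem c
    · intro y z _ _ hy hz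
      rw [map_add]; exact add_mem hy hz
    · intro y z _ _ hy hz
      rw [map_mul]; exact mul_mem hy hz
  have halg : IsAlgebraic (Algebra.adjoin (MvPolynomial σ k) {Q}) P := by
    let f : Algebra.adjoin (MvPolynomial σ k) {Q} →+* Algebra.adjoin k (insert q (Set.range x)) :=
      ((MvPolynomial.aeval (R := M) x).toRingHom.comp
        (Algebra.adjoin (MvPolynomial σ k) {Q}).val.toRingHom).codRestrict
        (Algebra.adjoin k (insert q (Set.range x))) fun y => hf _ y.2
    refine IsAlgebraic.of_ringHom_of_comp_eq (S := Algebra.adjoin k (insert q (Set.range x)))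
      (B := Ω) f (MvPolynomial.aeval (R := M) x) ha ?_ hx rfl
    rintro ⟨y, hy⟩
    suffices h : ∃ z ∈ Algebra.adjoin (MvPolynomial σ k) {Q}, MvPolynomial.aeval (R := M) x z = y by
      obtain ⟨z, hz, hzy⟩ := h
      exact ⟨⟨z, hz⟩, Subtype.ext hzy⟩
    refine Algebra.adjoin_induction (p := fun y _ => ∃ z ∈ Algebra.adjoin (MvPolynomial σ k) {Q},
      MvPolynomial.aeval (R := M) x z = y) ?_ ?_ ?_ ?_ hy
    · rintro y (rfl | ⟨i, rfl⟩)
      · exact ⟨Q, Algebra.subset_adjoin rfl, rfl⟩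
      · refine ⟨algebraMap (MvPolynomial σ k) _ (MvPolynomial.X i), Subalgebra.algebraMap_mem _ _, ?_⟩
        rw [hmap, MvPolynomial.aeval_X]
    · intro c
      refine ⟨algebraMap (MvPolynomial σ k) _ (MvPolynomial.C c), Subalgebra.algebraMap_mem _ _, ?_⟩
      rw [hmap, MvPolynomial.aeval_C]
    · rintro _ _ _ _ ⟨y, hy, rfl⟩ ⟨z, hz, rfl⟩
      exact ⟨y + z, add_mem hy hz, map_add _ _ _⟩
    · rintro _ _ _ _ ⟨y, hy, rfl⟩ ⟨z, hz, rfl⟩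
      exact ⟨y * z, mul_mem hy hz, map_mul _ _ _⟩
  obtain ⟨f, rfl⟩ := MvPolynomial.exists_aeval_eq_of_isRelPrime hk' Q D₁ D₂ hrel hdeg P halg
  exact hf _ (Polynomial.aeval_mem_adjoin_singleton _ _)

end

end

noncomputable section

namespace MvPolynomial

section
variable {M σ : Type*} [Field M]

theorem totalDegree_ne_zero_of_eval_ne {P : MvPolynomial σ M} (x y : σ → M)
    (h : eval x P ≠ eval y P) : P.totalDegree ≠ 0 := by
  intro h0
  rw [totalDegree_eq_zero_iff_eq_C.1 h0, eval_C, eval_C] at h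
  exact h rfl

theorem irreducible_of_totalDegree_le_one {P : MvPolynomial σ M} (hP : P.totalDegree ≤ 1)
    (x y : σ → M) (h : eval x P ≠ eval y P) : Irreducible P := by
  have h1 : P.totalDegree = 1 :=
    le_antisymm hP (Nat.one_le_iff_ne_zero.2 (totalDegree_ne_zero_of_eval_ne x y h))
  refine irreducible_of_totalDegree_eq_one h1 fun a ha => ?_
  have hne : P ≠ 0 := by
    rintro rfl
    simp at h
  obtain ⟨n, hn⟩ := ne_zero_iff.1 hne
  rw [isUnit_iff_ne_zero]
  rintro rfl
  exact hn (zero_dvd_iff.1 (ha n))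

theorem totalDegree_affine_le (a b c : M) :
    (C a * X 0 + C b * X 1 + C c : MvPolynomial (Fin 2) M).totalDegree ≤ 1 := by
  refine (totalDegree_add _ _).trans (max_le ((totalDegree_add _ _).trans (max_le ?_ ?_)) ?_)
  · exact (totalDegree_mul _ _).trans (by simp)
  · exact (totalDegree_mul _ _).trans (by simp)
  · simp

theorem isRelPrime_of_eval {P Q : MvPolynomial σ M} (hP : Irreducible P) (x : σ → M)
    (hx : eval x P = 0) (hQ : eval x Q ≠ 0) : IsRelPrime P Q := by
  rw [hP.isRelPrime_iff_not_dvd]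
  rintro ⟨R, rfl⟩
  exact hQ (by rw [map_mul, hx, zero_mul])

/-- Coprimality of the standard pair of products of lines. -/
theorem isRelPrime_lines (g₁ g₂ : M) (hg : g₁ ≠ 0 ∨ g₂ ≠ 0) :
    IsRelPrime (X 0 * ((1 - X 0 - X 1) + C g₁ * X 1) : MvPolynomial (Fin 2) M)
      (X 1 * ((1 - X 0 - X 1) + C g₂ * X 0)) := by
  have e1 : ((1 - X 0 - X 1) + C g₁ * X 1 : MvPolynomial (Fin 2) M) =
      C (-1) * X 0 + C (g₁ - 1) * X 1 + C 1 := by simp; ring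
  have i0 : Irreducible (X 0 : MvPolynomial (Fin 2) M) :=
    irreducible_of_totalDegree_le_one (by simp) ![0, 0] ![1, 0] (by simp)
  have i1 : Irreducible ((1 - X 0 - X 1) + C g₁ * X 1 : MvPolynomial (Fin 2) M) :=
    irreducible_of_totalDegree_le_one (by rw [e1]; exact totalDegree_affine_le _ _ _)
      ![0, 0] ![1, 0] (by simp)
  refine IsRelPrime.mul_left (IsRelPrime.mul_right ?_ ?_) (IsRelPrime.mul_right ?_ ?_)
  · exact isRelPrime_of_eval i0 ![0, 1] (by simp) (by simp)
  · exact isRelPrime_of_eval i0 ![0, 0] (by simp) (by simp)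
  · exact isRelPrime_of_eval i1 ![g₁, 1] (by simp) (by simp)
  · by_cases h2 : g₂ = 0
    · have h1 : g₁ ≠ 0 := by tauto
      exact isRelPrime_of_eval i1 ![g₁, 1] (by simp) (by simpa [h2] using h1)
    · exact isRelPrime_of_eval i1 ![1, 0] (by simp) (by simpa using h2)

theorem isRelPrime_map_iff {A B : Type*} [CommMonoid A] [CommMonoid B] (f : A ≃* B) {x y : A} :
    IsRelPrime (f x) (f y) ↔ IsRelPrime x y := by
  constructor
  · intro h d hx hy
    have := h (map_dvd f hx) (map_dvd f hy)
    simpa using this.map f.symm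
  · intro h d hx hy
    have := @h (f.symm d) (by simpa using map_dvd f.symm hx) (by simpa using map_dvd f.symm hy)
    simpa using this.map f

/-- Two affine forms with invertible linear part as new coordinates. -/
theorem exists_affine_equiv {c₁ c₂ : MvPolynomial (Fin 2) M} {a b c d e f : M}
    (hX : C a * c₁ + C b * c₂ + C c = X 0) (hY : C d * c₁ + C e * c₂ + C f = X 1)
    (h1 : aeval ![C a * X 0 + C b * X 1 + C c, C d * X 0 + C e * X 1 + C f] c₁
      = (X 0 : MvPolynomial (Fin 2) M))
    (h2 : aeval ![C a * X 0 + C b * X 1 + C c, C d * X 0 + C e * X 1 + C f] c₂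
      = (X 1 : MvPolynomial (Fin 2) M)) :
    ∃ φ : MvPolynomial (Fin 2) M ≃ₐ[M] MvPolynomial (Fin 2) M, φ (X 0) = c₁ ∧ φ (X 1) = c₂ := by
  refine ⟨AlgEquiv.ofAlgHom (aeval ![c₁, c₂])
    (aeval ![C a * X 0 + C b * X 1 + C c, C d * X 0 + C e * X 1 + C f]) ?_ ?_, ?_, ?_⟩
  · refine algHom_ext fun i => ?_
    fin_cases i
    · simpa [algebraMap_eq] using hX
    · simpa [algebraMap_eq] using hY
  · refine algHom_ext fun i => ?_
    fin_cases i
    · simpa using h1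
    · simpa using h2
  · simp
  · simp

end

end MvPolynomial
end

noncomputable section

namespace MvPolynomial

section
attribute [local instance] MvPolynomial.algebraMvPolynomial
variable {k M : Type*} [Field k] [Field M] [Algebra k M]

theorem exists_conic_coordinates (a b d : M) (hG : 4 * a * b - (a + b - d) ^ 2 ≠ 0) :
    ∃ φ : MvPolynomial (Fin 2) M ≃ₐ[M] MvPolynomial (Fin 2) M,
      C (2 * a) * φ (X 0) + C (a + b - d) * φ (X 1) + C (-a) = X 0 ∧
      C (a + b - d) * φ (X 0) + C (2 * b) * φ (X 1) + C (-b) = X 1 ∧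
      ∀ D : Derivation k M M, mapDerivation D
        (φ (C a * X 0 ^ 2 + C (a + b - d) * (X 0 * X 1) + C b * X 1 ^ 2)) =
        φ (C (D a) * (X 0 * (1 - X 0 - X 1)) + C (D b) * (X 1 * (1 - X 0 - X 1)) +
          C (D d) * (X 0 * X 1)) := by
  set S := a + b - d with hS
  set G := 4 * a * b - S ^ 2 with hGdef
  set c₁ : MvPolynomial (Fin 2) M :=
    C G⁻¹ * (C (2 * b) * (X 0 + C a) - C S * (X 1 + C b)) with hc₁
  set c₂ : MvPolynomial (Fin 2) M :=
    C G⁻¹ * (C (2 * a) * (X 1 + C b) - C S * (X 0 + C a)) with hc₂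
  have C2 : (C 2 : MvPolynomial (Fin 2) M) = 2 := map_ofNat C 2
  have C4 : (C 4 : MvPolynomial (Fin 2) M) = 4 := map_ofNat C 4
  have hGC : (C G⁻¹ * (4 * C a * C b - C S ^ 2) : MvPolynomial (Fin 2) M) = 1 := by
    have : (4 * C a * C b - C S ^ 2 : MvPolynomial (Fin 2) M) = C G := by
      rw [hGdef]; simp [C4]
    rw [this, ← C_mul, inv_mul_cancel₀ hG, C_1]
  have hX : C (2 * a) * c₁ + C S * c₂ + C (-a) = X 0 := by
    rw [hc₁, hc₂]; simp only [C_mul, C_neg, map_ofNat]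
    linear_combination (X 0 + C a) * hGC
  have hY : C S * c₁ + C (2 * b) * c₂ + C (-b) = X 1 := by
    rw [hc₁, hc₂]; simp only [C_mul, C_neg, map_ofNat]
    linear_combination (X 1 + C b) * hGC
  obtain ⟨φ, h0, h1⟩ := exists_affine_equiv hX hY
    (by rw [hc₁]; simp [algebraMap_eq]; simp only [C2]; linear_combination X 0 * hGC)
    (by rw [hc₂]; simp [algebraMap_eq]; simp only [C2]; linear_combination X 1 * hGC)
  refine ⟨φ, by rw [h0, h1]; exact hX, by rw [h0, h1]; exact hY, fun D => ?_⟩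
  have hφC : ∀ m : M, φ (C m) = C m := fun m => φ.commutes m
  simp only [map_add, map_sub, map_mul, map_pow, map_one, h0, h1, hφC]
  have dX := congrArg (mapDerivation D) hX
  have dY := congrArg (mapDerivation D) hY
  have two : D 2 = 0 := by
    have := D.map_natCast 2
    simpa using this
  simp only [map_add, Derivation.leibniz, mapDerivation_C, mapDerivation_X, smul_eq_mul,
    map_neg, two, mul_zero, add_zero] at dX dY ⊢
  simp only [Derivation.leibniz_pow, smul_eq_mul]
  have hDS : D S = D a + D b - D d := by rw [hS]; simp
  rw [hDS] at dX dY ⊢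
  simp only [C_mul, C_add, C_sub, map_ofNat] at dX dY ⊢
  simp
  linear_combination c₁ * dX + c₂ * dY

theorem totalDegree_algEquiv_ne_zero (φ : MvPolynomial (Fin 2) M ≃ₐ[M] MvPolynomial (Fin 2) M)
    {P : MvPolynomial (Fin 2) M} (x y : Fin 2 → M) (h : eval x P ≠ eval y P) :
    (φ P).totalDegree ≠ 0 := by
  intro h0
  rw [totalDegree_eq_zero_iff_eq_C] at h0
  have : P = C (coeff 0 (φ P)) := by
    apply φ.injective
    conv_lhs => rw [h0]
    exact (φ.commutes _).symm
  rw [this, eval_C, eval_C] at h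
  exact h rfl

end

end MvPolynomial
end

noncomputable section

section
variable {k Ω : Type*} [Field k] [Field Ω] [Algebra k Ω]

theorem mem_algebraAdjoin_of_le {K L : IntermediateField k Ω} (h : K ≤ L) {S : Set Ω}
    {B : Subalgebra L Ω} (hS : ∀ y ∈ S, y ∈ B) {a : Ω} (ha : a ∈ Algebra.adjoin K S) : a ∈ B := by
  refine Algebra.adjoin_induction (p := fun y _ => y ∈ B) hS ?_ ?_ ?_ ha
  · intro c
    exact B.algebraMap_mem ⟨c, h c.2⟩
  · intro y z _ _ hy hz
    exact add_mem hy hz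
  · intro y z _ _ hy hz
    exact mul_mem hy hz

theorem IntermediateField.mem_subalgebra_of_mem {L : IntermediateField k Ω} (B : Subalgebra L Ω)
    {x : Ω} (hx : x ∈ L) : x ∈ B := B.algebraMap_mem ⟨x, hx⟩

theorem independent_of_pair_mem_acl {U : Set Ω} {p q x y : Ω} (hp : p ∉ acl k U)
    (hq : q ∉ acl k (insert p U)) (hpx : p ∈ acl k (insert y (insert x U)))
    (hqx : q ∈ acl k (insert y (insert x U))) :
    x ∉ acl k U ∧ y ∉ acl k (insert x U) := by
  constructor
  · intro hx
    have hle : acl k (insert y (insert x U)) ≤ acl k (insert y U) :=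
      acl_le (Set.insert_subset (mem_acl_of_mem (Set.mem_insert _ _))
        (Set.insert_subset (acl_mono (Set.subset_insert _ _) hx)
          ((Set.subset_insert _ _).trans (subset_acl _))))
    exact not_both_mem_acl_insert hp hq (hle hpx) (hle hqx)
  · intro hy
    have hle : acl k (insert y (insert x U)) ≤ acl k (insert x U) :=
      acl_insert_le le_rfl hy
    exact not_both_mem_acl_insert hp hq (hle hpx) (hle hqx)

end

section
variable {k Ω : Type*} [Field k] [CharZero k] [Field Ω] [Algebra k Ω]

omit [CharZero k] in
theorem degree_one_independent {U : Set Ω} {p q z w : Ω} (hz : z ∈ acl k U) (hw : w ∈ acl k U)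
    (hp : p ∉ acl k U) (hq : q ∉ acl k (insert p U)) :
    (p - z) * (q - w) ∉ acl k (insert p U) := by
  have hle : acl k U ≤ acl k (insert p U) := acl_mono (Set.subset_insert _ _)
  have hpp : p ∈ acl k (insert p U) := mem_acl_of_mem (Set.mem_insert _ _)
  have hpz : p - z ≠ 0 := by
    intro h
    rw [sub_eq_zero.1 h] at hp
    exact hp hz
  intro h
  apply hq
  have hqe : q = (p - z)⁻¹ * ((p - z) * (q - w)) + w := by field_simp; ring
  rw [hqe]
  exact add_mem (mul_mem (inv_mem (sub_mem hpp (hle hz))) h) (hle hw)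

theorem degree_one_descent (hk : ∀ x : Ω, IsAlgebraic k x → x ∈ (algebraMap k Ω).range)
    {U : Set Ω} {p q z w : Ω} (hz : z ∈ acl k U) (hw : w ∈ acl k U) (hp : p ∉ acl k U)
    (hq : q ∉ acl k (insert p U)) {a : Ω} (haM : a ∈ Algebra.adjoin (acl k U) {p, q})
    (ha : a ∈ acl k {(p - z) * (q - w)}) : a ∈ Algebra.adjoin k {(p - z) * (q - w)} := by
  set l := (p - z) * (q - w) with hl
  have hle : acl k U ≤ acl k (insert p U) := acl_mono (Set.subset_insert _ _)
  have hpp : p ∈ acl k (insert p U) := mem_acl_of_mem (Set.mem_insert _ _)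
  have hpz : p - z ≠ 0 := by
    intro h
    rw [sub_eq_zero.1 h] at hp
    exact hp hz
  have hqe : q = (p - z)⁻¹ * l + w := by
    rw [hl]; field_simp; ring
  have hlM : l ∉ acl k (insert p U) := degree_one_independent hz hw hp hq
  have hr : Set.range ![l] = {l} := by simp
  have := mem_algebraAdjoin_of_mem_acl hk (algebraicIndependent_singleton_acl hlM) (a := a)
    (mem_algebraAdjoin_of_le hle ?_ haM) (by rw [hr]; exact ha)
  · rwa [hr] at this
  rw [hr]
  rintro y (rfl | rfl)
  · exact IntermediateField.mem_subalgebra_of_mem _ hpp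
  · rw [hqe]
    exact add_mem (mul_mem (IntermediateField.mem_subalgebra_of_mem _
      (inv_mem (sub_mem hpp (hle hz)))) (Algebra.subset_adjoin rfl))
      (IntermediateField.mem_subalgebra_of_mem _ (hle hw))

omit [CharZero k] in
theorem degree_two_independent {U : Set Ω} {p q z w z' w' : Ω} 
    (hz : z ∈ acl k U) (hw : w ∈ acl k U) (hz' : z' ∈ acl k U) (hw' : w' ∈ acl k U)
    (hp : p ∉ acl k U) (hq : q ∉ acl k (insert p U)) (hzz : z ≠ z') (hww : w ≠ w') :
    (p - z) * (q - w) ∉ acl k U ∧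
      (p - z') * (q - w') ∉ acl k (insert ((p - z) * (q - w)) U) := by
  set l := (p - z) * (q - w) with hl
  set l' := (p - z') * (q - w') with hl'
  have hle : acl k U ≤ acl k (insert l' (insert l U)) :=
    acl_mono ((Set.subset_insert _ _).trans (Set.subset_insert _ _))
  have h1 : l ∈ acl k (insert l' (insert l U)) := mem_acl_of_mem (by simp)
  have h2 : l' ∈ acl k (insert l' (insert l U)) := mem_acl_of_mem (by simp)
  have hzz' : z' - z ≠ 0 := sub_ne_zero.2 (Ne.symm hzz)
  have hww' : w' - w ≠ 0 := sub_ne_zero.2 (Ne.symm hww)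
  have hqe : q - w = ((l - l' + (z' - z) * (w' - w)) - (p - z) * (w' - w)) * (z' - z)⁻¹ := by
    field_simp
    rw [hl, hl']; ring
  have hpe : p ∈ acl k (insert l' (insert l U)) := by
    set K := acl k (insert l' (insert l U)) with hK
    have hA : (w' - w) ∈ K := hle (sub_mem hw' hw)
    have hB : (l - l' + (z' - z) * (w' - w)) ∈ K :=
      add_mem (sub_mem h1 h2) (hle (mul_mem (sub_mem hz' hz) (sub_mem hw' hw)))
    have hC : l * (z' - z) ∈ K := mul_mem h1 (hle (sub_mem hz' hz))
    let P : Polynomial K := Polynomial.C ⟨_, hA⟩ * Polynomial.X ^ 2 +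
      Polynomial.C (-⟨_, hB⟩) * Polynomial.X + Polynomial.C ⟨_, hC⟩
    have hA0 : (⟨_, hA⟩ : K) ≠ 0 := fun h => hww' (congrArg Subtype.val h)
    have hP : P ≠ 0 := by
      intro h
      have := Polynomial.natDegree_quadratic (b := -⟨_, hB⟩) (c := ⟨_, hC⟩) hA0
      change P.natDegree = 2 at this
      rw [h] at this
      simp at this
    have hroot : Polynomial.aeval (p - z) P = 0 := by
      simp only [P, map_add, map_mul, map_pow, Polynomial.aeval_C, Polynomial.aeval_X, map_neg]
      change (w' - w) * (p - z) ^ 2 + -(l - l' + (z' - z) * (w' - w)) * (p - z)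
        + l * (z' - z) = 0
      have e : (q - w) * (z' - z) = ((l - l' + (z' - z) * (w' - w)) - (p - z) * (w' - w)) := by
        rw [hqe, mul_assoc, inv_mul_cancel₀ hzz', mul_one]
      have e2 : l = (p - z) * (q - w) := hl
      linear_combination (p - z) * e + (z' - z) * e2
    have : p - z ∈ K := mem_acl_of_isAlgebraic (fun r => r.2) ⟨P, hP, hroot⟩
    have := add_mem this (hle hz)
    rwa [sub_add_cancel] at this
  have hqm : q ∈ acl k (insert l' (insert l U)) := by
    have : q = ((l - l' + (z' - z) * (w' - w)) - (p - z) * (w' - w)) * (z' - z)⁻¹ + w := by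
      rw [← hqe]; ring
    rw [this]
    exact add_mem (mul_mem (sub_mem (add_mem (sub_mem h1 h2)
      (hle (mul_mem (sub_mem hz' hz) (sub_mem hw' hw))))
      (mul_mem (sub_mem hpe (hle hz)) (hle (sub_mem hw' hw)))) (inv_mem (hle (sub_mem hz' hz))))
      (hle hw)
  exact independent_of_pair_mem_acl hp hq hpe hqm

end
end

noncomputable section

section
variable {k Ω : Type*} [Field k] [CharZero k] [Field Ω] [Algebra k Ω]

omit [CharZero k] in
theorem normalized_independent {U : Set Ω} {p q z w z' w' : Ω}
    (hz : z ∈ acl k U) (hw : w ∈ acl k U) (hz' : z' ∈ acl k U) (hw' : w' ∈ acl k U)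
    (hp : p ∉ acl k U) (hq : q ∉ acl k (insert p U)) (hzz : z ≠ z') (hww : w ≠ w') :
    (p - z) / (z' - z) ∉ acl k U ∧
      (q - w) / (w' - w) ∉ acl k (insert ((p - z) / (z' - z)) U) := by
  set x := (p - z) / (z' - z) with hx
  set y := (q - w) / (w' - w) with hy
  have hzz' : z' - z ≠ 0 := sub_ne_zero.2 (Ne.symm hzz)
  have hww' : w' - w ≠ 0 := sub_ne_zero.2 (Ne.symm hww)
  have hle : acl k U ≤ acl k (insert y (insert x U)) :=
    acl_mono ((Set.subset_insert _ _).trans (Set.subset_insert _ _))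
  have h1 : x ∈ acl k (insert y (insert x U)) := mem_acl_of_mem (by simp)
  have h2 : y ∈ acl k (insert y (insert x U)) := mem_acl_of_mem (by simp)
  have hpe : p = (z' - z) * x + z := by rw [hx]; field_simp; ring
  have hqe : q = (w' - w) * y + w := by rw [hy]; field_simp; ring
  refine independent_of_pair_mem_acl hp hq ?_ ?_
  · rw [hpe]
    exact add_mem (mul_mem (hle (sub_mem hz' hz)) h1) (hle hz)
  · rw [hqe]
    exact add_mem (mul_mem (hle (sub_mem hw' hw)) h2) (hle hw)

omit [CharZero k] in
theorem normalized_subset_adjoin {U : Set Ω} {p q z w z' w' : Ω}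
    (hz : z ∈ acl k U) (hw : w ∈ acl k U) (hz' : z' ∈ acl k U) (hw' : w' ∈ acl k U)
    (hzz : z ≠ z') (hww : w ≠ w') {a : Ω}
    (haM : a ∈ Algebra.adjoin (acl k U) {p, q}) :
    a ∈ Algebra.adjoin (acl k U)
      (Set.range ![(p - z) / (z' - z), (q - w) / (w' - w)]) := by
  have hzz' : z' - z ≠ 0 := sub_ne_zero.2 (Ne.symm hzz)
  have hww' : w' - w ≠ 0 := sub_ne_zero.2 (Ne.symm hww)
  refine mem_algebraAdjoin_of_le le_rfl ?_ haM
  have hpe : p = (z' - z) * ((p - z) / (z' - z)) + z := by field_simp; ring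
  have hqe : q = (w' - w) * ((q - w) / (w' - w)) + w := by field_simp; ring
  rintro y (rfl | rfl)
  · have h1 := add_mem (mul_mem (IntermediateField.mem_subalgebra_of_mem
      (Algebra.adjoin (acl k U) (Set.range ![(y - z) / (z' - z), (q - w) / (w' - w)]))
      (sub_mem hz' hz)) (Algebra.subset_adjoin ⟨0, rfl⟩))
      (IntermediateField.mem_subalgebra_of_mem _ hz)
    exact (congrArg (· ∈ Algebra.adjoin (acl k U) _) hpe).mpr h1
  · have h1 := add_mem (mul_mem (IntermediateField.mem_subalgebra_of_mem
      (Algebra.adjoin (acl k U) (Set.range ![(p - z) / (z' - z), (y - w) / (w' - w)]))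
      (sub_mem hw' hw)) (Algebra.subset_adjoin ⟨1, rfl⟩))
      (IntermediateField.mem_subalgebra_of_mem _ hw)
    exact (congrArg (· ∈ Algebra.adjoin (acl k U) _) hqe).mpr h1

theorem degree_two_descent_of_mem
    (hk : ∀ x : Ω, IsAlgebraic k x → x ∈ (algebraMap k Ω).range)
    {U : Set Ω} {p q z w z' w' : Ω}
    (hz : z ∈ acl k U) (hw : w ∈ acl k U) (hz' : z' ∈ acl k U) (hw' : w' ∈ acl k U)
    (hp : p ∉ acl k U) (hq : q ∉ acl k (insert p U)) (hzz : z ≠ z') (hww : w ≠ w')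
    (hD : (z' - z) * (w' - w) ∈ (algebraMap k Ω).range)
    {a : Ω} (haM : a ∈ Algebra.adjoin (acl k U) {p, q})
    (ha : a ∈ acl k {(p - z) * (q - w), (p - z') * (q - w')}) :
    a ∈ Algebra.adjoin k {(p - z) / (z' - z), (q - w) / (w' - w)} := by
  have hzz' : z' - z ≠ 0 := sub_ne_zero.2 (Ne.symm hzz)
  have hww' : w' - w ≠ 0 := sub_ne_zero.2 (Ne.symm hww)
  obtain ⟨h1, h2⟩ := normalized_independent hz hw hz' hw' hp hq hzz hww
  have hM := normalized_subset_adjoin hz hw hz' hw' hzz hww haM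
  set x := (p - z) / (z' - z) with hx
  set y := (q - w) / (w' - w) with hy
  have hr : Set.range ![x, y] = {x, y} := by simp [Set.pair_comm]
  have hpe : p - z = (z' - z) * x := by rw [hx]; field_simp
  have hqe : q - w = (w' - w) * y := by rw [hy]; field_simp
  have hDk : (z' - z) * (w' - w) ∈ acl k {x, y} := by
    obtain ⟨c, hc⟩ := hD
    rw [← hc]
    exact (acl k {x, y}).algebraMap_mem c
  have hxm : x ∈ acl k {x, y} := mem_acl_of_mem (by simp)
  have hym : y ∈ acl k {x, y} := mem_acl_of_mem (by simp)
  have := mem_algebraAdjoin_of_mem_acl hk (algebraicIndependent_pair_acl h1 h2) hM ?_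
  · rwa [hr] at this
  rw [hr]
  refine acl_le ?_ ha
  rintro _ (rfl | rfl)
  · have : (p - z) * (q - w) = ((z' - z) * (w' - w)) * (x * y) := by rw [hpe, hqe]; ring
    rw [this]
    exact mul_mem hDk (mul_mem hxm hym)
  · have : (p - z') * (q - w') = ((z' - z) * (w' - w)) * ((x - 1) * (y - 1)) := by
      rw [show p - z' = (p - z) - (z' - z) by ring, show q - w' = (q - w) - (w' - w) by ring,
        hpe, hqe]
      ring
    rw [this]
    exact mul_mem hDk (mul_mem (sub_mem hxm (one_mem _)) (sub_mem hym (one_mem _)))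

attribute [local instance] MvPolynomial.algebraMvPolynomial

open MvPolynomial in
theorem degree_two_descent_of_notMem
    (hk : ∀ x : Ω, IsAlgebraic k x → x ∈ (algebraMap k Ω).range)
    {U : Set Ω} {p q z w z' w' : Ω}
    (hz : z ∈ acl k U) (hw : w ∈ acl k U) (hz' : z' ∈ acl k U) (hw' : w' ∈ acl k U)
    (hp : p ∉ acl k U) (hq : q ∉ acl k (insert p U))
    (hD : (z' - z) * (w' - w) ∉ (algebraMap k Ω).range)
    {a : Ω} (haM : a ∈ Algebra.adjoin (acl k U) {p, q})
    (ha : a ∈ acl k {(p - z) * (q - w), (p - z') * (q - w')}) :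
    a ∈ Algebra.adjoin k {(p - z) * (q - w), (p - z') * (q - w')} := by
  have hzz' : z' - z ≠ 0 := fun h => hD (by rw [h, zero_mul]; exact zero_mem _)
  have hww' : w' - w ≠ 0 := fun h => hD (by rw [h, mul_zero]; exact zero_mem _)
  have hzz : z ≠ z' := fun h => hzz' (sub_eq_zero.2 h.symm)
  have hww : w ≠ w' := fun h => hww' (sub_eq_zero.2 h.symm)
  obtain ⟨h1, h2⟩ := normalized_independent hz hw hz' hw' hp hq hzz hww
  have hM := normalized_subset_adjoin hz hw hz' hw' hzz hww haM
  set x := (p - z) / (z' - z) with hx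
  set y := (q - w) / (w' - w) with hy
  have hpe : p - z = (z' - z) * x := by rw [hx]; field_simp
  have hqe : q - w = (w' - w) * y := by rw [hy]; field_simp
  set d := (z' - z) * (w' - w) with hd
  have hdU : d ∈ acl k U := mul_mem (sub_mem hz' hz) (sub_mem hw' hw)
  have hd0 : d ≠ 0 := mul_ne_zero hzz' hww'
  have hl1 : (p - z) * (q - w) = d * (x * y) := by rw [hpe, hqe, hd]; ring
  have hl2 : (p - z') * (q - w') = d * ((x - 1) * (y - 1)) := by
    rw [show p - z' = (p - z) - (z' - z) by ring, show q - w' = (q - w) - (w' - w) by ring,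
      hpe, hqe, hd]
    ring
  rw [hl1, hl2] at ha ⊢
  set t := x - y with ht
  set s := d * (x + y - 1) with hs
  have hC : CharZero Ω := charZero_of_injective_algebraMap (algebraMap k Ω).injective
  have hxe : x = (s / d + 1 + t) / 2 := by rw [hs, ht]; field_simp; ring
  have hye : y = (s / d + 1 - t) / 2 := by rw [hs, ht]; field_simp; ring
  have hle : acl k U ≤ acl k (insert t U) := acl_mono (Set.subset_insert _ _)
  have htm : t ∈ acl k (insert t U) := mem_acl_of_mem (by simp)
  have hxy : x ∈ acl k (insert s (insert t U)) ∧ y ∈ acl k (insert s (insert t U)) := by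
    have a1 : s ∈ acl k (insert s (insert t U)) := mem_acl_of_mem (by simp)
    have a2 : t ∈ acl k (insert s (insert t U)) := mem_acl_of_mem (by simp)
    have a3 : d ∈ acl k (insert s (insert t U)) := acl_mono (Set.subset_insert _ _) (hle hdU)
    have a4 : (2 : Ω) ∈ acl k (insert s (insert t U)) := ofNat_mem _ 2
    exact ⟨hxe ▸ div_mem (add_mem (add_mem (div_mem a1 a3) (one_mem _)) a2) a4,
      hye ▸ div_mem (sub_mem (add_mem (div_mem a1 a3) (one_mem _)) a2) a4⟩
  obtain ⟨ht0, hs0⟩ := independent_of_pair_mem_acl h1 h2 hxy.1 hxy.2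
  set M := acl k (insert t U) with hMdef
  have hind : AlgebraicIndependent M ![s] := algebraicIndependent_singleton_acl hs0
  let dM : M := ⟨d, hle hdU⟩
  let tM : M := ⟨t, htm⟩
  have hdM0 : dM ≠ 0 := fun h => hd0 (congrArg Subtype.val h)
  have hdt : AlgebraicIndependent k ![dM, tM] := by
    refine AlgebraicIndependent.of_comp M.val ?_
    have hh : AlgebraicIndependent k ![d, t] := by
      refine algebraicIndependent_pair (fun h => hD (hk d h)) fun h => ht0 ?_
      exact acl_le (Set.singleton_subset_iff.2 hdU) h
    convert hh using 1
    ext i; fin_cases i <;> rfl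
  obtain ⟨D₁, hD₁⟩ := hdt.exists_derivation ![1, 0]
  obtain ⟨D₂, hD₂⟩ := hdt.exists_derivation ![0, 1]
  have d1d : D₁ dM = 1 := hD₁ 0
  have d1t : D₁ tM = 0 := hD₁ 1
  have d2d : D₂ dM = 0 := hD₂ 0
  have d2t : D₂ tM = 1 := hD₂ 1
  let Q : MvPolynomial (Fin 1) M := C (1 / 4) * (C dM⁻¹ * X 0 ^ 2 + 2 * X 0 + C dM
    - C (dM * tM ^ 2))
  have hCM : CharZero M := charZero_of_injective_algebraMap (algebraMap k M).injective
  have hQe : aeval ![s] Q = d * (x * y) := by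
    simp only [Q, map_sub, map_add, map_mul, map_pow, aeval_X, map_ofNat]
    simp only [algHom_C]
    change ((1 / 4 : M) : Ω) * (d⁻¹ * s ^ 2 + 2 * s + d - d * t ^ 2) = _
    have h4 : ((1 / 4 : M) : Ω) = 1 / 4 := by
      rw [← IntermediateField.algebraMap_apply, map_div₀, map_one, map_ofNat]
    rw [h4, hs, ht]
    field_simp
    ring
  have c4 : ∀ D : Derivation k M M, D (1 / 4) = 0 := fun D => by
    have := D.map_algebraMap (1 / 4)
    rwa [map_div₀, map_one, map_ofNat] at this
  have c2 : ∀ D : Derivation k M M, mapDerivation D (2 : MvPolynomial (Fin 1) M) = 0 := fun D => by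
    exact (mapDerivation (σ := Fin 1) D).map_natCast 2
  have e1 : mapDerivation D₁ Q = C (1 / 4) * (-C (dM⁻¹ ^ 2) * X 0 ^ 2 + 1 - C (tM ^ 2)) := by
    simp only [Q, map_sub, map_add, Derivation.leibniz, Derivation.leibniz_pow, mapDerivation_C,
      mapDerivation_X, smul_eq_mul, c4, c2, Derivation.leibniz_inv, d1d, d1t]
    simp
    ring
  have e2 : mapDerivation D₂ Q = C (-(dM * tM) / 2) := by
    simp only [Q, map_sub, map_add, Derivation.leibniz, Derivation.leibniz_pow, mapDerivation_C,
      mapDerivation_X, smul_eq_mul, c4, c2, Derivation.leibniz_inv, d2d, d2t]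
    simp only [mul_zero, map_zero, smul_zero, add_zero, zero_sub, mul_one]
    rw [← C_neg, ← C_mul]
    congr 1
    simp
    ring
  have htM0 : tM ≠ 0 := fun h => ht0 (by rw [show t = 0 from congrArg Subtype.val h]; exact zero_mem _)
  have hrel : IsRelPrime (mapDerivation D₁ Q) (mapDerivation D₂ Q) := by
    rw [e2]
    refine IsUnit.isRelPrime_right ?_
    refine IsUnit.map C ?_
    rw [isUnit_iff_ne_zero]
    exact div_ne_zero (neg_ne_zero.2 (mul_ne_zero hdM0 htM0)) two_ne_zero
  have hdeg : (mapDerivation D₁ Q).totalDegree ≠ 0 := by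
    rw [e1]
    refine totalDegree_ne_zero_of_eval_ne ![0] ![1] ?_
    intro h
    simp at h
    exact hdM0 h
  have hr : Set.range ![s] = {s} := by simp
  have hfin := mem_algebraAdjoin_of_isRelPrime hk hind Q D₁ D₂ hrel hdeg (a := a) ?_ ?_
  · rw [hQe, hr] at hfin
    refine Algebra.adjoin_le ?_ hfin
    rintro _ (rfl | rfl)
    · exact Algebra.subset_adjoin (by simp)
    · have : s = d * (x * y) - d * ((x - 1) * (y - 1)) := by rw [hs]; ring
      rw [this]
      exact sub_mem (Algebra.subset_adjoin (by simp)) (Algebra.subset_adjoin (by simp))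
  · refine mem_algebraAdjoin_of_le hle ?_ hM
    have a1 : s ∈ Algebra.adjoin M (Set.range ![s]) := Algebra.subset_adjoin (by simp)
    have a2 : t ∈ Algebra.adjoin M (Set.range ![s]) :=
      IntermediateField.mem_subalgebra_of_mem _ htm
    have a3 : d⁻¹ ∈ Algebra.adjoin M (Set.range ![s]) :=
      IntermediateField.mem_subalgebra_of_mem _ (inv_mem (hle hdU))
    have a4 : (2 : Ω)⁻¹ ∈ Algebra.adjoin M (Set.range ![s]) :=
      IntermediateField.mem_subalgebra_of_mem _ (inv_mem (ofNat_mem _ 2))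
    rintro _ ⟨i, rfl⟩
    fin_cases i
    · change x ∈ _
      rw [hxe, div_eq_mul_inv, div_eq_mul_inv]
      exact mul_mem (add_mem (add_mem (mul_mem a1 a3) (one_mem _)) a2) a4
    · change y ∈ _
      rw [hye, div_eq_mul_inv, div_eq_mul_inv]
      exact mul_mem (sub_mem (add_mem (mul_mem a1 a3) (one_mem _)) a2) a4
  · rw [hQe, hr]
    refine acl_le ?_ ha
    have b1 : s ∈ acl k ({d * (x * y), s} : Set Ω) := mem_acl_of_mem (by simp)
    have b2 : d * (x * y) ∈ acl k ({d * (x * y), s} : Set Ω) := mem_acl_of_mem (by simp)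
    rintro _ (rfl | rfl)
    · exact b2
    · have : d * ((x - 1) * (y - 1)) = d * (x * y) - s := by rw [hs]; ring
      rw [this]
      exact sub_mem b2 b1

end
end

noncomputable section

attribute [local instance] MvPolynomial.algebraMvPolynomial

section
variable {k Ω : Type*} [Field k] [Field Ω] [Algebra k Ω]

/-- `(P, Q)` is generic over the origin and the independent vectors `(α₂, β₂)`, `(α₃, β₃)`,
all of which are algebraic over `U`. -/
structure GenericStar (k : Type*) {Ω : Type*} [Field k] [Field Ω] [Algebra k Ω] (U : Set Ω)
    (P Q α₂ β₂ α₃ β₃ : Ω) : Prop where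
  left : P ∉ acl k U
  right : Q ∉ acl k (insert P U)
  α₂_mem : α₂ ∈ acl k U
  β₂_mem : β₂ ∈ acl k U
  α₃_mem : α₃ ∈ acl k U
  β₃_mem : β₃ ∈ acl k U
  det : α₂ * β₃ ≠ α₃ * β₂

namespace GenericStar
variable {U : Set Ω} {P Q α₂ β₂ α₃ β₃ : Ω}

open MvPolynomial

/-- The conic attached to the squared distances `a`, `b`, `d`. -/
def conic {M : Type*} [CommRing M] (a b d : M) : MvPolynomial (Fin 2) M :=
  C a * X 0 ^ 2 + C (a + b - d) * (X 0 * X 1) + C b * X 1 ^ 2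

theorem exists_coordinates (h : GenericStar k U P Q α₂ β₂ α₃ β₃) :
    ∃ a b d : acl k U, (a : Ω) = α₂ * β₂ ∧ (b : Ω) = α₃ * β₃ ∧
      (d : Ω) = (α₃ - α₂) * (β₃ - β₂) ∧
      ∃ φ : MvPolynomial (Fin 2) (acl k U) ≃ₐ[acl k U] MvPolynomial (Fin 2) (acl k U),
        (∀ D : Derivation k (acl k U) (acl k U), mapDerivation D (φ (conic a b d)) =
          φ (C (D a) * (X 0 * (1 - X 0 - X 1)) + C (D b) * (X 1 * (1 - X 0 - X 1)) +
            C (D d) * (X 0 * X 1))) ∧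
        ∃ x : Fin 2 → Ω, x 0 = P * Q - (P - α₂) * (Q - β₂) ∧
          x 1 = P * Q - (P - α₃) * (Q - β₃) ∧
          x 1 ∉ acl k (insert (x 0) U) ∧ AlgebraicIndependent (acl k U) x ∧ aeval x (φ (conic a b d)) = P * Q ∧
          P ∈ Algebra.adjoin (acl k U) (Set.range x) ∧
          Q ∈ Algebra.adjoin (acl k U) (Set.range x) := by
  have hdet : α₂ * β₃ - α₃ * β₂ ≠ 0 := sub_ne_zero.2 h.det
  let a : acl k U := ⟨α₂ * β₂, mul_mem h.α₂_mem h.β₂_mem⟩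
  let b : acl k U := ⟨α₃ * β₃, mul_mem h.α₃_mem h.β₃_mem⟩
  let d : acl k U := ⟨(α₃ - α₂) * (β₃ - β₂),
    mul_mem (sub_mem h.α₃_mem h.α₂_mem) (sub_mem h.β₃_mem h.β₂_mem)⟩
  have hG : 4 * a * b - (a + b - d) ^ 2 ≠ 0 := by
    intro h0
    have h1 : 4 * (α₂ * β₂) * (α₃ * β₃) - (α₂ * β₂ + α₃ * β₃ - (α₃ - α₂) * (β₃ - β₂)) ^ 2 = 0 :=
      congrArg Subtype.val h0
    have h2 : (α₂ * β₃ - α₃ * β₂) ^ 2 = 0 := by linear_combination -h1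
    exact hdet (pow_eq_zero_iff two_ne_zero |>.1 h2)
  obtain ⟨φ, e0, e1, hφ⟩ := exists_conic_coordinates (k := k) a b d hG
  set X' := P * Q - (P - α₂) * (Q - β₂) with hX
  set Y' := P * Q - (P - α₃) * (Q - β₃) with hY
  set x : Fin 2 → Ω := ![X', Y'] with hx
  set c₁ := aeval x (φ (X 0)) with hc₁
  set c₂ := aeval x (φ (X 1)) with hc₂
  have f0 : 2 * (α₂ * β₂) * c₁ + (α₂ * β₂ + α₃ * β₃ - (α₃ - α₂) * (β₃ - β₂)) * c₂
      - α₂ * β₂ = X' := by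
    have := congrArg (aeval x) e0
    simp only [map_add, map_mul, algHom_C, aeval_X] at this
    rw [← sub_eq_zero]
    rw [← sub_eq_zero] at this
    refine Eq.trans ?_ this
    change _ = (2 * (α₂ * β₂)) * c₁ + (α₂ * β₂ + α₃ * β₃ - (α₃ - α₂) * (β₃ - β₂)) * c₂ +
      -(α₂ * β₂) - X'
    ring
  have f1 : (α₂ * β₂ + α₃ * β₃ - (α₃ - α₂) * (β₃ - β₂)) * c₁ + 2 * (α₃ * β₃) * c₂
      - α₃ * β₃ = Y' := by
    have := congrArg (aeval x) e1
    simp only [map_add, map_mul, algHom_C, aeval_X] at this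
    rw [← sub_eq_zero]
    rw [← sub_eq_zero] at this
    refine Eq.trans ?_ this
    change _ = (α₂ * β₂ + α₃ * β₃ - (α₃ - α₂) * (β₃ - β₂)) * c₁ + (2 * (α₃ * β₃)) * c₂ +
      -(α₃ * β₃) - Y'
    ring
  have hPe : P = c₁ * α₂ + c₂ * α₃ := by
    apply mul_left_cancel₀ hdet
    linear_combination α₃ * f0 - α₂ * f1 + α₃ * hX - α₂ * hY
  have hQe : Q = c₁ * β₂ + c₂ * β₃ := by
    apply mul_left_cancel₀ hdet
    linear_combination (-β₃) * f0 + β₂ * f1 - β₃ * hX + β₂ * hY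
  have hle : acl k U ≤ acl k (insert Y' (insert X' U)) :=
    acl_mono ((Set.subset_insert _ _).trans (Set.subset_insert _ _))
  have hPQ : P ∈ acl k (insert Y' (insert X' U)) ∧ Q ∈ acl k (insert Y' (insert X' U)) := by
    have hX' : X' ∈ acl k (insert Y' (insert X' U)) := mem_acl_of_mem (by simp)
    have hY' : Y' ∈ acl k (insert Y' (insert X' U)) := mem_acl_of_mem (by simp)
    have a2 := hle h.α₂_mem
    have a3 := hle h.α₃_mem
    have b2 := hle h.β₂_mem
    have b3 := hle h.β₃_mem
    have hi := inv_mem (sub_mem (mul_mem a2 b3) (mul_mem a3 b2))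
    have p1 : P = (α₂ * β₃ - α₃ * β₂)⁻¹ * (α₂ * (Y' + α₃ * β₃) - α₃ * (X' + α₂ * β₂)) := by
      rw [eq_inv_mul_iff_mul_eq₀ hdet, hX, hY]; ring
    have q1 : Q = (α₂ * β₃ - α₃ * β₂)⁻¹ * (β₃ * (X' + α₂ * β₂) - β₂ * (Y' + α₃ * β₃)) := by
      rw [eq_inv_mul_iff_mul_eq₀ hdet, hX, hY]; ring
    constructor
    · rw [p1]
      exact mul_mem hi (sub_mem (mul_mem a2 (add_mem hY' (mul_mem a3 b3)))
        (mul_mem a3 (add_mem hX' (mul_mem a2 b2))))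
    · rw [q1]
      exact mul_mem hi (sub_mem (mul_mem b3 (add_mem hX' (mul_mem a2 b2)))
        (mul_mem b2 (add_mem hY' (mul_mem a3 b3))))
  obtain ⟨i1, i2⟩ := independent_of_pair_mem_acl h.left h.right hPQ.1 hPQ.2
  refine ⟨a, b, d, rfl, rfl, rfl, φ, hφ, x, rfl, rfl, i2, algebraicIndependent_pair_acl i1 i2,
    ?_, ?_, ?_⟩
  · rw [conic]
    simp only [map_add, map_mul, map_pow, ← algebraMap_eq, AlgEquiv.commutes, AlgHom.commutes]
    change α₂ * β₂ * c₁ ^ 2 + (α₂ * β₂ + α₃ * β₃ - (α₃ - α₂) * (β₃ - β₂)) * (c₁ * c₂) +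
      α₃ * β₃ * c₂ ^ 2 = _
    rw [hPe, hQe]
    ring
  · rw [hPe, Algebra.adjoin_range_eq_range_aeval]
    exact add_mem (mul_mem ⟨_, rfl⟩ ((aeval (R := acl k U) x).range.algebraMap_mem ⟨_, h.α₂_mem⟩))
      (mul_mem ⟨_, rfl⟩ ((aeval (R := acl k U) x).range.algebraMap_mem ⟨_, h.α₃_mem⟩))
  · rw [hQe, Algebra.adjoin_range_eq_range_aeval]
    exact add_mem (mul_mem ⟨_, rfl⟩ ((aeval (R := acl k U) x).range.algebraMap_mem ⟨_, h.β₂_mem⟩))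
      (mul_mem ⟨_, rfl⟩ ((aeval (R := acl k U) x).range.algebraMap_mem ⟨_, h.β₃_mem⟩))

end GenericStar
end
end

noncomputable section

attribute [local instance] MvPolynomial.algebraMvPolynomial

section
variable {k Ω : Type*} [Field k] [CharZero k] [Field Ω] [Algebra k Ω]

omit [CharZero k] in
theorem isAlgebraic_of_mem_acl_empty {x : Ω} (hx : x ∈ acl k ∅) : IsAlgebraic k x := by
  have h1 : Algebra.IsAlgebraic k (Algebra.adjoin k (∅ : Set Ω)) := by
    refine ⟨fun y => ?_⟩
    obtain ⟨c, hc⟩ := Algebra.mem_bot.1 ((Algebra.adjoin_empty k Ω).le y.2)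
    have : y = algebraMap k _ c := Subtype.ext hc.symm
    rw [this]
    exact isAlgebraic_algebraMap c
  exact (mem_acl.1 hx).restrictScalars k

theorem exists_derivation_eq_one (hk : ∀ x : Ω, IsAlgebraic k x → x ∈ (algebraMap k Ω).range)
    {M : IntermediateField k Ω} (m : M) (hm : (m : Ω) ∉ (algebraMap k Ω).range) :
    ∃ D : Derivation k M M, D m = 1 := by
  have h1 : AlgebraicIndependent k ![m] := by
    refine AlgebraicIndependent.of_comp M.val ?_
    have : AlgebraicIndependent k ![(m : Ω)] := by
      rw [algebraicIndependent_unique_type_iff]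
      exact fun h => hm (hk _ h)
    convert this using 1
    ext i; fin_cases i; rfl
  obtain ⟨D, hD⟩ := h1.exists_derivation ![1]
  exact ⟨D, hD 0⟩

theorem exists_dual_derivations (hk : ∀ x : Ω, IsAlgebraic k x → x ∈ (algebraMap k Ω).range)
    {M : IntermediateField k Ω} (m n : M) (hm : (m : Ω) ∉ (algebraMap k Ω).range)
    (hn : (n : Ω) ∉ acl k {(m : Ω)}) :
    ∃ D₁ D₂ : Derivation k M M, D₁ m = 1 ∧ D₁ n = 0 ∧ D₂ m = 0 ∧ D₂ n = 1 := by
  have h1 : AlgebraicIndependent k ![m, n] := by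
    refine AlgebraicIndependent.of_comp M.val ?_
    have : AlgebraicIndependent k ![(m : Ω), (n : Ω)] :=
      algebraicIndependent_pair (fun h => hm (hk _ h)) hn
    convert this using 1
    ext i; fin_cases i <;> rfl
  obtain ⟨D₁, hD₁⟩ := h1.exists_derivation ![1, 0]
  obtain ⟨D₂, hD₂⟩ := h1.exists_derivation ![0, 1]
  exact ⟨D₁, D₂, hD₁ 0, hD₁ 1, hD₂ 0, hD₂ 1⟩

omit [CharZero k] in
theorem derivation_eq_zero_of_mem_range {M : IntermediateField k Ω} (D : Derivation k M M) {m : M}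
    (hm : (m : Ω) ∈ (algebraMap k Ω).range) : D m = 0 := by
  obtain ⟨c, hc⟩ := hm
  have : m = algebraMap k M c := Subtype.ext hc.symm
  rw [this, D.map_algebraMap]

namespace GenericStar
variable {U : Set Ω} {P Q α₂ β₂ α₃ β₃ : Ω}

open MvPolynomial

omit [CharZero k] in
theorem range_eq_of_coordinates {x : Fin 2 → Ω} (h0 : x 0 = P * Q - (P - α₂) * (Q - β₂))
    (h1 : x 1 = P * Q - (P - α₃) * (Q - β₃)) :
    Set.range x = {P * Q - (P - α₂) * (Q - β₂), P * Q - (P - α₃) * (Q - β₃)} := by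
  rw [← h0, ← h1]
  ext y
  simp [eq_comm]

omit [CharZero k] in
theorem acl_eq_of_coordinates {x : Fin 2 → Ω} (h0 : x 0 = P * Q - (P - α₂) * (Q - β₂))
    (h1 : x 1 = P * Q - (P - α₃) * (Q - β₃)) :
    acl k {P * Q, (P - α₂) * (Q - β₂), (P - α₃) * (Q - β₃)} ≤
      acl k (insert (P * Q) (Set.range x)) := by
  rw [range_eq_of_coordinates h0 h1]
  refine acl_le ?_
  set T : Set Ω := insert (P * Q) {P * Q - (P - α₂) * (Q - β₂), P * Q - (P - α₃) * (Q - β₃)}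
  have t0 : P * Q ∈ acl k T := mem_acl_of_mem (by simp [T])
  have t1 : P * Q - (P - α₂) * (Q - β₂) ∈ acl k T := mem_acl_of_mem (by simp [T])
  have t2 : P * Q - (P - α₃) * (Q - β₃) ∈ acl k T := mem_acl_of_mem (by simp [T])
  rintro _ (rfl | rfl | rfl)
  · exact t0
  · simpa using sub_mem t0 t1
  · simpa using sub_mem t0 t2

omit [CharZero k] in
theorem adjoin_le_of_coordinates {x : Fin 2 → Ω} (h0 : x 0 = P * Q - (P - α₂) * (Q - β₂))
    (h1 : x 1 = P * Q - (P - α₃) * (Q - β₃)) :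
    Algebra.adjoin k (insert (P * Q) (Set.range x)) ≤
      Algebra.adjoin k {P * Q, (P - α₂) * (Q - β₂), (P - α₃) * (Q - β₃)} := by
  rw [range_eq_of_coordinates h0 h1]
  refine Algebra.adjoin_le ?_
  rintro _ (rfl | rfl | rfl)
  · exact Algebra.subset_adjoin (by simp)
  · exact sub_mem (Algebra.subset_adjoin (by simp)) (Algebra.subset_adjoin (by simp))
  · exact sub_mem (Algebra.subset_adjoin (by simp)) (Algebra.subset_adjoin (by simp))

theorem mul_notMem_acl (hk : ∀ x : Ω, IsAlgebraic k x → x ∈ (algebraMap k Ω).range)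
    (h : GenericStar k U P Q α₂ β₂ α₃ β₃) (ha : α₂ * β₂ ∉ (algebraMap k Ω).range) :
    P * Q ∉ acl k {P * Q - (P - α₂) * (Q - β₂), P * Q - (P - α₃) * (Q - β₃)} := by
  obtain ⟨a, b, d, ea, eb, ed, φ, hφ, x, hx0, hx1, hx2, hx, hQ, hP', hQ'⟩ := h.exists_coordinates
  rw [← range_eq_of_coordinates hx0 hx1]
  intro hmem
  have h1 := mem_algebraAdjoin_of_mem_acl hk hx (mul_mem hP' hQ') hmem
  rw [Algebra.adjoin_range_eq_range_aeval] at h1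
  obtain ⟨p, hp⟩ := h1
  have hp2 : map (algebraMap k (acl k U)) p = φ (conic a b d) := by
    apply hx
    rw [hQ, ← hp]
    exact aeval_map_algebraMap _ _ _
  obtain ⟨D, hD⟩ := exists_derivation_eq_one hk a (by rwa [ea])
  have h2 : mapDerivation D (φ (conic a b d)) = 0 := by
    rw [← hp2]
    ext m
    rw [coeff_mapDerivation, coeff_map, D.map_algebraMap, coeff_zero]
  rw [hφ, EmbeddingLike.map_eq_zero_iff] at h2
  have h3 := congrArg (eval ![-1, 0]) h2
  simp [hD] at h3

theorem notMem_acl (hk : ∀ x : Ω, IsAlgebraic k x → x ∈ (algebraMap k Ω).range)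
    (h : GenericStar k U P Q α₂ β₂ α₃ β₃) (ha : α₂ * β₂ ∉ (algebraMap k Ω).range) :
    (P - α₃) * (Q - β₃) ∉ acl k {P * Q, (P - α₂) * (Q - β₂)} := by
  obtain ⟨a, b, d, ea, eb, ed, φ, hφ, x, hx0, hx1, hx2, hx, hQ, hP', hQ'⟩ := h.exists_coordinates
  intro hmem
  apply h.mul_notMem_acl hk ha
  rw [Set.pair_comm]
  have hX : x 1 ∉ acl k {x 0} := fun hh => hx2 (acl_mono (by simp) hh)
  refine acl_exchange ?_ (by rw [← hx0, ← hx1]; exact hX)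
  have t0 : P * Q ∈ acl k (insert (P * Q) {P * Q - (P - α₂) * (Q - β₂)}) :=
    mem_acl_of_mem (by simp)
  have t1 : P * Q - (P - α₂) * (Q - β₂) ∈ acl k (insert (P * Q) {P * Q - (P - α₂) * (Q - β₂)}) :=
    mem_acl_of_mem (by simp)
  refine sub_mem t0 (acl_le ?_ hmem)
  rintro _ (rfl | rfl)
  · exact t0
  · simpa using sub_mem t0 t1

theorem mul_mem_algebraAdjoin (hk : ∀ x : Ω, IsAlgebraic k x → x ∈ (algebraMap k Ω).range)
    (h : GenericStar k U P Q α₂ β₂ α₃ β₃) (ha : α₂ * β₂ ∈ (algebraMap k Ω).range)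
    (hb : α₃ * β₃ ∈ (algebraMap k Ω).range)
    (hd : (α₃ - α₂) * (β₃ - β₂) ∈ (algebraMap k Ω).range) :
    P * Q ∈ Algebra.adjoin k {P * Q - (P - α₂) * (Q - β₂), P * Q - (P - α₃) * (Q - β₃)} := by
  obtain ⟨a, b, d, ea, eb, ed, φ, hφ, x, hx0, hx1, hx2, hx, hQ, hP', hQ'⟩ := h.exists_coordinates
  have hcoeff : ∀ m, ((coeff m (φ (conic a b d)) : acl k U) : Ω) ∈ (algebraMap k Ω).range := by
    intro m
    by_contra hm
    obtain ⟨D, hD⟩ := exists_derivation_eq_one hk _ hm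
    have h1 := hφ D
    rw [derivation_eq_zero_of_mem_range D (by rwa [ea]),
      derivation_eq_zero_of_mem_range D (by rwa [eb]),
      derivation_eq_zero_of_mem_range D (by rwa [ed])] at h1
    have h2 := congrArg (coeff m) h1
    rw [coeff_mapDerivation, hD] at h2
    simp at h2
  rw [← range_eq_of_coordinates hx0 hx1, ← hQ, aeval_def, eval₂_eq]
  refine sum_mem fun m _ => mul_mem ?_
    (prod_mem fun i _ => pow_mem (Algebra.subset_adjoin (Set.mem_range_self i)) _)
  obtain ⟨c, hc⟩ := hcoeff m
  rw [IntermediateField.algebraMap_apply, ← hc]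
  exact Subalgebra.algebraMap_mem _ c

theorem mem_algebraAdjoin_of_mem_range
    (hk : ∀ x : Ω, IsAlgebraic k x → x ∈ (algebraMap k Ω).range)
    (h : GenericStar k U P Q α₂ β₂ α₃ β₃) (ha : α₂ * β₂ ∈ (algebraMap k Ω).range)
    (hb : α₃ * β₃ ∈ (algebraMap k Ω).range)
    (hd : (α₃ - α₂) * (β₃ - β₂) ∈ (algebraMap k Ω).range) {e : Ω}
    (heM : e ∈ Algebra.adjoin (acl k U) {P, Q})
    (he : e ∈ acl k {P * Q, (P - α₂) * (Q - β₂), (P - α₃) * (Q - β₃)}) :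
    e ∈ Algebra.adjoin k {P * Q, (P - α₂) * (Q - β₂), (P - α₃) * (Q - β₃)} := by
  have hPQ := h.mul_mem_algebraAdjoin hk ha hb hd
  obtain ⟨a, b, d, ea, eb, ed, φ, hφ, x, hx0, hx1, hx2, hx, hQ, hP', hQ'⟩ := h.exists_coordinates
  rw [← range_eq_of_coordinates hx0 hx1] at hPQ
  have heM' : e ∈ Algebra.adjoin (acl k U) (Set.range x) := by
    refine mem_algebraAdjoin_of_le le_rfl ?_ heM
    rintro _ (rfl | rfl)
    exacts [hP', hQ']
  have h1 := mem_algebraAdjoin_of_mem_acl hk hx heM' ?_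
  · exact adjoin_le_of_coordinates hx0 hx1 (Algebra.adjoin_mono (Set.subset_insert _ _) h1)
  · exact acl_insert_le le_rfl (algebraAdjoin_le_acl _ hPQ) (acl_eq_of_coordinates hx0 hx1 he)

theorem mem_algebraAdjoin_of_independent
    (hk : ∀ x : Ω, IsAlgebraic k x → x ∈ (algebraMap k Ω).range)
    (h : GenericStar k U P Q α₂ β₂ α₃ β₃) (ha : α₂ * β₂ ∉ (algebraMap k Ω).range)
    (hb : α₃ * β₃ ∉ acl k {α₂ * β₂})
    (hd : (α₃ - α₂) * (β₃ - β₂) ∉ (algebraMap k Ω).range) {e : Ω}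
    (heM : e ∈ Algebra.adjoin (acl k U) {P, Q})
    (he : e ∈ acl k {P * Q, (P - α₂) * (Q - β₂), (P - α₃) * (Q - β₃)}) :
    e ∈ Algebra.adjoin k {P * Q, (P - α₂) * (Q - β₂), (P - α₃) * (Q - β₃)} := by
  obtain ⟨a, b, d, ea, eb, ed, φ, hφ, x, hx0, hx1, hx2, hx, hQ, hP', hQ'⟩ := h.exists_coordinates
  have heM' : e ∈ Algebra.adjoin (acl k U) (Set.range x) := by
    refine mem_algebraAdjoin_of_le le_rfl ?_ heM
    rintro _ (rfl | rfl)
    exacts [hP', hQ']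
  have hder : ∃ D₁ D₂ : Derivation k (acl k U) (acl k U), D₁ a = 1 ∧ D₁ b = 0 ∧ D₂ a = 0 ∧
      D₂ b = 1 ∧ (D₁ d ≠ 0 ∨ D₂ d ≠ 0) := by
    obtain ⟨D₁, D₂, h1, h2, h3, h4⟩ := exists_dual_derivations hk a b (by rwa [ea])
      (by rwa [ea, eb])
    by_cases h0 : D₁ d ≠ 0 ∨ D₂ d ≠ 0
    · exact ⟨D₁, D₂, h1, h2, h3, h4, h0⟩
    · push Not at h0
      obtain ⟨D, hD⟩ := exists_derivation_eq_one hk d (by rwa [ed])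
      refine ⟨D₁ + (D - D a • D₁ - D b • D₂), D₂, ?_, ?_, h3, h4, Or.inl ?_⟩
      · simp [h1, h3]
      · simp [h2, h4]
      · simp [h0, hD]
  obtain ⟨D₁, D₂, h1, h2, h3, h4, h5⟩ := hder
  have g1 : mapDerivation D₁ (φ (conic a b d)) =
      φ (X 0 * ((1 - X 0 - X 1) + C (D₁ d) * X 1)) := by
    rw [hφ, h1, h2]
    congr 1
    simp
    ring
  have g2 : mapDerivation D₂ (φ (conic a b d)) =
      φ (X 1 * ((1 - X 0 - X 1) + C (D₂ d) * X 0)) := by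
    rw [hφ, h3, h4]
    congr 1
    simp
    ring
  have := mem_algebraAdjoin_of_isRelPrime hk hx (φ (conic a b d)) D₁ D₂ ?_ ?_ heM' ?_
  · rw [hQ] at this
    exact adjoin_le_of_coordinates hx0 hx1 this
  · rw [g1, g2]
    exact (isRelPrime_map_iff φ.toMulEquiv).2 (isRelPrime_lines _ _ h5)
  · rw [g1]
    refine totalDegree_algEquiv_ne_zero φ ![0, 0] ![-1, 0] ?_
    simp
    norm_num
  · rw [hQ]
    exact acl_eq_of_coordinates hx0 hx1 he

theorem mem_algebraAdjoin_of_normalized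
    (hk : ∀ x : Ω, IsAlgebraic k x → x ∈ (algebraMap k Ω).range)
    (h : GenericStar k U P Q α₂ β₂ α₃ β₃) (ha : α₂ * β₂ ∉ (algebraMap k Ω).range)
    (hb : α₃ * β₃ ∉ acl k {α₂ * β₂}) (hα : α₂ ≠ α₃) (hβ : β₂ ≠ β₃)
    (hd : (α₃ - α₂) * (β₃ - β₂) ∈ (algebraMap k Ω).range) {e : Ω}
    (heM : e ∈ Algebra.adjoin (acl k U) {P, Q})
    (he : e ∈ acl k {P * Q, (P - α₂) * (Q - β₂), (P - α₃) * (Q - β₃)}) :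
    e ∈ Algebra.adjoin k {P * Q, (P - α₂) / (α₃ - α₂), (Q - β₂) / (β₃ - β₂)} := by
  have hα' : α₃ - α₂ ≠ 0 := sub_ne_zero.2 hα.symm
  have hβ' : β₃ - β₂ ≠ 0 := sub_ne_zero.2 hβ.symm
  have hM := normalized_subset_adjoin h.α₂_mem h.β₂_mem h.α₃_mem h.β₃_mem hα hβ heM
  obtain ⟨i1, i2⟩ := normalized_independent h.α₂_mem h.β₂_mem h.α₃_mem h.β₃_mem
    h.left h.right hα hβ
  have hx := algebraicIndependent_pair_acl i1 i2
  set x := (P - α₂) / (α₃ - α₂) with hxdef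
  set y := (Q - β₂) / (β₃ - β₂) with hydef
  set d := (α₃ - α₂) * (β₃ - β₂) with hddef
  have hd0 : d ≠ 0 := mul_ne_zero hα' hβ'
  set s := -α₂ / (α₃ - α₂) with hs
  set t := -β₂ / (β₃ - β₂) with ht
  let sM : acl k U := ⟨s, div_mem (neg_mem h.α₂_mem) (sub_mem h.α₃_mem h.α₂_mem)⟩
  let tM : acl k U := ⟨t, div_mem (neg_mem h.β₂_mem) (sub_mem h.β₃_mem h.β₂_mem)⟩
  let dM : acl k U := ⟨d, mul_mem (sub_mem h.α₃_mem h.α₂_mem) (sub_mem h.β₃_mem h.β₂_mem)⟩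
  have hdM0 : dM ≠ 0 := fun h0 => hd0 (congrArg Subtype.val h0)
  have hdk : ∀ T : Set Ω, d ∈ acl k T := fun T => by
    obtain ⟨c, hc⟩ := hd
    rw [← hc]
    exact (acl k T).algebraMap_mem c
  have hst : s ∉ acl k ∅ ∧ t ∉ acl k (insert s ∅) := by
    have hs' : s ∈ acl k (insert t (insert s ∅)) := mem_acl_of_mem (by simp)
    have ht' : t ∈ acl k (insert t (insert s ∅)) := mem_acl_of_mem (by simp)
    refine independent_of_pair_mem_acl (p := α₂ * β₂) (q := α₃ * β₃) ?_ ?_ ?_ ?_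
    · intro h0
      refine ha (hk _ (isAlgebraic_of_mem_acl_empty h0))
    · simpa using hb
    · have : α₂ * β₂ = d * (s * t) := by rw [hs, ht, hddef]; field_simp
      rw [this]
      exact mul_mem (hdk _) (mul_mem hs' ht')
    · have : α₃ * β₃ = d * ((1 - s) * (1 - t)) := by rw [hs, ht, hddef]; field_simp; ring
      rw [this]
      exact mul_mem (hdk _) (mul_mem (sub_mem (one_mem _) hs') (sub_mem (one_mem _) ht'))
  obtain ⟨D₁, D₂, h1, h2, h3, h4⟩ := exists_dual_derivations hk sM tM
    (fun ⟨c, hc⟩ => hst.1 (by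
      change algebraMap k Ω c = s at hc
      rw [← hc]; exact (acl k _).algebraMap_mem c)) (by simpa using hst.2)
  let R : MvPolynomial (Fin 2) (acl k U) := C dM * ((X 0 - C sM) * (X 1 - C tM))
  have hdD : ∀ D : Derivation k (acl k U) (acl k U), D dM = 0 :=
    fun D => derivation_eq_zero_of_mem_range D hd
  have hRe : aeval ![x, y] R = P * Q := by
    simp only [R, map_mul, map_sub, algHom_C, aeval_X]
    change d * ((x - s) * (y - t)) = P * Q
    rw [hxdef, hydef, hs, ht, hddef]
    field_simp
    ring
  have g1 : mapDerivation D₁ R = C 0 * X 0 + C (-dM) * X 1 + C (dM * tM) := by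
    simp only [R, map_sub, Derivation.leibniz, mapDerivation_C, mapDerivation_X, smul_eq_mul, hdD,
      h1, h2]
    simp
    ring
  have g2 : mapDerivation D₂ R = C (-dM) * X 0 + C 0 * X 1 + C (dM * sM) := by
    simp only [R, map_sub, Derivation.leibniz, mapDerivation_C, mapDerivation_X, smul_eq_mul, hdD,
      h3, h4]
    simp
    ring
  have hr : Set.range ![x, y] = {x, y} := by simp [Set.pair_comm]
  have := mem_algebraAdjoin_of_isRelPrime hk hx R D₁ D₂ ?_ ?_ hM ?_
  · rwa [hRe, hr] at this
  · rw [g1, g2]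
    refine isRelPrime_of_eval (irreducible_of_totalDegree_le_one (totalDegree_affine_le _ _ _)
      ![0, 0] ![0, 1] ?_) ![sM + 1, tM] ?_ ?_
    · simpa using hdM0
    · simp
    · simpa [mul_add] using hdM0
  · rw [g1]
    refine totalDegree_ne_zero_of_eval_ne ![0, 0] ![0, 1] ?_
    simpa using hdM0
  · rw [hRe, hr]
    refine acl_le ?_ he
    have hx' : x ∈ acl k ({P * Q, x, y} : Set Ω) := mem_acl_of_mem (by simp)
    have hy' : y ∈ acl k ({P * Q, x, y} : Set Ω) := mem_acl_of_mem (by simp)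
    rintro _ (rfl | rfl | rfl)
    · exact mem_acl_of_mem (by simp)
    · have : (P - α₂) * (Q - β₂) = d * (x * y) := by rw [hxdef, hydef, hddef]; field_simp
      rw [this]
      exact mul_mem (hdk _) (mul_mem hx' hy')
    · have : (P - α₃) * (Q - β₃) = d * ((x - 1) * (y - 1)) := by
        rw [hxdef, hydef, hddef]; field_simp; ring
      rw [this]
      exact mul_mem (hdk _) (mul_mem (sub_mem hx' (one_mem _)) (sub_mem hy' (one_mem _)))

end GenericStar
end
end

noncomputable section

namespace Laman
variable {β : Type*} [DecidableEq β]

/-- The number of edges spanned by a set of vertices. -/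
def spanned (E : Finset (Sym2 β)) (S : Finset β) : ℕ := (E ∩ S.sym2).card

/-- The Laman sparsity condition for a set of edges. -/
structure Sparse (E : Finset (Sym2 β)) : Prop where
  not_isDiag : ∀ e ∈ E, ¬ e.IsDiag
  spanned_le : ∀ S : Finset β, 2 ≤ S.card → spanned E S + 3 ≤ 2 * S.card

/-- A set of at least two vertices spanning the largest possible number of edges. -/
def TightOn (E : Finset (Sym2 β)) (S : Finset β) : Prop :=
  2 ≤ S.card ∧ spanned E S + 3 = 2 * S.card

variable {E : Finset (Sym2 β)} {S T : Finset β}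

theorem Sparse.mono (h : Sparse E) {E' : Finset (Sym2 β)} (hE : E' ⊆ E) : Sparse E' :=
  ⟨fun e he => h.1 e (hE he), fun S hS => (Nat.add_le_add_right
    (Finset.card_le_card (Finset.inter_subset_inter_right hE)) 3).trans (h.2 S hS)⟩

theorem spanned_add_le (E : Finset (Sym2 β)) (S T : Finset β) :
    spanned E S + spanned E T ≤ spanned E (S ∪ T) + spanned E (S ∩ T) := by
  rw [spanned, spanned, ← Finset.card_union_add_card_inter]
  refine Nat.add_le_add (Finset.card_le_card ?_) (Finset.card_le_card ?_)
  · refine Finset.union_subset ?_ ?_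
    · exact Finset.inter_subset_inter_left (Finset.sym2_mono Finset.subset_union_left)
    · exact Finset.inter_subset_inter_left (Finset.sym2_mono Finset.subset_union_right)
  · intro e
    simp only [Finset.mem_inter, Finset.mem_sym2_iff]
    exact fun h => ⟨h.1.1, fun a ha => ⟨h.1.2 a ha, h.2.2 a ha⟩⟩

theorem TightOn.union (hE : Sparse E) (hS : TightOn E S) (hT : TightOn E T)
    (h : 2 ≤ (S ∩ T).card) : TightOn E (S ∪ T) := by
  have h1 := spanned_add_le E S T
  have h2 := Finset.card_union_add_card_inter S T
  have h3 : S.card ≤ (S ∪ T).card := Finset.card_le_card Finset.subset_union_left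
  have h4 := hE.2 _ h
  have h6 : 2 ≤ (S ∪ T).card := hS.1.trans h3
  have h5 := hE.2 _ h6
  have := hS.2
  have := hT.2
  exact ⟨h6, by omega⟩

omit [DecidableEq β] in
theorem two_le_card_of_mem {a b : β} (hab : a ≠ b) (ha : a ∈ S) (hb : b ∈ S) : 2 ≤ S.card :=
  Finset.one_lt_card.2 ⟨a, ha, b, hb, hab⟩

theorem disjoint_spanned (hE : Sparse E) (h : (S ∩ T).card ≤ 1) :
    Disjoint (E ∩ S.sym2) (E ∩ T.sym2) := by
  rw [Finset.disjoint_left]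
  intro e h1 h2
  simp only [Finset.mem_inter, Finset.mem_sym2_iff] at h1 h2
  induction e with
  | _ a b =>
    have hab : a ≠ b := fun hab => hE.1 _ h1.1 hab
    have := two_le_card_of_mem (S := S ∩ T) hab
      (Finset.mem_inter.2 ⟨h1.2 a (by simp), h2.2 a (by simp)⟩)
      (Finset.mem_inter.2 ⟨h1.2 b (by simp), h2.2 b (by simp)⟩)
    omega

theorem TightOn.exists_of_triangle (hE : Sparse E) {R : Finset β} (hS : TightOn E S)
    (hT : TightOn E T) (hR : TightOn E R) {a b c : β} (hbc : b ≠ c)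
    (haS : a ∈ S) (hbS : b ∈ S) (haT : a ∈ T) (hcT : c ∈ T) (hbR : b ∈ R) (hcR : c ∈ R) :
    ∃ W, TightOn E W ∧ a ∈ W ∧ b ∈ W ∧ c ∈ W := by
  by_cases h1 : 2 ≤ (S ∩ T).card
  · exact ⟨_, hS.union hE hT h1, by simp [*], by simp [*], by simp [*]⟩
  by_cases h2 : 2 ≤ (S ∩ R).card
  · exact ⟨_, hS.union hE hR h2, by simp [*], by simp [*], by simp [*]⟩
  by_cases h3 : 2 ≤ (T ∩ R).card
  · exact ⟨_, hT.union hE hR h3, by simp [*], by simp [*], by simp [*]⟩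
  refine ⟨S ∪ T ∪ R, ?_, by simp [*], by simp [*], by simp [*]⟩
  have c1 : (S ∩ T).card = 1 :=
    le_antisymm (by omega) (Finset.card_pos.2 ⟨a, by simp [*]⟩)
  have c2 : 2 ≤ ((S ∪ T) ∩ R).card := two_le_card_of_mem hbc (by simp [*]) (by simp [*])
  have c3 : ((S ∪ T) ∩ R).card ≤ (S ∩ R).card + (T ∩ R).card := by
    rw [Finset.union_inter_distrib_right]
    exact Finset.card_union_le _ _
  have u1 := Finset.card_union_add_card_inter S T
  have u2 := Finset.card_union_add_card_inter (S ∪ T) R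
  have hle : spanned E S + spanned E T + spanned E R ≤ spanned E (S ∪ T ∪ R) := by
    rw [spanned, spanned, ← Finset.card_union_of_disjoint (disjoint_spanned hE (by omega)), spanned,
      ← Finset.card_union_of_disjoint (Finset.disjoint_union_left.2
        ⟨disjoint_spanned hE (by omega), disjoint_spanned hE (by omega)⟩)]
    refine Finset.card_le_card (Finset.union_subset (Finset.union_subset ?_ ?_) ?_)
    all_goals
      refine Finset.inter_subset_inter_left (Finset.sym2_mono ?_)
      intro x hx
      simp [hx]
  have h6 : 2 ≤ (S ∪ T ∪ R).card := hR.1.trans (Finset.card_le_card Finset.subset_union_right)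
  have h5 := hE.2 _ h6
  have := hS.2
  have := hT.2
  have := hR.2
  exact ⟨h6, by omega⟩

theorem Sparse.insert (hE : Sparse E) {a b : β} (hab : a ≠ b)
    (h : ∀ S, TightOn E S → a ∈ S → b ∉ S) : Sparse (insert s(a, b) E) := by
  refine ⟨fun e he => ?_, fun S hS => ?_⟩
  · rcases Finset.mem_insert.1 he with rfl | he
    · exact hab
    · exact hE.1 e he
  · have h0 := hE.2 S hS
    by_cases hm : a ∈ S ∧ b ∈ S
    · have h1 : spanned E S + 3 ≠ 2 * S.card := fun h1 => h S ⟨hS, h1⟩ hm.1 hm.2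
      have h2 : spanned (Insert.insert s(a, b) E) S ≤ spanned E S + 1 := by
        rw [spanned, Finset.insert_inter_of_mem (by simpa using hm)]
        exact Finset.card_insert_le _ _
      omega
    · rw [spanned, Finset.insert_inter_of_notMem (by simpa using hm)]
      exact h0

theorem TightOn.of_mem (hE : Sparse E) {a b : β} (h : s(a, b) ∈ E) : TightOn E {a, b} := by
  have hab : a ≠ b := fun hab => hE.1 _ h hab
  have h2 : ({a, b} : Finset β).card = 2 := Finset.card_pair hab
  have h1 : 1 ≤ spanned E {a, b} := Finset.card_pos.2 ⟨s(a, b), by simp [h]⟩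
  have := hE.2 _ h2.ge
  exact ⟨h2.ge, by omega⟩

/-- The edges at a vertex. -/
def star (E : Finset (Sym2 β)) (v : β) : Finset (Sym2 β) := {e ∈ E | v ∈ e}

theorem Sparse.exists_star_card_le (hE : Sparse E) (hne : E.Nonempty) :
    ∃ v, 0 < (star E v).card ∧ (star E v).card ≤ 3 := by
  set S : Finset β := E.biUnion Sym2.toFinset with hS
  obtain ⟨e, he⟩ := hne
  have hS2 : 2 ≤ S.card := by
    rw [← Sym2.card_toFinset_of_not_isDiag e (hE.1 e he)]
    exact Finset.card_le_card (Finset.subset_biUnion_of_mem _ he)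
  have hi : spanned E S = E.card := by
    rw [spanned, Finset.inter_eq_left.2]
    intro f hf
    rw [Finset.mem_sym2_iff]
    exact fun a ha => Finset.mem_biUnion.2 ⟨f, hf, Sym2.mem_toFinset.2 ha⟩
  have hsum : ∑ v ∈ S, (star E v).card = 2 * E.card := by
    have := Finset.sum_card_bipartiteAbove_eq_sum_card_bipartiteBelow
      (s := S) (t := E) (fun v e => v ∈ e)
    simp only [Finset.bipartiteAbove, Finset.bipartiteBelow] at this
    refine Eq.trans this ?_
    rw [mul_comm, ← smul_eq_mul, ← Finset.sum_const]
    refine Finset.sum_congr rfl fun f hf => ?_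
    rw [← Sym2.card_toFinset_of_not_isDiag f (hE.1 f hf)]
    congr 1
    ext a
    simp only [Finset.mem_filter, Sym2.mem_toFinset, and_iff_right_iff_imp]
    exact fun ha => Finset.mem_biUnion.2 ⟨f, hf, Sym2.mem_toFinset.2 ha⟩
  have hlt : ∑ v ∈ S, (star E v).card < ∑ v ∈ S, 4 := by
    have := hE.2 S hS2
    rw [hsum, Finset.sum_const, smul_eq_mul]
    omega
  obtain ⟨v, hv, hv4⟩ := Finset.exists_lt_of_sum_lt hlt
  obtain ⟨f, hf, hvf⟩ := Finset.mem_biUnion.1 hv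
  exact ⟨v, Finset.card_pos.2 ⟨f, Finset.mem_filter.2 ⟨hf, Sym2.mem_toFinset.1 hvf⟩⟩, by omega⟩

theorem Sparse.not_tightOn_of_star (hE : Sparse E) {v a b c : β} (hab : a ≠ b) (hac : a ≠ c)
    (hbc : b ≠ c) (ha : s(v, a) ∈ E) (hb : s(v, b) ∈ E) (hc : s(v, c) ∈ E)
    (hS : TightOn (E \ star E v) S) (haS : a ∈ S) (hbS : b ∈ S) (hcS : c ∈ S) : False := by
  have hE' : Sparse (E \ star E v) := hE.mono Finset.sdiff_subset
  have hva : v ≠ a := fun h => hE.1 _ ha h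
  have hvb : v ≠ b := fun h => hE.1 _ hb h
  have hvS : v ∉ S := by
    intro hv
    have h1 : spanned (E \ star E v) (S.erase v) = spanned (E \ star E v) S := by
      rw [spanned, spanned]
      congr 1
      ext e
      simp only [Finset.mem_inter, Finset.mem_sym2_iff, Finset.mem_sdiff, star, Finset.mem_filter,
        Finset.mem_erase, not_and]
      refine and_congr_right fun he => forall₂_congr fun x hx => and_iff_right_of_imp ?_
      rintro - rfl
      exact he.2 he.1 hx
    have h2 := Finset.card_erase_of_mem hv
    have h3 : 2 ≤ (S.erase v).card := two_le_card_of_mem hab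
      (Finset.mem_erase.2 ⟨hva.symm, haS⟩) (Finset.mem_erase.2 ⟨hvb.symm, hbS⟩)
    have := hE'.2 _ h3
    have := hS.2
    omega
  have h1 := hE.2 (Insert.insert v S)
    (hS.1.trans (Finset.card_le_card (Finset.subset_insert _ _)))
  rw [Finset.card_insert_of_notMem hvS] at h1
  have h2 : spanned (E \ star E v) S + 3 ≤ spanned E (Insert.insert v S) := by
    have h3 : ({s(v, a), s(v, b), s(v, c)} : Finset (Sym2 β)).card = 3 := by
      rw [Finset.card_eq_three]
      refine ⟨_, _, _, ?_, ?_, ?_, rfl⟩ <;> simp <;> grind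
    rw [← h3, spanned, spanned, ← Finset.card_union_of_disjoint]
    · refine Finset.card_le_card (Finset.union_subset ?_ ?_)
      · exact Finset.inter_subset_inter Finset.sdiff_subset
          (Finset.sym2_mono (Finset.subset_insert _ _))
      · intro e he
        simp only [Finset.mem_insert, Finset.mem_singleton] at he
        rcases he with rfl | rfl | rfl <;> simp [*]
    · rw [Finset.disjoint_right]
      intro e he h4
      have h5 := (Finset.mem_sym2_iff.1 (Finset.mem_inter.1 h4).2) v
      simp only [Finset.mem_insert, Finset.mem_singleton] at he
      rcases he with rfl | rfl | rfl <;> exact hvS (h5 (by simp))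
  have := hS.2
  omega

end Laman
end

noncomputable section

section
variable {F Ω : Type*} [Field F] [Field Ω] [Algebra F Ω]

theorem IntermediateField.mem_of_mem_algebraAdjoin {K N : IntermediateField F Ω} (h : K ≤ N)
    {S : Set Ω} (hS : S ⊆ N) {a : Ω} (ha : a ∈ Algebra.adjoin K S) : a ∈ N := by
  refine Algebra.adjoin_induction (p := fun y _ => y ∈ N) (fun y hy => hS hy) (fun c => h c.2)
    (fun y z _ _ hy hz => add_mem hy hz) (fun y z _ _ hy hz => mul_mem hy hz) ha

theorem mem_acl_acl_iff {S T : Set Ω} (hT : T ⊆ acl F S) {x : Ω} :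
    x ∈ acl (acl F T) S ↔ x ∈ acl F S := by
  rw [mem_acl_acl]
  exact ⟨fun h => acl_le (Set.union_subset hT (subset_acl S)) h,
    fun h => acl_mono Set.subset_union_right h⟩

theorem mem_acl_acl_insert_iff {S T : Set Ω} (hT : T ⊆ acl F S) {x y : Ω} :
    x ∈ acl (acl F T) (insert y S) ↔ x ∈ acl F (insert y S) :=
  mem_acl_acl_iff (hT.trans (acl_mono (Set.subset_insert _ _)))

/-- In `acl F T`, elements algebraic over the base already lie in the base. -/
theorem acl_algebraicallyClosed (T : Set Ω) (x : Ω) (hx : IsAlgebraic (acl F T) x) :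
    x ∈ (algebraMap (acl F T) Ω).range := exists_algebraMap_acl_eq hx

theorem mem_range_acl_iff {T : Set Ω} {x : Ω} :
    x ∈ (algebraMap (acl F T) Ω).range ↔ x ∈ acl F T :=
  ⟨fun ⟨c, hc⟩ => hc ▸ c.2, fun h => ⟨⟨x, h⟩, rfl⟩⟩

end

section
variable {F Ω β : Type*} [Field F] [Field Ω] [Algebra F Ω]

/-- The squared distance in isotropic coordinates. -/
def sqDist (z w : β → Ω) : Sym2 β → Ω :=
  Sym2.lift ⟨fun u v => (z u - z v) * (w u - w v), fun u v => by ring⟩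

@[simp]
theorem sqDist_mk (z w : β → Ω) (u v : β) : sqDist z w s(u, v) = (z u - z v) * (w u - w v) := rfl

/-- The coordinates of the vertices other than `v`. -/
def others (z w : β → Ω) (v : β) : Set Ω := {x | ∃ u, u ≠ v ∧ (x = z u ∨ x = w u)}

/-- Products of isotropic coordinate differences along rigid triples. -/
def rigidProducts (F : Type*) [Field F] [Algebra F Ω] (z w : β → Ω) (E : Set (Sym2 β)) : Set Ω :=
  {x | ∃ a b c, sqDist z w s(a, b) ∈ acl F (sqDist z w '' E) ∧
    sqDist z w s(c, b) ∈ acl F (sqDist z w '' E) ∧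
    sqDist z w s(a, c) ∈ acl F (sqDist z w '' E) ∧ x = (z a - z b) * (w c - w b)}

/-- Everything algebraic over the squared lengths is rational in rigid products. -/
def RationalInProducts (F : Type*) [Field F] [Algebra F Ω] (z w : β → Ω) (E : Set (Sym2 β)) :
    Prop :=
  acl F (sqDist z w '' E) ≤ IntermediateField.adjoin F (rigidProducts F z w E)

/-- The coordinates are independent, and polynomials in them are integrally closed. -/
structure GenericPlacement (F : Type*) [Field F] [Algebra F Ω] (z w : β → Ω) : Prop where
  indep : AlgebraicIndependent F (Sum.elim z w)
  integral : ∀ x : Ω, IsIntegral (Algebra.adjoin F (Set.range (Sum.elim z w))) x →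
    x ∈ Algebra.adjoin F (Set.range (Sum.elim z w))

variable {z w : β → Ω} {E E' : Set (Sym2 β)} {v a b c : β}

theorem rigidProducts_mono
    (h : acl F (sqDist z w '' E') ≤ acl F (sqDist z w '' E)) :
    rigidProducts F z w E' ⊆ rigidProducts F z w E := by
  rintro x ⟨a, b, c, h1, h2, h3, rfl⟩
  exact ⟨a, b, c, h h1, h h2, h h3, rfl⟩

theorem mem_rigidProducts (h : sqDist z w s(a, b) ∈ acl F (sqDist z w '' E)) :
    sqDist z w s(a, b) ∈ rigidProducts F z w E :=
  ⟨a, b, a, h, h, by rw [sqDist_mk, sub_self, zero_mul]; exact zero_mem _, rfl⟩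

theorem RationalInProducts.le (hE : RationalInProducts F z w E')
    (h : acl F (sqDist z w '' E') ≤ acl F (sqDist z w '' E)) :
    acl F (sqDist z w '' E') ≤ IntermediateField.adjoin F (rigidProducts F z w E) :=
  hE.trans (IntermediateField.adjoin.mono _ _ _ (rigidProducts_mono h))

theorem mem_others_z (h : a ≠ v) : z a ∈ acl F (others z w v) :=
  mem_acl_of_mem ⟨a, h, Or.inl rfl⟩

theorem mem_others_w (h : a ≠ v) : w a ∈ acl F (others z w v) :=
  mem_acl_of_mem ⟨a, h, Or.inr rfl⟩

theorem sqDist_image_subset (hv : ∀ e ∈ E, v ∉ e) :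
    sqDist z w '' E ⊆ acl F (others z w v) := by
  rintro _ ⟨e, he, rfl⟩
  induction e with
  | _ a b =>
    have ha : a ≠ v := fun h => hv _ he (by simp [h])
    have hb : b ≠ v := fun h => hv _ he (by simp [h])
    exact mul_mem (sub_mem (mem_others_z ha) (mem_others_z hb))
      (sub_mem (mem_others_w ha) (mem_others_w hb))

section
variable (h : AlgebraicIndependent F (Sum.elim z w))
include h

theorem notMem_acl_others : z v ∉ acl F (others z w v) := by
  have h1 := h.transcendental_adjoin (s := {Sum.inl v, Sum.inr v}ᶜ) (i := Sum.inl v) (by simp)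
  refine fun h2 => h1 (acl_mono ?_ h2)
  rintro x ⟨u, hu, rfl | rfl⟩
  · exact ⟨Sum.inl u, by simpa using hu, rfl⟩
  · exact ⟨Sum.inr u, by simpa using hu, rfl⟩

theorem notMem_acl_insert_others : w v ∉ acl F (insert (z v) (others z w v)) := by
  have h1 := h.transcendental_adjoin (s := {Sum.inr v}ᶜ) (i := Sum.inr v) (by simp)
  refine fun h2 => h1 (acl_mono ?_ h2)
  rintro x (rfl | ⟨u, hu, rfl | rfl⟩)
  · exact ⟨Sum.inl v, by simp, rfl⟩
  · exact ⟨Sum.inl u, by simp, rfl⟩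
  · exact ⟨Sum.inr u, by simpa using hu, rfl⟩

theorem z_ne (hab : a ≠ b) : z a ≠ z b := by
  intro h0
  apply notMem_acl_others h (v := a)
  rw [h0]
  exact mem_others_z hab.symm

theorem w_ne (hab : a ≠ b) : w a ≠ w b := by
  intro h0
  apply notMem_acl_insert_others h (v := a)
  rw [h0]
  exact acl_mono (Set.subset_insert _ _) (mem_others_w hab.symm)

theorem det_ne (hab : a ≠ b) (hac : a ≠ c) (hbc : b ≠ c) :
    (z b - z a) * (w c - w a) ≠ (z c - z a) * (w b - w a) := by
  intro h0
  have h1 : z b - z a ≠ 0 := sub_ne_zero.2 (z_ne h hab.symm)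
  apply notMem_acl_insert_others h (v := c)
  have h2 : w c = (z b - z a)⁻¹ * ((z c - z a) * (w b - w a)) + w a := by
    rw [← h0]; field_simp; ring
  have hle : acl F (others z w c) ≤ acl F (insert (z c) (others z w c)) :=
    acl_mono (Set.subset_insert _ _)
  rw [h2]
  exact add_mem (mul_mem (inv_mem (hle (sub_mem (mem_others_z hbc) (mem_others_z hac))))
    (mul_mem (sub_mem (mem_acl_of_mem (Set.mem_insert _ _)) (hle (mem_others_z hac)))
      (hle (sub_mem (mem_others_w hbc) (mem_others_w hac))))) (hle (mem_others_w hac))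

theorem genericStar {T : Set Ω} (hT : T ⊆ acl F (others z w v)) (ha : a ≠ v) (hb : b ≠ v)
    (hc : c ≠ v) (hab : a ≠ b) (hac : a ≠ c) (hbc : b ≠ c) :
    GenericStar (acl F T) (others z w v) (z v - z a) (w v - w a) (z b - z a) (w b - w a)
      (z c - z a) (w c - w a) where
  left h0 := by
    rw [mem_acl_acl_iff hT] at h0
    apply notMem_acl_others h (v := v)
    simpa using add_mem h0 (mem_others_z ha)
  right h0 := by
    rw [mem_acl_acl_insert_iff hT] at h0
    apply notMem_acl_insert_others h (v := v)
    have h1 : w v - w a ∈ acl F (insert (z v) (others z w v)) := by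
      refine acl_insert_le (Set.subset_insert _ _) (sub_mem (mem_acl_of_mem
        (Set.mem_insert _ _)) (acl_mono (Set.subset_insert _ _) (mem_others_z ha))) h0
    simpa using add_mem h1 (acl_mono (Set.subset_insert _ _) (mem_others_w ha))
  α₂_mem := (mem_acl_acl_iff hT).2 (sub_mem (mem_others_z hb) (mem_others_z ha))
  β₂_mem := (mem_acl_acl_iff hT).2 (sub_mem (mem_others_w hb) (mem_others_w ha))
  α₃_mem := (mem_acl_acl_iff hT).2 (sub_mem (mem_others_z hc) (mem_others_z ha))
  β₃_mem := (mem_acl_acl_iff hT).2 (sub_mem (mem_others_w hc) (mem_others_w ha))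
  det := det_ne h hab hac hbc

end

theorem AlgebraicIndepOn.insert_of_notMem_acl (hE : AlgebraicIndepOn F (sqDist z w) E)
    {e : Sym2 β} (he : sqDist z w e ∉ acl F (sqDist z w '' E)) :
    AlgebraicIndepOn F (sqDist z w) (insert e E) := hE.insert he

theorem independent_degree_one (h : AlgebraicIndependent F (Sum.elim z w))
    (hE : AlgebraicIndepOn F (sqDist z w) E) (hv : ∀ e ∈ E, v ∉ e) (ha : a ≠ v) :
    AlgebraicIndepOn F (sqDist z w) (insert s(v, a) E) := by
  refine hE.insert_of_notMem_acl fun h0 => ?_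
  refine degree_one_independent (mem_others_z ha) (mem_others_w ha)
    (notMem_acl_others h) (notMem_acl_insert_others h) ?_
  exact acl_mono (Set.subset_insert _ _) (acl_le (sqDist_image_subset hv) h0)

theorem independent_degree_two (h : AlgebraicIndependent F (Sum.elim z w))
    (hE : AlgebraicIndepOn F (sqDist z w) E) (hv : ∀ e ∈ E, v ∉ e) (ha : a ≠ v) (hb : b ≠ v)
    (hab : a ≠ b) :
    AlgebraicIndepOn F (sqDist z w) (insert s(v, b) (insert s(v, a) E)) := by
  refine (independent_degree_one h hE hv ha).insert_of_notMem_acl fun h0 => ?_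
  refine (degree_two_independent (mem_others_z ha) (mem_others_w ha) (mem_others_z hb)
    (mem_others_w hb) (notMem_acl_others h) (notMem_acl_insert_others h) (z_ne h hab)
    (w_ne h hab)).2 ?_
  rw [Set.image_insert_eq] at h0
  refine acl_le (Set.insert_subset (mem_acl_of_mem (Set.mem_insert _ _)) ?_) h0
  exact (sqDist_image_subset hv).trans (acl_mono (Set.subset_insert _ _))

theorem independent_degree_three [CharZero F] (h : AlgebraicIndependent F (Sum.elim z w))
    (hE : AlgebraicIndepOn F (sqDist z w) E) (hv : ∀ e ∈ E, v ∉ e) (ha : a ≠ v) (hb : b ≠ v)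
    (hc : c ≠ v) (hab : a ≠ b) (hac : a ≠ c) (hbc : b ≠ c)
    (hD : sqDist z w s(b, a) ∉ acl F (sqDist z w '' E)) :
    AlgebraicIndepOn F (sqDist z w) (insert s(v, c) (insert s(v, b) (insert s(v, a) E))) := by
  refine (independent_degree_two h hE hv ha hb hab).insert_of_notMem_acl fun h0 => ?_
  have hs := genericStar h (sqDist_image_subset hv) ha hb hc hab hac hbc
  have := charZero_of_injective_algebraMap (algebraMap F (acl F (sqDist z w '' E))).injective
  refine hs.notMem_acl (acl_algebraicallyClosed _) (mem_range_acl_iff.not.2 hD) ?_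
  rw [mem_acl_acl]
  simp only [sub_sub_sub_cancel_right]
  refine acl_mono ?_ h0
  rw [Set.image_insert_eq, Set.image_insert_eq]
  rintro x (rfl | rfl | hx)
  · exact Or.inr (Or.inr rfl)
  · exact Or.inr (Or.inl rfl)
  · exact Or.inl hx

end
end

noncomputable section

section
variable {F Ω β : Type*} [Field F] [Field Ω] [Algebra F Ω]
variable {z w : β → Ω} {E E' : Set (Sym2 β)} {v a b c : β}

theorem RationalInProducts.of_polynomials (hP : GenericPlacement F z w)
    (h : ∀ e ∈ acl F (sqDist z w '' E), e ∈ Algebra.adjoin F (Set.range (Sum.elim z w)) →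
      e ∈ IntermediateField.adjoin F (rigidProducts F z w E)) : RationalInProducts F z w E := by
  intro x hx
  obtain ⟨y, hy, hyx⟩ := (mem_acl.1 hx).exists_integral_multiple
  have hsub : (sqDist z w '' E) ⊆ Algebra.adjoin F (Set.range (Sum.elim z w)) := by
    rintro _ ⟨e, -, rfl⟩
    induction e with
    | _ p q =>
      have hz : ∀ u, z u ∈ Algebra.adjoin F (Set.range (Sum.elim z w)) := fun u =>
        Algebra.subset_adjoin ⟨Sum.inl u, rfl⟩
      have hw : ∀ u, w u ∈ Algebra.adjoin F (Set.range (Sum.elim z w)) := fun u =>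
        Algebra.subset_adjoin ⟨Sum.inr u, rfl⟩
      exact mul_mem (sub_mem (hz _) (hz _)) (sub_mem (hw _) (hw _))
  have hle : Algebra.adjoin F (sqDist z w '' E) ≤
      Algebra.adjoin F (Set.range (Sum.elim z w)) := Algebra.adjoin_le hsub
  have h1 : (y : Ω) * x ∈ Algebra.adjoin F (Set.range (Sum.elim z w)) := by
    refine hP.integral _ ?_
    obtain ⟨p, hp, hpx⟩ := hyx
    refine ⟨p.map (Subalgebra.inclusion hle).toRingHom, hp.map _, ?_⟩
    rw [Polynomial.eval₂_map]
    exact hpx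
  have hyE : (y : Ω) ∈ acl F (sqDist z w '' E) := algebraAdjoin_le_acl _ y.2
  have h2 := h _ (mul_mem hyE hx) h1
  have hy2 : (y : Ω) ∈ IntermediateField.adjoin F (rigidProducts F z w E) := by
    refine IntermediateField.algebra_adjoin_le_adjoin F _ (Algebra.adjoin_mono ?_ y.2)
    rintro _ ⟨e, he, rfl⟩
    induction e with
    | _ p q => exact mem_rigidProducts (mem_acl_of_mem ⟨_, he, rfl⟩)
  have hy0 : (y : Ω) ≠ 0 := by simpa using hy
  have := mul_mem (inv_mem hy2) h2
  rwa [inv_mul_cancel_left₀ hy0] at this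

theorem mem_adjoin_pair {T : Set Ω} (hT : T ⊆ acl F (others z w v)) {e : Ω}
    (he : e ∈ Algebra.adjoin F (Set.range (Sum.elim z w))) :
    e ∈ Algebra.adjoin (acl (acl F T) (others z w v)) {z v, w v} := by
  refine Algebra.adjoin_induction ?_ (fun r => ?_) (fun x y _ _ => add_mem)
    (fun x y _ _ => mul_mem) he
  · rintro _ ⟨u | u, rfl⟩
    · by_cases hu : u = v
      · subst hu
        exact Algebra.subset_adjoin (by simp)
      · exact (Algebra.adjoin _ _).algebraMap_mem
          (⟨z u, (mem_acl_acl_iff hT).2 (mem_others_z hu)⟩ : acl (acl F T) (others z w v))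
    · by_cases hu : u = v
      · subst hu
        exact Algebra.subset_adjoin (by simp)
      · exact (Algebra.adjoin _ _).algebraMap_mem
          (⟨w u, (mem_acl_acl_iff hT).2 (mem_others_w hu)⟩ : acl (acl F T) (others z w v))
  · exact (Algebra.adjoin _ _).algebraMap_mem
      (⟨algebraMap F Ω r, (mem_acl_acl_iff hT).2 ((acl F _).algebraMap_mem r)⟩ :
        acl (acl F T) (others z w v))

theorem Subalgebra.mem_of_sub_mem {R A : Type*} [CommRing R] [CommRing A] [Algebra R A]
    {S : Subalgebra R A} {x y : A} (hy : y ∈ S) (h : x - y ∈ S) : x ∈ S := by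
  simpa using add_mem h hy

theorem mem_adjoin_pair_sub {T : Set Ω} (hT : T ⊆ acl F (others z w v)) (ha : a ≠ v) {e : Ω}
    (he : e ∈ Algebra.adjoin F (Set.range (Sum.elim z w))) :
    e ∈ Algebra.adjoin (acl (acl F T) (others z w v)) {z v - z a, w v - w a} := by
  refine Algebra.adjoin_le ?_ (mem_adjoin_pair hT he)
  have hz : z a ∈ Algebra.adjoin (acl (acl F T) (others z w v)) {z v - z a, w v - w a} :=
    (Algebra.adjoin _ _).algebraMap_mem
      (⟨z a, (mem_acl_acl_iff hT).2 (mem_others_z ha)⟩ : acl (acl F T) (others z w v))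
  have hw : w a ∈ Algebra.adjoin (acl (acl F T) (others z w v)) {z v - z a, w v - w a} :=
    (Algebra.adjoin _ _).algebraMap_mem
      (⟨w a, (mem_acl_acl_iff hT).2 (mem_others_w ha)⟩ : acl (acl F T) (others z w v))
  rintro x (rfl | rfl)
  · exact Subalgebra.mem_of_sub_mem hz (Algebra.subset_adjoin (Set.mem_insert _ _))
  · exact Subalgebra.mem_of_sub_mem hw (Algebra.subset_adjoin (Set.mem_insert_of_mem _ rfl))

theorem acl_image_le (h : E' ⊆ E) : acl F (sqDist z w '' E') ≤ acl F (sqDist z w '' E) :=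
  acl_mono (Set.image_mono h)

theorem charZero_acl [CharZero F] (T : Set Ω) : CharZero (acl F T) :=
  charZero_of_injective_algebraMap (algebraMap F (acl F T)).injective

theorem RationalInProducts.empty [IsAlgClosed F] : RationalInProducts F z w ∅ := by
  intro x hx
  rw [Set.image_empty] at hx
  have hi := (isAlgebraic_of_mem_acl_empty hx).isIntegral
  obtain ⟨c, rfl⟩ := minpoly.mem_range_of_degree_eq_one F x
    (IsAlgClosed.degree_eq_one_of_irreducible F (minpoly.irreducible hi))
  exact (IntermediateField.adjoin F _).algebraMap_mem c

variable [CharZero F]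

theorem RationalInProducts.degree_one (hP : GenericPlacement F z w)
    (hE : RationalInProducts F z w E) (hv : ∀ e ∈ E, v ∉ e) (ha : a ≠ v) :
    RationalInProducts F z w (insert s(v, a) E) := by
  refine .of_polynomials hP fun e he heP => ?_
  have hT := sqDist_image_subset (F := F) (z := z) (w := w) hv
  have := charZero_acl (F := F) (sqDist z w '' E)
  have he' : e ∈ acl (acl F (sqDist z w '' E)) {(z v - z a) * (w v - w a)} := by
    rw [mem_acl_acl]
    refine acl_mono ?_ he
    rw [Set.image_insert_eq]
    rintro x (rfl | hx)
    · exact Or.inr rfl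
    · exact Or.inl hx
  have := degree_one_descent (acl_algebraicallyClosed _)
    ((mem_acl_acl_iff hT).2 (mem_others_z ha)) ((mem_acl_acl_iff hT).2 (mem_others_w ha))
    ((mem_acl_acl_iff hT).not.2 (notMem_acl_others hP.indep))
    ((mem_acl_acl_insert_iff hT).not.2 (notMem_acl_insert_others hP.indep))
    (mem_adjoin_pair hT heP) he'
  refine IntermediateField.mem_of_mem_algebraAdjoin
    (hE.le (acl_image_le (Set.subset_insert _ _))) ?_ this
  rw [Set.singleton_subset_iff]
  exact IntermediateField.subset_adjoin _ _
    (mem_rigidProducts (a := v) (b := a) (mem_acl_of_mem ⟨_, Set.mem_insert _ _, rfl⟩))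

omit [CharZero F] in
theorem z_div_mem_products (h : AlgebraicIndependent F (Sum.elim z w)) (hab : a ≠ b)
    (hva : sqDist z w s(v, a) ∈ acl F (sqDist z w '' E))
    (hvb : sqDist z w s(v, b) ∈ acl F (sqDist z w '' E))
    (hba : sqDist z w s(b, a) ∈ acl F (sqDist z w '' E)) :
    (z v - z a) / (z b - z a) ∈ IntermediateField.adjoin F (rigidProducts F z w E) := by
  have hz : z b - z a ≠ 0 := sub_ne_zero.2 (z_ne h hab.symm)
  have hw : w b - w a ≠ 0 := sub_ne_zero.2 (w_ne h hab.symm)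
  have h1 : (z v - z a) / (z b - z a) = (z v - z a) * (w b - w a) / sqDist z w s(b, a) := by
    rw [sqDist_mk]; field_simp
  rw [h1]
  exact div_mem (IntermediateField.subset_adjoin _ _ ⟨v, a, b, hva, hba, hvb, rfl⟩)
    (IntermediateField.subset_adjoin _ _ (mem_rigidProducts hba))

omit [CharZero F] in
theorem w_div_mem_products (h : AlgebraicIndependent F (Sum.elim z w)) (hab : a ≠ b)
    (hva : sqDist z w s(v, a) ∈ acl F (sqDist z w '' E))
    (hvb : sqDist z w s(v, b) ∈ acl F (sqDist z w '' E))
    (hba : sqDist z w s(b, a) ∈ acl F (sqDist z w '' E)) :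
    (w v - w a) / (w b - w a) ∈ IntermediateField.adjoin F (rigidProducts F z w E) := by
  have hz : z b - z a ≠ 0 := sub_ne_zero.2 (z_ne h hab.symm)
  have hw : w b - w a ≠ 0 := sub_ne_zero.2 (w_ne h hab.symm)
  have h1 : (w v - w a) / (w b - w a) = (z b - z a) * (w v - w a) / sqDist z w s(b, a) := by
    rw [sqDist_mk]; field_simp
  rw [h1]
  refine div_mem (IntermediateField.subset_adjoin _ _ ⟨b, a, v, hba, hva, ?_, rfl⟩)
    (IntermediateField.subset_adjoin _ _ (mem_rigidProducts hba))
  rwa [Sym2.eq_swap]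

theorem RationalInProducts.degree_two (hP : GenericPlacement F z w)
    (hE : RationalInProducts F z w E) (hv : ∀ e ∈ E, v ∉ e) (ha : a ≠ v) (hb : b ≠ v)
    (hab : a ≠ b) :
    RationalInProducts F z w (insert s(v, b) (insert s(v, a) E)) := by
  refine .of_polynomials hP fun e he heP => ?_
  have hT := sqDist_image_subset (F := F) (z := z) (w := w) hv
  have := charZero_acl (F := F) (sqDist z w '' E)
  have hEE : E ⊆ insert s(v, b) (insert s(v, a) E) :=
    (Set.subset_insert _ _).trans (Set.subset_insert _ _)
  have he' : e ∈ acl (acl F (sqDist z w '' E))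
      {(z v - z a) * (w v - w a), (z v - z b) * (w v - w b)} := by
    rw [mem_acl_acl]
    refine acl_mono ?_ he
    rw [Set.image_insert_eq, Set.image_insert_eq]
    rintro x (rfl | rfl | hx)
    · exact Or.inr (Or.inr rfl)
    · exact Or.inr (Or.inl rfl)
    · exact Or.inl hx
  have hva : sqDist z w s(v, a) ∈ acl F (sqDist z w '' (insert s(v, b) (insert s(v, a) E))) :=
    mem_acl_of_mem ⟨_, by simp, rfl⟩
  have hvb : sqDist z w s(v, b) ∈ acl F (sqDist z w '' (insert s(v, b) (insert s(v, a) E))) :=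
    mem_acl_of_mem ⟨_, by simp, rfl⟩
  have hza := (mem_acl_acl_iff hT).2 (mem_others_z (F := F) (w := w) ha)
  have hwa := (mem_acl_acl_iff hT).2 (mem_others_w (F := F) (z := z) ha)
  have hzb := (mem_acl_acl_iff hT).2 (mem_others_z (F := F) (w := w) hb)
  have hwb := (mem_acl_acl_iff hT).2 (mem_others_w (F := F) (z := z) hb)
  have hp := (mem_acl_acl_iff hT).not.2 (notMem_acl_others hP.indep)
  have hq := (mem_acl_acl_insert_iff hT).not.2 (notMem_acl_insert_others hP.indep)
  by_cases hD : sqDist z w s(b, a) ∈ acl F (sqDist z w '' E)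
  · have hba := acl_image_le hEE hD
    have := degree_two_descent_of_mem (acl_algebraicallyClosed _) hza hwa hzb hwb hp hq
      (z_ne hP.indep hab) (w_ne hP.indep hab) (mem_range_acl_iff.2 hD)
      (mem_adjoin_pair hT heP) he'
    refine IntermediateField.mem_of_mem_algebraAdjoin (hE.le (acl_image_le hEE)) ?_ this
    rintro x (rfl | rfl)
    · exact z_div_mem_products hP.indep hab hva hvb hba
    · exact w_div_mem_products hP.indep hab hva hvb hba
  · have := degree_two_descent_of_notMem (acl_algebraicallyClosed _) hza hwa hzb hwb hp hq
      (mem_range_acl_iff.not.2 hD) (mem_adjoin_pair hT heP) he'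
    refine IntermediateField.mem_of_mem_algebraAdjoin (hE.le (acl_image_le hEE)) ?_ this
    rintro x (rfl | rfl)
    · exact IntermediateField.subset_adjoin _ _ (mem_rigidProducts hva)
    · exact IntermediateField.subset_adjoin _ _ (mem_rigidProducts hvb)

omit [CharZero F] in
theorem mem_acl_star {e : Ω} {T : Set Ω} (hT : sqDist z w '' E ⊆ T)
    (he : e ∈ acl F (sqDist z w '' insert s(v, c) (insert s(v, b) (insert s(v, a) E)))) :
    e ∈ acl (acl F T) {(z v - z a) * (w v - w a), (z v - z a - (z b - z a)) *
      (w v - w a - (w b - w a)), (z v - z a - (z c - z a)) * (w v - w a - (w c - w a))} := by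
  rw [mem_acl_acl]
  simp only [sub_sub_sub_cancel_right]
  refine acl_mono ?_ he
  rw [Set.image_insert_eq, Set.image_insert_eq, Set.image_insert_eq]
  rintro x (rfl | rfl | rfl | hx)
  · exact Or.inr (Or.inr (Or.inr rfl))
  · exact Or.inr (Or.inr (Or.inl rfl))
  · exact Or.inr (Or.inl rfl)
  · exact Or.inl (hT hx)

theorem RationalInProducts.degree_three_of_notMem (hP : GenericPlacement F z w)
    (hE : RationalInProducts F z w E) (hv : ∀ e ∈ E, v ∉ e) (ha : a ≠ v) (hb : b ≠ v)
    (hc : c ≠ v) (hab : a ≠ b) (hac : a ≠ c) (hbc : b ≠ c)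
    (hD : sqDist z w s(b, a) ∉ acl F (sqDist z w '' E))
    (hD' : sqDist z w s(c, a) ∉ acl F (sqDist z w '' insert s(b, a) E)) :
    RationalInProducts F z w (insert s(v, c) (insert s(v, b) (insert s(v, a) E))) := by
  refine .of_polynomials hP fun e he heP => ?_
  have hT := sqDist_image_subset (F := F) (z := z) (w := w) hv
  have := charZero_acl (F := F) (sqDist z w '' E)
  have hs := genericStar hP.indep hT ha hb hc hab hac hbc
  have hEE : E ⊆ insert s(v, c) (insert s(v, b) (insert s(v, a) E)) :=
    ((Set.subset_insert _ _).trans (Set.subset_insert _ _)).trans (Set.subset_insert _ _)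
  have he' := mem_acl_star subset_rfl he
  generalize hS : insert s(v, c) (insert s(v, b) (insert s(v, a) E)) = S at hEE
  have hva : sqDist z w s(v, a) ∈ acl F (sqDist z w '' S) :=
    mem_acl_of_mem ⟨_, by simp [← hS], rfl⟩
  have hvb : sqDist z w s(v, b) ∈ acl F (sqDist z w '' S) :=
    mem_acl_of_mem ⟨_, by simp [← hS], rfl⟩
  have hvc : sqDist z w s(v, c) ∈ acl F (sqDist z w '' S) :=
    mem_acl_of_mem ⟨_, by simp [← hS], rfl⟩
  have hD2 : (z c - z a) * (w c - w a) ∉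
      acl (acl F (sqDist z w '' E)) {(z b - z a) * (w b - w a)} := by
    rw [mem_acl_acl]
    rwa [Set.image_insert_eq, ← Set.union_singleton] at hD'
  by_cases hbc' : sqDist z w s(c, b) ∈ acl F (sqDist z w '' E)
  · have hcb := acl_image_le hEE hbc'
    have := hs.mem_algebraAdjoin_of_normalized (acl_algebraicallyClosed _)
      (mem_range_acl_iff.not.2 hD) hD2
      (fun h => z_ne hP.indep hbc (sub_left_injective h))
      (fun h => w_ne hP.indep hbc (sub_left_injective h))
      (by rw [mem_range_acl_iff]; simpa only [sub_sub_sub_cancel_right, sqDist_mk] using hbc')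
      (mem_adjoin_pair_sub hT ha heP) he'
    simp only [sub_sub_sub_cancel_right] at this
    refine IntermediateField.mem_of_mem_algebraAdjoin (hE.le (acl_image_le hEE)) ?_ this
    rintro x (rfl | rfl | rfl)
    · exact IntermediateField.subset_adjoin _ _ (mem_rigidProducts hva)
    · exact z_div_mem_products hP.indep hbc hvb hvc hcb
    · exact w_div_mem_products hP.indep hbc hvb hvc hcb
  · have := hs.mem_algebraAdjoin_of_independent (acl_algebraicallyClosed _)
      (mem_range_acl_iff.not.2 hD) hD2
      (by rw [mem_range_acl_iff]; simpa only [sub_sub_sub_cancel_right, sqDist_mk] using hbc')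
      (mem_adjoin_pair_sub hT ha heP) he'
    simp only [sub_sub_sub_cancel_right] at this
    refine IntermediateField.mem_of_mem_algebraAdjoin (hE.le (acl_image_le hEE)) ?_ this
    rintro x (rfl | rfl | rfl)
    · exact IntermediateField.subset_adjoin _ _ (mem_rigidProducts hva)
    · exact IntermediateField.subset_adjoin _ _ (mem_rigidProducts hvb)
    · exact IntermediateField.subset_adjoin _ _ (mem_rigidProducts hvc)

theorem sqDist_mem_acl_of_star (h : AlgebraicIndependent F (Sum.elim z w))
    (hv : ∀ e ∈ E, v ∉ e) (ha : a ≠ v) (hb : b ≠ v)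
    (hc : c ≠ v) (hab : a ≠ b) (hac : a ≠ c) (hbc : b ≠ c)
    (hD : sqDist z w s(b, a) ∉ acl F (sqDist z w '' E))
    (hca : sqDist z w s(c, a) ∈ acl F (sqDist z w '' insert s(b, a) E))
    (hcb : sqDist z w s(c, b) ∈ acl F (sqDist z w '' insert s(b, a) E)) :
    sqDist z w s(b, a) ∈
      acl F (sqDist z w '' insert s(v, c) (insert s(v, b) (insert s(v, a) E))) := by
  have hv' : ∀ e ∈ insert s(b, a) E, v ∉ e := by
    rintro e (rfl | he)
    · simp [ha.symm, hb.symm]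
    · exact hv e he
  have hT := sqDist_image_subset (F := F) (z := z) (w := w) hv
  have hT' := sqDist_image_subset (F := F) (z := z) (w := w) hv'
  have := charZero_acl (F := F) (sqDist z w '' E)
  have := charZero_acl (F := F) (sqDist z w '' insert s(b, a) E)
  have h1 := (genericStar h hT' ha hb hc hab hac hbc).mul_mem_algebraAdjoin
    (acl_algebraicallyClosed _) (mem_range_acl_iff.2 (mem_acl_of_mem ⟨s(b, a), by simp, rfl⟩))
    (mem_range_acl_iff.2 hca)
    (by rw [mem_range_acl_iff]; simpa only [sub_sub_sub_cancel_right, sqDist_mk] using hcb)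
  have h2 := (genericStar h hT ha hb hc hab hac hbc).mul_notMem_acl
    (acl_algebraicallyClosed _) (mem_range_acl_iff.not.2 hD)
  have h3 := mem_acl_acl.1 (algebraAdjoin_le_acl _ h1)
  rw [ Set.image_insert_eq, Set.insert_union] at h3
  rw [mem_acl_acl] at h2
  refine acl_le ?_ (acl_exchange h3 h2)
  simp only [sub_sub_sub_cancel_right]
  generalize hS : insert s(v, c) (insert s(v, b) (insert s(v, a) E)) = S
  have hva : sqDist z w s(v, a) ∈ acl F (sqDist z w '' S) :=
    mem_acl_of_mem ⟨_, by simp [← hS], rfl⟩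
  have hvb : sqDist z w s(v, b) ∈ acl F (sqDist z w '' S) :=
    mem_acl_of_mem ⟨_, by simp [← hS], rfl⟩
  have hvc : sqDist z w s(v, c) ∈ acl F (sqDist z w '' S) :=
    mem_acl_of_mem ⟨_, by simp [← hS], rfl⟩
  rintro x (rfl | ⟨e, he, rfl⟩ | rfl | rfl)
  · exact hva
  · exact mem_acl_of_mem ⟨e, by simp [← hS, he], rfl⟩
  · exact sub_mem hva hvb
  · exact sub_mem hva hvc

theorem RationalInProducts.degree_three_of_mem (hP : GenericPlacement F z w)
    (hE : RationalInProducts F z w (insert s(b, a) E)) (hv : ∀ e ∈ E, v ∉ e) (ha : a ≠ v)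
    (hb : b ≠ v) (hc : c ≠ v) (hab : a ≠ b) (hac : a ≠ c) (hbc : b ≠ c)
    (hD : sqDist z w s(b, a) ∉ acl F (sqDist z w '' E))
    (hca : sqDist z w s(c, a) ∈ acl F (sqDist z w '' insert s(b, a) E))
    (hcb : sqDist z w s(c, b) ∈ acl F (sqDist z w '' insert s(b, a) E)) :
    RationalInProducts F z w (insert s(v, c) (insert s(v, b) (insert s(v, a) E))) := by
  refine .of_polynomials hP fun e he heP => ?_
  have hba := sqDist_mem_acl_of_star hP.indep hv ha hb hc hab hac hbc hD hca hcb
  have hv' : ∀ e ∈ insert s(b, a) E, v ∉ e := by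
    rintro e (rfl | he)
    · simp [ha.symm, hb.symm]
    · exact hv e he
  have hT := sqDist_image_subset (F := F) (z := z) (w := w) hv'
  have := charZero_acl (F := F) (sqDist z w '' insert s(b, a) E)
  have he' := mem_acl_star (Set.image_mono (Set.subset_insert s(b, a) E)) he
  have := (genericStar hP.indep hT ha hb hc hab hac hbc).mem_algebraAdjoin_of_mem_range
    (acl_algebraicallyClosed _) (mem_range_acl_iff.2 (mem_acl_of_mem ⟨s(b, a), by simp, rfl⟩))
    (mem_range_acl_iff.2 hca)
    (by rw [mem_range_acl_iff]; simpa only [sub_sub_sub_cancel_right, sqDist_mk] using hcb)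
    (mem_adjoin_pair_sub hT ha heP) he'
  simp only [sub_sub_sub_cancel_right] at this
  have hEE : E ⊆ insert s(v, c) (insert s(v, b) (insert s(v, a) E)) :=
    ((Set.subset_insert _ _).trans (Set.subset_insert _ _)).trans (Set.subset_insert _ _)
  generalize hS : insert s(v, c) (insert s(v, b) (insert s(v, a) E)) = S at *
  refine IntermediateField.mem_of_mem_algebraAdjoin (hE.le (acl_le ?_)) ?_ this
  · rw [Set.image_insert_eq]
    exact Set.insert_subset hba ((Set.image_mono hEE).trans (subset_acl _))
  · have hm : ∀ f ∈ S, sqDist z w f ∈ IntermediateField.adjoin F (rigidProducts F z w S) := by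
      intro f hf
      induction f with
      | _ p q => exact IntermediateField.subset_adjoin _ _
                  (mem_rigidProducts (mem_acl_of_mem ⟨_, hf, rfl⟩))
    rintro x (rfl | rfl | rfl)
    · exact hm s(v, a) (by simp [← hS])
    · exact hm s(v, b) (by simp [← hS])
    · exact hm s(v, c) (by simp [← hS])

theorem RationalInProducts.degree_three (hP : GenericPlacement F z w)
    (hE : RationalInProducts F z w E) (hE' : RationalInProducts F z w (insert s(b, a) E))
    (hv : ∀ e ∈ E, v ∉ e) (ha : a ≠ v)
    (hb : b ≠ v) (hc : c ≠ v) (hab : a ≠ b) (hac : a ≠ c) (hbc : b ≠ c)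
    (hD : sqDist z w s(b, a) ∉ acl F (sqDist z w '' E)) :
    RationalInProducts F z w (insert s(v, c) (insert s(v, b) (insert s(v, a) E))) := by
  by_cases hca : sqDist z w s(c, a) ∈ acl F (sqDist z w '' insert s(b, a) E)
  · by_cases hcb : sqDist z w s(c, b) ∈ acl F (sqDist z w '' insert s(b, a) E)
    · exact hE'.degree_three_of_mem hP hv ha hb hc hab hac hbc hD hca hcb
    · rw [Sym2.eq_swap (a := b)] at hD hcb
      rw [Set.insert_comm s(v, b)]
      exact hE.degree_three_of_notMem hP hv hb ha hc hab.symm hbc hac hD hcb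
  · exact hE.degree_three_of_notMem hP hv ha hb hc hab hac hbc hD hca

end
end

noncomputable section

section
variable {F Ω β : Type*} [Field F] [Field Ω] [Algebra F Ω] [DecidableEq β]
variable {z w : β → Ω} {v a b c : β}

namespace Laman
variable {E : Finset (Sym2 β)}

theorem mem_star {e : Sym2 β} : e ∈ star E v ↔ e ∈ E ∧ v ∈ e := by
  simp [star]

theorem Sparse.exists_of_mem_star (hE : Sparse E) {e : Sym2 β} (he : e ∈ star E v) :
    ∃ a, a ≠ v ∧ e = s(v, a) := by
  obtain ⟨h1, a, rfl⟩ := mem_star.1 he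
  exact ⟨a, fun h => hE.not_isDiag _ h1 (by simp [h]), rfl⟩

theorem notMem_of_mem_sdiff_star {e : Sym2 β} (he : e ∈ E \ star E v) : v ∉ e := by
  rw [Finset.mem_sdiff, mem_star] at he
  exact fun h => he.2 ⟨he.1, h⟩

theorem coe_eq_sdiff_union_star :
    (E : Set (Sym2 β)) = ((E \ star E v : Finset (Sym2 β)) : Set (Sym2 β)) ∪ star E v := by
  rw [← Finset.coe_union, Finset.sdiff_union_of_subset]
  exact fun e he => (mem_star.1 he).1

end Laman

open Laman

omit [DecidableEq β] in
theorem AlgebraicIndepOn.notMem_acl {E : Set (Sym2 β)} {e : Sym2 β}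
    (h : AlgebraicIndepOn F (sqDist z w) (insert e E)) (he : e ∉ E) :
    sqDist z w e ∉ acl F (sqDist z w '' E) :=
  ((AlgebraicIndepOn.insert_iff he).1 h).2

theorem Laman.independent_and_rational [CharZero F] [IsAlgClosed F]
    (hP : GenericPlacement F z w) {E : Finset (Sym2 β)} (hE : Sparse E) :
    AlgebraicIndepOn F (sqDist z w) (E : Set (Sym2 β)) ∧
      RationalInProducts F z w (E : Set (Sym2 β)) := by
  induction hn : E.card using Nat.strong_induction_on generalizing E with
  | _ n ih =>
  subst hn
  rcases E.eq_empty_or_nonempty with rfl | hne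
  · rw [Finset.coe_empty]
    exact ⟨(algebraicIndependent_empty_type_iff ..).2 (algebraMap F Ω).injective, .empty⟩
  obtain ⟨v, hv0, hv3⟩ := hE.exists_star_card_le hne
  have hE' : Sparse (E \ star E v) := hE.mono Finset.sdiff_subset
  have hstar : star E v ⊆ E := fun e he => (mem_star.1 he).1
  have hcard : (E \ star E v).card + (star E v).card = E.card :=
    Finset.card_sdiff_add_card_eq_card hstar
  obtain ⟨hi, hr⟩ := ih _ (by omega) hE' rfl
  have hv : ∀ e ∈ ((E \ star E v : Finset (Sym2 β)) : Set (Sym2 β)), v ∉ e := fun e he =>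
    notMem_of_mem_sdiff_star he
  have hEeq := coe_eq_sdiff_union_star (E := E) (v := v)
  have hcases : (star E v).card = 1 ∨ (star E v).card = 2 ∨ (star E v).card = 3 := by omega
  rcases hcases with h1 | h2 | h3
  · obtain ⟨e, he⟩ := Finset.card_eq_one.1 h1
    obtain ⟨a, ha, rfl⟩ := hE.exists_of_mem_star (v := v) (e := e) (by simp [he])
    rw [hEeq, he, Finset.coe_singleton, Set.union_singleton, ← he]
    exact ⟨independent_degree_one hP.indep hi hv ha, hr.degree_one hP hv ha⟩
  · obtain ⟨e, f, hef, he⟩ := Finset.card_eq_two.1 h2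
    obtain ⟨a, ha, rfl⟩ := hE.exists_of_mem_star (v := v) (e := e) (by simp [he])
    obtain ⟨b, hb, rfl⟩ := hE.exists_of_mem_star (v := v) (e := f) (by simp [he])
    have hab : a ≠ b := fun h => hef (h ▸ rfl)
    have h4 : (E : Set (Sym2 β)) =
        insert s(v, b) (insert s(v, a) ((E \ star E v : Finset (Sym2 β)) : Set (Sym2 β))) := by
      conv_lhs => rw [hEeq, he, ← he]
      ext x
      simp only [he, Finset.coe_insert, Finset.coe_singleton, Set.mem_union, Set.mem_insert_iff,
        Set.mem_singleton_iff]
      tauto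
    rw [h4]
    exact ⟨independent_degree_two hP.indep hi hv ha hb hab, hr.degree_two hP hv ha hb hab⟩
  · obtain ⟨e, f, g, hef, heg, hfg, he⟩ := Finset.card_eq_three.1 h3
    obtain ⟨a, ha, rfl⟩ := hE.exists_of_mem_star (v := v) (e := e) (by simp [he])
    obtain ⟨b, hb, rfl⟩ := hE.exists_of_mem_star (v := v) (e := f) (by simp [he])
    obtain ⟨c, hc, rfl⟩ := hE.exists_of_mem_star (v := v) (e := g) (by simp [he])
    have hab : a ≠ b := fun h => hef (h ▸ rfl)
    have hac : a ≠ c := fun h => heg (h ▸ rfl)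
    have hbc : b ≠ c := fun h => hfg (h ▸ rfl)
    have key : ∀ a b c, a ≠ v → b ≠ v → c ≠ v → a ≠ b → a ≠ c → b ≠ c →
        star E v = {s(v, a), s(v, b), s(v, c)} →
        (∀ S, TightOn (E \ star E v) S → a ∈ S → b ∉ S) →
        AlgebraicIndepOn F (sqDist z w) (E : Set (Sym2 β)) ∧
          RationalInProducts F z w (E : Set (Sym2 β)) := by
      intro a b c ha hb hc hab hac hbc he hS
      have hS' : Sparse (insert s(b, a) (E \ star E v)) := by
        rw [Sym2.eq_swap]
        exact hE'.insert hab hS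
      obtain ⟨hi', hr'⟩ := ih _ (by have := Finset.card_insert_le s(b, a) (E \ star E v); omega)
        hS' rfl
      rw [Finset.coe_insert] at hi' hr'
      have hD := hi'.notMem_acl (fun h => hS _ (TightOn.of_mem hE' h) (by simp) (by simp))
      have h4 : (E : Set (Sym2 β)) = insert s(v, c) (insert s(v, b) (insert s(v, a)
          ((E \ star E v : Finset (Sym2 β)) : Set (Sym2 β)))) := by
        conv_lhs => rw [hEeq, he, ← he]
        ext x
        simp only [he, Finset.coe_insert, Finset.coe_singleton, Set.mem_union, Set.mem_insert_iff,
          Set.mem_singleton_iff]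
        tauto
      rw [h4]
      exact ⟨independent_degree_three hP.indep hi hv ha hb hc hab hac hbc hD,
        hr.degree_three hP hr' hv ha hb hc hab hac hbc hD⟩
    by_cases hSab : ∀ S, TightOn (E \ star E v) S → a ∈ S → b ∉ S
    · exact key a b c ha hb hc hab hac hbc he hSab
    by_cases hSac : ∀ S, TightOn (E \ star E v) S → a ∈ S → c ∉ S
    · exact key a c b ha hc hb hac hab hbc.symm (by rw [he]; ext; simp; tauto) hSac
    by_cases hSbc : ∀ S, TightOn (E \ star E v) S → b ∈ S → c ∉ S
    · exact key b c a hb hc ha hbc hab.symm hac.symm (by rw [he]; ext; simp; tauto) hSbc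
    push Not at hSab hSac hSbc
    obtain ⟨S, hS, haS, hbS⟩ := hSab
    obtain ⟨T, hT, haT, hcT⟩ := hSac
    obtain ⟨R, hR, hbR, hcR⟩ := hSbc
    obtain ⟨W, hW, haW, hbW, hcW⟩ :=
      TightOn.exists_of_triangle hE' hS hT hR hbc haS hbS haT hcT hbR hcR
    have hm : ∀ x ∈ star E v, x ∈ E := fun x hx => hstar hx
    exact (hE.not_tightOn_of_star hab hac hbc (hm _ (by simp [he])) (hm _ (by simp [he]))
      (hm _ (by simp [he])) hW haW hbW hcW).elim

theorem Laman.exists_tightOn [CharZero F] [IsAlgClosed F]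
    (hP : GenericPlacement F z w) {E : Finset (Sym2 β)} (hE : Sparse E) (hab : a ≠ b)
    (h : sqDist z w s(a, b) ∈ acl F (sqDist z w '' E)) : ∃ S, TightOn E S ∧ a ∈ S ∧ b ∈ S := by
  by_contra! hS
  have hi := (independent_and_rational hP (hE.insert hab hS)).1
  rw [Finset.coe_insert] at hi
  exact hi.notMem_acl (fun h => hS _ (TightOn.of_mem hE h) (by simp) (by simp)) h

end
end

noncomputable section

section
variable {F Ω β : Type*} [Field F] [Field Ω] [Algebra F Ω] [DecidableEq β]
variable {z w : β → Ω} {v a b c : β}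

open Laman

/-- Algebraically independent families in the algebraic closure of a set are not larger than
the set. -/
theorem AlgebraicIndepOn.encard_le {ι : Type*} {f : ι → Ω} {I : Set ι}
    (h : AlgebraicIndepOn F f I) {T : Set Ω} (hT : f '' I ⊆ acl F T) :
    I.encard ≤ T.encard := by
  have hinj : Set.InjOn f I := fun x hx y hy hxy =>
    congrArg Subtype.val (AlgebraicIndependent.injective h (a₁ := ⟨x, hx⟩) (a₂ := ⟨y, hy⟩) hxy)
  have hF : FaithfulSMul F Ω := inferInstance
  have h1 : (AlgebraicIndependent.matroid F Ω).Indep (f '' I) := by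
    rw [AlgebraicIndependent.matroid_indep_iff]
    exact h.image
  have h2 : f '' I ⊆ (AlgebraicIndependent.matroid F Ω).closure T := by
    rw [AlgebraicIndependent.matroid_closure_eq]
    exact hT
  calc I.encard = (f '' I).encard := hinj.encard_image.symm
    _ ≤ _ := h1.encard_le_eRk_of_subset h2
    _ = _ := Matroid.eRk_closure_eq _ _
    _ ≤ _ := Matroid.eRk_le_encard _ _

theorem Laman.TightOn.sqDist_mem_acl [CharZero F] [IsAlgClosed F]
    (hP : GenericPlacement F z w) {E : Finset (Sym2 β)} (hE : Sparse E) {S : Finset β}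
    (hS : TightOn E S) (ha : a ∈ S) (hb : b ∈ S) :
    sqDist z w s(a, b) ∈ acl F (sqDist z w '' E) := by
  by_cases hab : a = b
  · subst hab
    rw [sqDist_mk, sub_self, zero_mul]
    exact zero_mem _
  have hza : z b - z a ≠ 0 := sub_ne_zero.2 (z_ne hP.indep (Ne.symm hab))
  have hwa : w b - w a ≠ 0 := sub_ne_zero.2 (w_ne hP.indep (Ne.symm hab))
  set E' := E ∩ S.sym2 with hE'
  suffices h : sqDist z w s(a, b) ∈ acl F (sqDist z w '' (E' : Set (Sym2 β))) from
    acl_image_le (by rw [hE']; exact_mod_cast Finset.inter_subset_left) h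
  by_contra h0
  have hi := (independent_and_rational hP (hE.mono (E' := E') Finset.inter_subset_left)).1
  have hi' := hi.insert_of_notMem_acl h0
  have hmem : s(a, b) ∉ E' := fun h => h0 (mem_acl_of_mem ⟨_, h, rfl⟩)
  set R := (S.erase a).erase b
  set zz : β → Ω := fun u => (z u - z a) / (z b - z a)
  set ww : β → Ω := fun u => (w u - w a) / (w b - w a)
  set T : Finset Ω := insert (sqDist z w s(a, b)) (R.image zz ∪ R.image ww) with hT
  have hzz : ∀ u ∈ S, zz u ∈ acl F (T : Set Ω) := by
    intro u hu
    by_cases hua : u = a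
    · simp only [zz, hua, sub_self, zero_div]; exact zero_mem _
    by_cases hub : u = b
    · simp only [zz, hub, div_self hza]; exact one_mem _
    refine mem_acl_of_mem ?_
    rw [hT, Finset.mem_coe]
    exact Finset.mem_insert_of_mem (Finset.mem_union_left _ (Finset.mem_image_of_mem _
      (by simp [R, hua, hub, hu])))
  have hww : ∀ u ∈ S, ww u ∈ acl F (T : Set Ω) := by
    intro u hu
    by_cases hua : u = a
    · simp only [ww, hua, sub_self, zero_div]; exact zero_mem _
    by_cases hub : u = b
    · simp only [ww, hub, div_self hwa]; exact one_mem _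
    refine mem_acl_of_mem ?_
    rw [hT, Finset.mem_coe]
    exact Finset.mem_insert_of_mem (Finset.mem_union_right _ (Finset.mem_image_of_mem _
      (by simp [R, hua, hub, hu])))
  have hD : sqDist z w s(a, b) ∈ acl F (T : Set Ω) :=
    mem_acl_of_mem (by rw [hT, Finset.mem_coe]; exact Finset.mem_insert_self _ _)
  have hall : ∀ u ∈ S, ∀ v ∈ S, sqDist z w s(u, v) ∈ acl F (T : Set Ω) := by
    intro u hu v hv
    have h1 : sqDist z w s(u, v) = sqDist z w s(a, b) * (zz u - zz v) * (ww u - ww v) := by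
      simp only [sqDist_mk, zz, ww]
      field_simp
      ring
    rw [h1]
    exact mul_mem (mul_mem hD (sub_mem (hzz u hu) (hzz v hv))) (sub_mem (hww u hu) (hww v hv))
  have hle := hi'.encard_le (T := (T : Set Ω)) (by
    rintro _ ⟨e, he | he, rfl⟩
    · rw [he]; exact hD
    · induction e with
      | _ p q =>
        rw [hE', Finset.mem_coe, Finset.mem_inter, Finset.mk_mem_sym2_iff] at he
        exact hall _ he.2.1 _ he.2.2)
  rw [← Finset.coe_insert, Set.encard_coe_eq_coe_finsetCard, Set.encard_coe_eq_coe_finsetCard,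
    Nat.cast_le, Finset.card_insert_of_notMem hmem] at hle
  have h1 : T.card ≤ R.card + R.card + 1 :=
    (Finset.card_insert_le _ _).trans (Nat.add_le_add_right ((Finset.card_union_le _ _).trans
      (add_le_add Finset.card_image_le Finset.card_image_le)) 1)
  have h2 : R.card = S.card - 1 - 1 := by
    rw [Finset.card_erase_of_mem (by simp [hb, Ne.symm hab]), Finset.card_erase_of_mem ha]
  have h3 := hS.1
  have h4 : E'.card + 3 = 2 * S.card := hS.2
  omega

end
end

namespace MvPolynomial

theorem exists_C_mem_of_forall_exists_aeval_ne_zero {D Kb κ : Type*} [CommRing D] [IsDomain D] [Field Kb]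
    [IsAlgClosed Kb] [Algebra D Kb] [FaithfulSMul D Kb] [Finite κ] (I : Ideal (MvPolynomial κ D))
    (hI : ∀ x : κ → Kb, ∃ p ∈ I, aeval x p ≠ 0) : ∃ e : D, e ≠ 0 ∧ C e ∈ I := by
  let _ : Algebra (FractionRing D) Kb := FractionRing.liftAlgebra D Kb
  have _ : IsScalarTower D (FractionRing D) Kb := FractionRing.isScalarTower_liftAlgebra D Kb
  let ψ : MvPolynomial κ D →+* MvPolynomial κ (FractionRing D) := map (algebraMap D (FractionRing D))
  have hempty : zeroLocus Kb (I.map ψ) = ∅ := by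
    ext x
    simp only [mem_zeroLocus_iff, Set.mem_empty_iff_false, iff_false, not_forall]
    obtain ⟨p, hp, hne⟩ := hI x
    refine ⟨ψ p, Ideal.mem_map_of_mem _ hp, ?_⟩
    rwa [aeval_map_algebraMap]
  have htop : I.map ψ = ⊤ := by
    have h := vanishingIdeal_zeroLocus_eq_radical (K := Kb) (I.map ψ)
    rw [hempty, vanishingIdeal_empty] at h
    exact Ideal.radical_eq_top.1 h.symm
  let _ : Algebra (MvPolynomial κ D) (MvPolynomial κ (FractionRing D)) :=
    MvPolynomial.algebraMvPolynomial
  have := MvPolynomial.isLocalization (σ := κ) (nonZeroDivisors D) (FractionRing D)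
  have h := (IsLocalization.map_algebraMap_ne_top_iff_disjoint
    ((nonZeroDivisors D).map (C (σ := κ))) (MvPolynomial κ (FractionRing D)) I).not
  have h2 := h.1 (by rw [not_not]; exact htop)
  rw [Set.not_disjoint_iff] at h2
  obtain ⟨_, ⟨e, he, rfl⟩, h3⟩ := h2
  exact ⟨e, nonZeroDivisors.ne_zero he, h3⟩

theorem totalDegree_map_eq_of_injective {R S τ : Type*} [CommSemiring R] [CommSemiring S] (f : R →+* S)
    (hf : Function.Injective f) (p : MvPolynomial τ R) : (map f p).totalDegree = p.totalDegree := by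
  rw [totalDegree, totalDegree, support_map_of_injective _ hf]

theorem totalDegree_map_le' {R S τ : Type*} [CommSemiring R] [CommSemiring S] (f : R →+* S)
    (p : MvPolynomial τ R) : (map f p).totalDegree ≤ p.totalDegree :=
  Finset.sup_mono (support_map_subset f p)

/-- The polynomial whose coefficients at the exponents in `J` are independent variables. -/
noncomputable def generic {τ κ : Type*} (D : Type*) [CommRing D] (J : Finset (τ →₀ ℕ)) (v : J → κ) :
    MvPolynomial τ (MvPolynomial κ D) := ∑ m : J, monomial m.1 (X (v m))

theorem map_generic {τ κ D R : Type*} [CommRing D] [CommRing R] (J : Finset (τ →₀ ℕ)) (v : J → κ)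
    (φ : D →+* R) (x : κ → R) :
    map (eval₂Hom φ x) (generic D J v) = ∑ m : J, monomial m.1 (x (v m)) := by
  simp [generic, map_monomial]

theorem map_generic_mul_generic_sub {τ κ D R : Type*} [CommRing D] [CommRing R] (J : Finset (τ →₀ ℕ))
    (v w : J → κ) (p : MvPolynomial τ D) (φ : D →+* R) (x : κ → R) :
    map (eval₂Hom φ x) (generic D J v * generic D J w - map C p) =
      (∑ m : J, monomial m.1 (x (v m))) * (∑ m : J, monomial m.1 (x (w m))) - map φ p := by
  simp only [map_sub, map_mul, map_generic, map_map]
  congr 2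
  ext a <;> simp

theorem sum_monomial_coeff_eq {τ R : Type*} [CommRing R] (J : Finset (τ →₀ ℕ)) (f : MvPolynomial τ R)
    (hf : f.support ⊆ J) : ∑ m : J, monomial m.1 (coeff m.1 f) = f := by
  rw [Finset.sum_coe_sort J (fun m => monomial m (coeff m f))]
  conv_rhs => rw [f.as_sum]
  symm
  apply Finset.sum_subset hf
  intro m _ hm
  rw [notMem_support_iff.1 hm, monomial_zero]

theorem exists_ne_zero_forall_totalDegree_eq_zero {D Kb τ : Type*} [CommRing D] [IsDomain D] [Field Kb]
    [IsAlgClosed Kb] [Algebra D Kb] [FaithfulSMul D Kb] [Finite τ] (p : MvPolynomial τ D)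
    (hp : Irreducible (map (algebraMap D Kb) p)) :
    ∃ e : D, e ≠ 0 ∧ ∀ {k : Type*} [Field k] (φ : D →+* k), φ e ≠ 0 →
      ∀ f g, map φ p ≠ 0 → map φ p = f * g → totalDegree f = 0 ∨ totalDegree g = 0 := by
  set d := p.totalDegree with hd
  let J : Finset (τ →₀ ℕ) := (Finsupp.finite_of_degree_le (σ := τ) d).toFinset.filter
    (fun m => m.degree < d)
  have hJ : ∀ m, m ∈ J ↔ m.degree < d := fun m => by
    simp only [J, Finset.mem_filter, Set.Finite.mem_toFinset, Set.mem_ofPred_eq]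
    exact ⟨fun h => h.2, fun h => ⟨h.le, h⟩⟩
  let F := generic D J (Sum.inl : J → J ⊕ J)
  let G := generic D J (Sum.inr : J → J ⊕ J)
  let H := F * G - map C p
  let I : Ideal (MvPolynomial (J ⊕ J) D) := Ideal.span (Set.range fun m => coeff m H)
  have hI : ∀ x : J ⊕ J → Kb, ∃ q ∈ I, aeval x q ≠ 0 := by
    intro x
    by_contra! hcon
    have hz : map (eval₂Hom (algebraMap D Kb) x) H = 0 := by
      ext m
      rw [coeff_map, coeff_zero]
      exact hcon _ (Ideal.subset_span ⟨m, rfl⟩)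
    rw [map_generic_mul_generic_sub, sub_eq_zero] at hz
    have hlt : ∀ y : J → Kb, 0 < d → (∑ m : J, monomial m.1 (y m)).totalDegree < d := by
      intro y h0
      obtain ⟨d', hd'⟩ := Nat.exists_eq_succ_of_ne_zero h0.ne'
      rw [hd', Nat.lt_succ_iff]
      refine totalDegree_finsetSum_le fun m _ => ?_
      refine (totalDegree_monomial_le _ _).trans ?_
      have h1 : m.1.degree < d := (hJ m.1).1 m.2
      rw [hd', Nat.lt_succ_iff] at h1
      exact h1
    have hd2 : (map (algebraMap D Kb) p).totalDegree = d :=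
      totalDegree_map_eq_of_injective _ (FaithfulSMul.algebraMap_injective D Kb) _
    have h0 : 0 < d := by
      by_contra! h0
      have : IsEmpty J := ⟨fun m => by have := (hJ m.1).1 m.2; omega⟩
      apply hp.ne_zero
      rw [← hz]; simp
    have hne := hp.ne_zero
    rw [← hz, mul_ne_zero_iff] at hne
    rw [← hz, totalDegree_mul_of_isDomain hne.1 hne.2] at hd2
    have h1 := hlt (fun m => x (Sum.inl m)) h0
    have h2 := hlt (fun m => x (Sum.inr m)) h0
    rcases hp.isUnit_or_isUnit hz.symm with h | h
    · have := (isUnit_iff_totalDegree_of_isReduced.1 h).2; omega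
    · have := (isUnit_iff_totalDegree_of_isReduced.1 h).2; omega
  obtain ⟨e, he, heI⟩ := exists_C_mem_of_forall_exists_aeval_ne_zero I hI
  refine ⟨e, he, fun {k} _ φ hφ f g hne hfg => ?_⟩
  by_contra! hcon
  apply hφ
  rw [hfg, mul_ne_zero_iff] at hne
  have hdeg := totalDegree_mul_of_isDomain hne.1 hne.2
  have hle := totalDegree_map_le' φ p
  rw [hfg, hdeg] at hle
  have hsup : ∀ q : MvPolynomial τ k, q.totalDegree < d → q.support ⊆ J := by
    intro q hq m hm
    rw [hJ]
    refine lt_of_le_of_lt ?_ hq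
    exact le_totalDegree hm
  let x : J ⊕ J → k := Sum.elim (fun m => coeff m.1 f) (fun m => coeff m.1 g)
  have hz : map (eval₂Hom φ x) H = 0 := by
    rw [map_generic_mul_generic_sub, sub_eq_zero, hfg]
    simp only [x, Sum.elim_inl, Sum.elim_inr]
    rw [sum_monomial_coeff_eq J f (hsup f (by omega)), sum_monomial_coeff_eq J g (hsup g (by omega))]
  have hIle : I ≤ RingHom.ker (eval₂Hom φ x) := by
    rw [Ideal.span_le]
    rintro _ ⟨m, rfl⟩
    rw [SetLike.mem_coe, RingHom.mem_ker, ← coeff_map, hz, coeff_zero]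
  have := hIle heI
  simpa [RingHom.mem_ker] using this

end MvPolynomial

namespace MvPolynomial

theorem optionEquivLeft_map {R S σ : Type*} [CommRing R] [CommRing S] (φ : R →+* S)
    (p : MvPolynomial (Option σ) R) :
    optionEquivLeft S σ (map φ p) = (optionEquivLeft R σ p).map (map φ) := by
  have h : ((optionEquivLeft S σ).toRingEquiv.toRingHom.comp (map φ)) =
      (Polynomial.mapRingHom (map φ)).comp
        (optionEquivLeft R σ).toRingEquiv.toRingHom := by
    apply MvPolynomial.ringHom_ext
    · intro a
      simp [optionEquivLeft_C]
    · rintro (_ | i)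
      · simp [optionEquivLeft_X_none]
      · simp [optionEquivLeft_X_some]
  exact congrArg (fun f : _ →+* Polynomial (MvPolynomial σ S) => f p) h

theorem exists_ne_zero_forall_irreducible_map {D Kb σ : Type*} [CommRing D] [IsDomain D] [Field Kb]
    [IsAlgClosed Kb] [Algebra D Kb] [FaithfulSMul D Kb] [Finite σ]
    (p : Polynomial (MvPolynomial σ D)) (hm : p.Monic)
    (hp : Irreducible (p.map (map (algebraMap D Kb)))) :
    ∃ e : D, e ≠ 0 ∧ ∀ {k : Type*} [Field k] (φ : D →+* k), φ e ≠ 0 →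
      Irreducible (p.map (map (σ := σ) φ)) := by
  set p' := (optionEquivLeft D σ).symm p with hp'
  have hpp : optionEquivLeft D σ p' = p := by simp [p']
  have hdeg : p.natDegree ≠ 0 := by
    intro h0
    rw [Polynomial.eq_one_of_monic_natDegree_zero hm h0, Polynomial.map_one] at hp
    exact hp.not_isUnit isUnit_one
  obtain ⟨e, he, H⟩ := exists_ne_zero_forall_totalDegree_eq_zero (Kb := Kb) p' (by
    rw [← MulEquiv.irreducible_iff (optionEquivLeft Kb σ), optionEquivLeft_map, hpp]
    exact hp)
  refine ⟨e, he, fun {k} _ φ hφ => ?_⟩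
  rw [← hpp, ← optionEquivLeft_map, MulEquiv.irreducible_iff (optionEquivLeft k σ)]
  have hmk : (p.map (map (σ := σ) φ)).Monic := hm.map _
  have hne : map φ p' ≠ 0 := by
    intro h
    rw [← hpp, ← optionEquivLeft_map, h, map_zero] at hmk
    exact hmk.ne_zero rfl
  have hunit : ∀ f : MvPolynomial (Option σ) k, f ≠ 0 → f.totalDegree = 0 → IsUnit f := by
    intro f hf h0
    rw [totalDegree_eq_zero_iff_eq_C] at h0
    rw [h0] at hf ⊢
    exact (IsUnit.mk0 _ (by simpa using hf)).map C
  refine ⟨fun hu => ?_, fun f g hfg => ?_⟩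
  · have hu2 := hu.map (optionEquivLeft k σ)
    rw [optionEquivLeft_map, hpp] at hu2
    have h1 := congrArg Polynomial.natDegree (hmk.eq_one_of_isUnit hu2)
    rw [hm.natDegree_map, Polynomial.natDegree_one] at h1
    exact hdeg h1
  · have h2 := hne
    rw [hfg, mul_ne_zero_iff] at h2
    exact (H φ hφ f g hne hfg).imp (hunit f h2.1) (hunit g h2.2)

end MvPolynomial

namespace MvPolynomial

/-- The evaluation of polynomials with coefficients in the integral closure of the base ring. -/
noncomputable def integralEval (B A σ : Type*) [CommRing B] [CommRing A] [Algebra B A]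
    [Algebra (MvPolynomial σ B) A] : MvPolynomial σ (integralClosure B A) →+* A :=
  eval₂Hom (algebraMap (integralClosure B A) A) (fun i => algebraMap (MvPolynomial σ B) A (X i))

theorem exists_ringHom_comp_eq {R K N : Type*} [CommRing R] [CommRing K] [CommRing N] (f : K →+* N)
    (hf : Function.Injective f) (h : R →+* N) (hr : ∀ x, h x ∈ Set.range f) :
    ∃ g : R →+* K, ∀ x, f (g x) = h x := by
  choose g hg using hr
  exact ⟨{ toFun := g
           map_one' := hf (by simp [hg])
           map_zero' := hf (by simp [hg])
           map_add' := fun a b => hf (by simp [hg])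
           map_mul' := fun a b => hf (by simp [hg]) }, hg⟩

theorem exists_irreducible_of_isIntegral_aux {B A σ : Type*} (L N Kb : Type*) [CommRing B] [IsDomain B] [CommRing A]
    [IsDomain A] [IsIntegrallyClosed A] [Algebra B A] [Algebra (MvPolynomial σ B) A]
    [IsScalarTower B (MvPolynomial σ B) A] [Finite σ]
    (hinj : Function.Injective (algebraMap (MvPolynomial σ B) A)) [Field L] [Algebra A L]
    [IsFractionRing A L] [Field N] [Algebra L N] [IsGalois L N] [IsAlgClosed N] [Algebra A N]
    [IsScalarTower A L N] [Algebra B N] [IsScalarTower B A N]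
    [Field Kb] [IsAlgClosed Kb] [Algebra Kb N] [Algebra B Kb] [IsScalarTower B Kb N]
    [Algebra.IsAlgebraic B Kb] (hKb : ∀ x : N, IsAlgebraic B x → x ∈ Set.range (algebraMap Kb N))
    (u : A) (hu : IsIntegral (MvPolynomial σ B) u) :
    ∃ p : Polynomial (MvPolynomial σ (integralClosure B A)), p.Monic ∧
      p.eval₂ (integralEval B A σ) u = 0 ∧ ∃ e : integralClosure B A, e ≠ 0 ∧
        ∀ {k : Type*} [Field k] (φ : integralClosure B A →+* k), φ e ≠ 0 →
          Irreducible (p.map (map (σ := σ) φ)) := by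
  have hAN : Function.Injective (algebraMap A N) := by
    rw [IsScalarTower.algebraMap_eq A L N]
    exact (algebraMap L N).injective.comp (IsFractionRing.injective A L)
  have hKbN := (algebraMap Kb N).injective
  obtain ⟨g, hgval⟩ := exists_ringHom_comp_eq (algebraMap Kb N) hKbN
    ((algebraMap A N).comp (algebraMap (integralClosure B A) A)) (fun θ => hKb _ (by
      exact (θ.2.map (IsScalarTower.toAlgHom B A N)).isAlgebraic))
  have hg : Function.Injective g := fun a b h => by
    apply Subtype.ext
    apply hAN
    have h1 := hgval a
    rw [h, hgval] at h1
    exact h1.symm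
  let t : σ → N := fun i => algebraMap A N (algebraMap (MvPolynomial σ B) A (X i))
  have ht : AlgebraicIndependent B t := by
    have h1 : AlgebraicIndependent B (fun i : σ => (X i : MvPolynomial σ B)) :=
      MvPolynomial.algebraicIndependent_X σ B
    exact h1.map' (f := (IsScalarTower.toAlgHom B A N).comp
      (IsScalarTower.toAlgHom B (MvPolynomial σ B) A)) (hAN.comp hinj)
  have htK : AlgebraicIndependent Kb t := ht.extendScalars Kb
  let _ : Algebra (MvPolynomial σ Kb) N := (aeval (R := Kb) t).toRingHom.toAlgebra
  have hMdef : ∀ q, algebraMap (MvPolynomial σ Kb) N q = aeval t q := fun q => rfl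
  have hMN : Function.Injective (algebraMap (MvPolynomial σ Kb) N) := htK
  have htf : Module.IsTorsionFree (MvPolynomial σ Kb) N :=
    Module.isTorsionFree_iff_algebraMap_injective.2 hMN
  have hnorm : IsIntegrallyClosed (MvPolynomial σ Kb) := UniqueFactorizationMonoid.instIsIntegrallyClosed
  -- the minimal polynomial
  have hcomm : (algebraMap A N).comp (algebraMap (MvPolynomial σ B) A) =
      (algebraMap (MvPolynomial σ Kb) N).comp (map (algebraMap B Kb)) := by
    refine MvPolynomial.ringHom_ext (fun b => ?_) (fun i => ?_)
    · rw [RingHom.comp_apply, RingHom.comp_apply, map_C, hMdef, aeval_C,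
        ← IsScalarTower.algebraMap_apply B Kb N, ← MvPolynomial.algebraMap_eq,
        ← IsScalarTower.algebraMap_apply B (MvPolynomial σ B) A,
        ← IsScalarTower.algebraMap_apply B A N]
    · rw [RingHom.comp_apply, RingHom.comp_apply, map_X, hMdef, aeval_X]
  obtain ⟨q, hqm, hq⟩ := hu
  set v := algebraMap A N u with hv
  have hqv : Polynomial.aeval v (q.map (map (algebraMap B Kb))) = 0 := by
    rw [Polynomial.aeval_def, Polynomial.eval₂_map, ← hcomm, hv, ← Polynomial.hom_eval₂, hq, map_zero]
  have hvint : IsIntegral (MvPolynomial σ Kb) v := ⟨_, hqm.map _, hqv⟩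
  set π := minpoly (MvPolynomial σ Kb) v with hπ
  have hπm : π.Monic := minpoly.monic hvint
  have hπirr : Irreducible π := minpoly.irreducible hvint
  have h_int : ∀ n m, IsIntegral B (coeff m (π.coeff n)) := by
    let _ : Algebra (MvPolynomial σ B) (MvPolynomial σ Kb) := MvPolynomial.algebraMvPolynomial
    intro n
    refine MvPolynomial.isIntegral_iff_isIntegral_coeff.1 ?_
    exact Polynomial.isIntegral_coeff_of_dvd q π hqm hπm (minpoly.isIntegrallyClosed_dvd hvint hqv) n
  have hfix : ∀ (τ : N ≃ₐ[L] N) n m, τ (algebraMap Kb N (coeff m (π.coeff n))) =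
      algebraMap Kb N (coeff m (π.coeff n)) := by
    intro τ
    have hτA : ∀ a : A, τ (algebraMap A N a) = algebraMap A N a := fun a => by
      rw [IsScalarTower.algebraMap_apply A L N, τ.commutes]
    let τB : N →ₐ[B] N := { (τ : N →+* N) with
      commutes' := fun b => by
        change τ (algebraMap B N b) = _
        rw [IsScalarTower.algebraMap_apply B A N, hτA] }
    obtain ⟨tK, htKval⟩ := exists_ringHom_comp_eq (algebraMap Kb N) hKbN
      ((τ : N →+* N).comp (algebraMap Kb N)) (fun c => hKb _ (by
        have h1 : IsAlgebraic B (algebraMap Kb N c) :=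
          (Algebra.IsAlgebraic.isAlgebraic (R := B) c).algHom (IsScalarTower.toAlgHom B Kb N)
        exact h1.algHom τB))
    have hcomp : (algebraMap (MvPolynomial σ Kb) N).comp (map tK) =
        (τ : N →+* N).comp (algebraMap (MvPolynomial σ Kb) N) := by
      refine MvPolynomial.ringHom_ext (fun c => ?_) (fun i => ?_)
      · rw [RingHom.comp_apply, RingHom.comp_apply, map_C, hMdef, aeval_C, hMdef, aeval_C, htKval]
        rfl
      · rw [RingHom.comp_apply, RingHom.comp_apply, map_X, hMdef, aeval_X]
        exact (hτA _).symm
    have hz : Polynomial.aeval v (π.map (map tK)) = 0 := by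
      rw [Polynomial.aeval_def, Polynomial.eval₂_map, hcomp]
      have : v = (τ : N →+* N) v := (hτA u).symm
      rw [this, ← Polynomial.hom_eval₂]
      have : Polynomial.eval₂ (algebraMap (MvPolynomial σ Kb) N) v π = 0 := minpoly.aeval _ _
      rw [this, map_zero]
    have heq : π.map (map tK) = π :=
      Polynomial.eq_of_monic_of_dvd_of_natDegree_le hπm (hπm.map _)
        (minpoly.isIntegrallyClosed_dvd hvint hz) (hπm.natDegree_map _).le
    intro n m
    have h1 := htKval (coeff m (π.coeff n))
    rw [RingHom.comp_apply] at h1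
    refine h1.symm.trans (congrArg _ ?_)
    conv_rhs => rw [← heq, Polynomial.coeff_map, coeff_map]
  have hlift : π ∈ Polynomial.lifts (map (σ := σ) g) := by
    rw [Polynomial.lifts_iff_coeff_lifts]
    intro n
    rw [mem_range_map_iff_coeffs_subset]
    intro c hc
    rw [Finset.mem_coe, mem_coeffs_iff] at hc
    obtain ⟨m, -, rfl⟩ := hc
    have hbot := (InfiniteGalois.mem_bot_iff_fixed (k := L) (algebraMap Kb N (coeff m (π.coeff n)))).2
      (fun τ => hfix τ n m)
    obtain ⟨l, hl⟩ := IntermediateField.mem_bot.1 hbot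
    have hlint : IsIntegral B (algebraMap Kb N (coeff m (π.coeff n))) :=
      (h_int n m).map (IsScalarTower.toAlgHom B Kb N)
    have hl2 : IsIntegral A l := by
      have h3 : IsIntegral A (algebraMap L N l) := by
        rw [hl]; exact hlint.tower_top
      exact (isIntegral_algebraMap_iff (algebraMap L N).injective).1 h3
    obtain ⟨a, rfl⟩ := IsIntegrallyClosed.isIntegral_iff.1 hl2
    rw [← IsScalarTower.algebraMap_apply A L N] at hl
    refine ⟨⟨a, ?_⟩, hKbN ((hgval _).trans hl)⟩
    rw [← hl] at hlint
    exact (isIntegral_algHom_iff (IsScalarTower.toAlgHom B A N) hAN).1 hlint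
  obtain ⟨p, hp⟩ := (Polynomial.mem_lifts _).1 hlift
  have hpm : p.Monic := Polynomial.monic_of_injective (map_injective g hg) (by rw [hp]; exact hπm)
  let _ : Algebra (integralClosure B A) Kb := g.toAlgebra
  have : FaithfulSMul (integralClosure B A) Kb := (faithfulSMul_iff_algebraMap_injective _ _).2 hg
  refine ⟨p, hpm, ?_, exists_ne_zero_forall_irreducible_map (Kb := Kb) p hpm ?_⟩
  · apply hAN
    have hcomp : (algebraMap A N).comp (integralEval B A σ) =
        (algebraMap (MvPolynomial σ Kb) N).comp (map g) := by
      refine MvPolynomial.ringHom_ext (fun c => ?_) (fun i => ?_)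
      · rw [RingHom.comp_apply, RingHom.comp_apply, map_C, hMdef, aeval_C, hgval, integralEval,
          eval₂Hom_C]
        rfl
      · rw [RingHom.comp_apply, RingHom.comp_apply, map_X, hMdef, aeval_X, integralEval, eval₂Hom_X']
    rw [Polynomial.hom_eval₂, hcomp, ← Polynomial.eval₂_map, hp, map_zero]
    exact minpoly.aeval _ _
  · change Irreducible (p.map (map g))
    rw [hp]; exact hπirr

theorem exists_irreducible_of_isIntegral {B A σ : Type*} [CommRing B] [IsDomain B] [CommRing A]
    [IsDomain A] [CharZero A] [IsIntegrallyClosed A] [Algebra B A] [Algebra (MvPolynomial σ B) A]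
    [IsScalarTower B (MvPolynomial σ B) A] [Finite σ]
    (hinj : Function.Injective (algebraMap (MvPolynomial σ B) A))
    (u : A) (hu : IsIntegral (MvPolynomial σ B) u) :
    ∃ p : Polynomial (MvPolynomial σ (integralClosure B A)), p.Monic ∧
      p.eval₂ (integralEval B A σ) u = 0 ∧ ∃ e : integralClosure B A, e ≠ 0 ∧
        ∀ {k : Type*} [Field k] (φ : integralClosure B A →+* k), φ e ≠ 0 →
          Irreducible (p.map (map (σ := σ) φ)) := by
  let L := FractionRing A
  let N := AlgebraicClosure L
  have hBN : Function.Injective (algebraMap B N) := by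
    rw [IsScalarTower.algebraMap_eq B A N, IsScalarTower.algebraMap_eq A L N,
      IsScalarTower.algebraMap_eq B (MvPolynomial σ B) A]
    exact ((algebraMap L N).injective.comp (IsFractionRing.injective A L)).comp
      (hinj.comp (C_injective σ B))
  have : FaithfulSMul B N := (faithfulSMul_iff_algebraMap_injective B N).2 hBN
  have : CharZero L := charZero_of_injective_algebraMap (IsFractionRing.injective A L)
  let K := FractionRing B
  let _ : Algebra K N := FractionRing.liftAlgebra B N
  have : IsScalarTower B K N := FractionRing.isScalarTower_liftAlgebra B N
  have hclosed : IsAlgClosed (algebraicClosure K N) := IsAlgClosure.isAlgClosed K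
  have halg : Algebra.IsAlgebraic B (algebraicClosure K N) := by
    have : Algebra.IsAlgebraic K (algebraicClosure K N) := algebraicClosure.isAlgebraic K N
    exact (IsFractionRing.comap_isAlgebraic_iff (A := B) (K := K) (C := algebraicClosure K N)).2 this
  have htower : IsScalarTower B (algebraicClosure K N) N :=
    IsScalarTower.of_algebraMap_eq fun b => rfl
  refine exists_irreducible_of_isIntegral_aux L N (algebraicClosure K N) hinj (fun x hx => ?_) u hu
  rw [IsFractionRing.isAlgebraic_iff B K N] at hx
  exact ⟨⟨x, mem_algebraicClosure_iff.2 hx⟩, rfl⟩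

end MvPolynomial

theorem exists_primitive_and_smul_mem_adjoin {S A : Type*} (K L : Type*) [CommRing S] [IsDomain S]
    [IsIntegrallyClosed S] [CommRing A] [IsDomain A] [IsIntegrallyClosed A] [Algebra S A]
    [Algebra.IsIntegral S A] [Field K] [Algebra S K] [IsFractionRing S K] [Field L] [Algebra A L]
    [IsFractionRing A L] [Algebra S L] [IsScalarTower S A L] [Algebra K L] [IsScalarTower S K L]
    [FiniteDimensional K L] [CharZero K] :
    ∃ u : A, ∃ G : S, G ≠ 0 ∧ ∀ x : A, ∃ h : Polynomial S, Polynomial.aeval u h = G • x := by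
  obtain ⟨α, hα⟩ := Field.exists_primitive_element K L
  have hαalg : IsAlgebraic S α :=
    (IsFractionRing.isAlgebraic_iff S K L).2 (Algebra.IsAlgebraic.isAlgebraic α)
  obtain ⟨y, hy0, hy⟩ := hαalg.exists_integral_multiple
  have hyA : IsIntegral A (y • α) := hy.tower_top
  obtain ⟨u, hu⟩ := IsIntegrallyClosed.isIntegral_iff.1 hyA
  have hyK : algebraMap S K y ≠ 0 := fun h => hy0 (by
    rwa [map_eq_zero_iff _ (IsFractionRing.injective S K)] at h)
  have hadj : Algebra.adjoin K {algebraMap A L u} = ⊤ := by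
    rw [hu, ← IntermediateField.adjoin_simple_eq_top_iff_of_isAlgebraic
      (Algebra.IsAlgebraic.isAlgebraic _), ← top_le_iff, ← hα, IntermediateField.adjoin_simple_le_iff]
    have h1 : y • α ∈ IntermediateField.adjoin K {y • α} :=
      IntermediateField.mem_adjoin_simple_self K _
    have h2 : α = (algebraMap S K y)⁻¹ • (y • α) := by
      rw [← IsScalarTower.algebraMap_smul K y α, smul_smul, inv_mul_cancel₀ hyK, one_smul]
    have h3 := IntermediateField.smul_mem _ h1 (x := (algebraMap S K y)⁻¹)
    rwa [← h2] at h3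
  have huint : IsIntegral S (algebraMap A L u) := by rw [hu]; exact hy
  let pb := PowerBasis.ofAdjoinEqTop (huint.tower_top (A := K)) hadj
  have hgen : pb.gen = algebraMap A L u := PowerBasis.ofAdjoinEqTop_gen _ _
  have hgint : IsIntegral S pb.gen := by rw [hgen]; exact huint
  have hd0 := Algebra.discr_not_zero_of_basis K pb.basis
  have hdint : IsIntegral S (Algebra.discr K pb.basis) := by
    refine Algebra.discr_isIntegral K (R := S) (b := pb.basis) fun i => ?_
    rw [pb.basis_eq_pow]
    exact hgint.pow _
  obtain ⟨G, hG⟩ := IsIntegrallyClosed.isIntegral_iff.1 hdint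
  refine ⟨u, G, fun h => hd0 (by rw [← hG, h, map_zero]), fun x => ?_⟩
  have hx : IsIntegral S (algebraMap A L x) :=
    (Algebra.IsIntegral.isIntegral (R := S) x).map (IsScalarTower.toAlgHom S A L)
  have hmem := Algebra.discr_mul_isIntegral_mem_adjoin K (B := pb) hgint hx
  rw [← hG, hgen, Algebra.adjoin_singleton_eq_range_aeval] at hmem
  obtain ⟨h, hh⟩ := hmem
  refine ⟨h, IsFractionRing.injective A L ?_⟩
  rw [← Polynomial.aeval_algebraMap_apply]
  rw [IsScalarTower.algebraMap_smul] at hh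
  refine hh.trans ?_
  rw [Algebra.smul_def, Algebra.smul_def, map_mul, ← IsScalarTower.algebraMap_apply]

namespace MvPolynomial

theorem exists_prime_of_point {B A σ k : Type*} [CommRing B] [IsDomain B] [CommRing A] [IsDomain A]
    [Algebra B A] [Algebra (MvPolynomial σ B) A] [IsScalarTower B (MvPolynomial σ B) A]
    [Algebra.IsIntegral (MvPolynomial σ B) A] [FaithfulSMul (MvPolynomial σ B) A]
    [IsIntegrallyClosed (MvPolynomial σ B)] [Finite σ] [Field k] [IsAlgClosed k]
    (p : Polynomial (MvPolynomial σ (integralClosure B A))) (hpm : p.Monic) (u : A)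
    (hu : p.eval₂ (integralEval B A σ) u = 0) (G : MvPolynomial σ B) (r : A →+* k)
    (hsurj : Function.Surjective (r.comp (algebraMap B A)))
    (hirr : Irreducible (p.map (map (σ := σ) (r.comp (algebraMap (integralClosure B A) A)))))
    (hG : map (r.comp (algebraMap B A)) G ≠ 0) :
    ∃ Q : Ideal A, Q.IsPrime ∧ Q ≤ RingHom.ker r ∧
      (∀ b : B, r (algebraMap B A b) = 0 → algebraMap B A b ∈ Q) ∧
      ∀ (x : A) (h : Polynomial (MvPolynomial σ B)), Polynomial.aeval u h = G • x →
        (x ∈ Q ↔ p.map (map (r.comp (algebraMap (integralClosure B A) A))) ∣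
          h.map (map (r.comp (algebraMap B A)))) := by
  set ρ : B →+* k := r.comp (algebraMap B A) with hρ
  set φ : integralClosure B A →+* k := r.comp (algebraMap (integralClosure B A) A) with hφ
  let ev : MvPolynomial σ B →+* MvPolynomial σ k := map ρ
  have hev : Function.Surjective ev := map_surjective ρ hsurj
  have hC : ∀ b : B, algebraMap (MvPolynomial σ B) A (C b) = algebraMap B A b := fun b =>
    (IsScalarTower.algebraMap_apply B (MvPolynomial σ B) A b).symm
  let at_r : MvPolynomial σ k →+* k :=
    (aeval (R := k) (fun i => r (algebraMap (MvPolynomial σ B) A (X i)))).toRingHom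
  have hat : at_r.comp ev = r.comp (algebraMap (MvPolynomial σ B) A) := by
    refine MvPolynomial.ringHom_ext (fun b => ?_) (fun i => ?_)
    · rw [RingHom.comp_apply, RingHom.comp_apply, hC]
      simp [ev, at_r, hρ]
    · simp [ev, at_r]
  have hprime : (RingHom.ker ev).IsPrime := RingHom.ker_isPrime ev
  have hle : RingHom.ker ev ≤ (RingHom.ker r).under (MvPolynomial σ B) := by
    intro x hx
    rw [RingHom.mem_ker] at hx
    rw [Ideal.under_def, Ideal.mem_comap, RingHom.mem_ker, ← RingHom.comp_apply, ← hat,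
      RingHom.comp_apply, hx, map_zero]
  have : (RingHom.ker r).IsPrime := RingHom.ker_isPrime r
  obtain ⟨Q, hQr, hQp, hQover⟩ := Ideal.exists_ideal_le_liesOver_of_le (RingHom.ker r) hle
  have hQS : ∀ x : MvPolynomial σ B, algebraMap _ A x ∈ Q ↔ ev x = 0 := fun x => by
    rw [← RingHom.mem_ker, hQover.over, Ideal.under_def, Ideal.mem_comap]
  let mk := Ideal.Quotient.mk Q
  let rbar : A ⧸ Q →+* k := Ideal.Quotient.lift Q r hQr
  have hrbar : ∀ a, rbar (mk a) = r a := fun a => rfl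
  let j : MvPolynomial σ k →+* A ⧸ Q :=
    ev.liftOfSurjective hev ⟨mk.comp (algebraMap (MvPolynomial σ B) A), fun x hx => by
      rw [RingHom.mem_ker, RingHom.comp_apply, Ideal.Quotient.eq_zero_iff_mem, hQS]
      exact hx⟩
  have hj : ∀ x, j (ev x) = mk (algebraMap _ A x) := fun x =>
    RingHom.liftOfRightInverse_comp_apply _ _ _ _ x
  have hjinj : Function.Injective j := by
    rw [injective_iff_map_eq_zero]
    intro x hx
    obtain ⟨x, rfl⟩ := hev x
    rwa [hj, Ideal.Quotient.eq_zero_iff_mem, hQS] at hx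
  have hjC : ∀ b, j (C (ρ b)) = mk (algebraMap B A b) := fun b => by
    have := hj (C b)
    rw [hC] at this
    rw [← this]; simp [ev]
  have hrj : ∀ c, rbar (j (C c)) = c := fun c => by
    obtain ⟨b, rfl⟩ := hsurj c
    rw [hjC, hrbar]; rfl
  have hθ : ∀ θ : integralClosure B A, mk (algebraMap _ A θ) = j (C (φ θ)) := by
    intro θ
    let _ : Algebra k (A ⧸ Q) := (j.comp C).toAlgebra
    obtain ⟨m, hmm, hm⟩ := θ.2
    have h_int : IsIntegral k (mk (algebraMap _ A θ)) := by
      refine ⟨m.map ρ, hmm.map _, ?_⟩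
      change Polynomial.eval₂ (j.comp C) _ _ = 0
      have h1 : (j.comp C).comp ρ = mk.comp (algebraMap B A) := RingHom.ext hjC
      rw [Polynomial.eval₂_map, h1, ← Polynomial.hom_eval₂]
      exact (congrArg mk hm).trans (map_zero _)
    obtain ⟨c, hc⟩ := minpoly.mem_range_of_degree_eq_one k _
      (IsAlgClosed.degree_eq_one_of_irreducible k (minpoly.irreducible h_int))
    have hc' : j (C c) = mk (algebraMap _ A θ) := hc
    have h2 : φ θ = c := by
      rw [← hrj c, hc', hrbar]; rfl
    rw [h2, hc']
  let _ : Algebra (MvPolynomial σ k) (A ⧸ Q) := j.toAlgebra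
  have htf : Module.IsTorsionFree (MvPolynomial σ k) (A ⧸ Q) :=
    Module.isTorsionFree_iff_algebraMap_injective.2 hjinj
  have hnorm : IsIntegrallyClosed (MvPolynomial σ k) := UniqueFactorizationMonoid.instIsIntegrallyClosed
  set pr := p.map (map (σ := σ) φ) with hpr
  have hprm : pr.Monic := hpm.map _
  have hcomp : j.comp (map φ) = mk.comp (integralEval B A σ) := by
    refine MvPolynomial.ringHom_ext (fun θ => ?_) (fun i => ?_)
    · simp only [RingHom.comp_apply, map_C, integralEval, eval₂Hom_C]
      exact (hθ θ).symm
    · have := hj (X i)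
      simp only [ev, map_X] at this
      simp only [RingHom.comp_apply, map_X, integralEval, eval₂Hom_X', this]
  have hprz : Polynomial.aeval (mk u) pr = 0 := by
    change Polynomial.eval₂ j (mk u) _ = 0
    rw [hpr, Polynomial.eval₂_map, hcomp, ← Polynomial.hom_eval₂, hu, map_zero]
  have h_int : IsIntegral (MvPolynomial σ k) (mk u) := ⟨pr, hprm, hprz⟩
  have hker : ∀ h : Polynomial (MvPolynomial σ k), Polynomial.aeval (mk u) h = 0 ↔ pr ∣ h := by
    intro h
    constructor
    · intro h0
      have h1 := minpoly.isIntegrallyClosed_dvd h_int hprz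
      have h2 := (minpoly.irreducible h_int).associated_of_dvd hirr h1
      exact h2.symm.dvd.trans (minpoly.isIntegrallyClosed_dvd h_int h0)
    · rintro ⟨q, rfl⟩
      rw [map_mul, hprz, zero_mul]
  refine ⟨Q, hQp, hQr, fun b hb => ?_, fun x h hx => ?_⟩
  · rw [← Ideal.Quotient.eq_zero_iff_mem]
    have : ρ b = 0 := hb
    change mk _ = 0
    rw [← hjC, this, map_zero, map_zero]
  · rw [← hker]
    have h1 : Polynomial.aeval (mk u) (h.map ev) = mk (Polynomial.aeval u h) := by
      change Polynomial.eval₂ j (mk u) _ = mk (Polynomial.eval₂ _ u h)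
      rw [Polynomial.eval₂_map, Polynomial.hom_eval₂]
      congr 1
      exact RingHom.ext hj
    have h2 : algebraMap _ A G ∉ Q := fun h => hG ((hQS G).1 h)
    rw [h1, hx, Algebra.smul_def, map_mul, mul_eq_zero, Ideal.Quotient.eq_zero_iff_mem,
      Ideal.Quotient.eq_zero_iff_mem]
    exact ⟨fun h => Or.inr h, fun h => h.resolve_left h2⟩

end MvPolynomial

namespace MvPolynomial

theorem map_eq_map_of_forall_mem_coeffs {R S τ : Type*} [CommSemiring R] [CommSemiring S] (f g : R →+* S)
    (q : MvPolynomial τ R) (h : ∀ c ∈ q.coeffs, f c = g c) : map f q = map g q := by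
  ext m
  rw [coeff_map, coeff_map]
  by_cases hm : coeff m q = 0
  · rw [hm, map_zero, map_zero]
  · exact h _ (mem_coeffs_iff.2 ⟨m, mem_support_iff.2 hm, rfl⟩)

theorem exists_finset_forall_exists_prime_of_isIntegral {B A σ : Type*} (K L : Type*) [CommRing B] [IsDomain B]
    [CommRing A] [IsDomain A] [CharZero A] [IsIntegrallyClosed A]
    [Algebra B A] [Algebra (MvPolynomial σ B) A] [IsScalarTower B (MvPolynomial σ B) A]
    [Algebra.IsIntegral (MvPolynomial σ B) A] [FaithfulSMul (MvPolynomial σ B) A]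
    [IsIntegrallyClosed (MvPolynomial σ B)] [Finite σ] [Field K] [Algebra (MvPolynomial σ B) K]
    [IsFractionRing (MvPolynomial σ B) K] [Field L] [Algebra A L] [IsFractionRing A L]
    [Algebra (MvPolynomial σ B) L] [IsScalarTower (MvPolynomial σ B) A L] [Algebra K L]
    [IsScalarTower (MvPolynomial σ B) K L] [FiniteDimensional K L] [CharZero K] :
    ∃ Θ : Finset A, (∀ θ ∈ Θ, IsIntegral B θ) ∧ ∃ F : B, F ≠ 0 ∧
      ∀ {k : Type*} [Field k] [IsAlgClosed k] (r s : A →+* k),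
        r.comp (algebraMap B A) = s.comp (algebraMap B A) →
        Function.Surjective (r.comp (algebraMap B A)) → r (algebraMap B A F) ≠ 0 →
        (∀ θ ∈ Θ, r θ = s θ) → ∃ P : Ideal A, P.IsPrime ∧ P ≤ RingHom.ker r ∧ P ≤ RingHom.ker s ∧
          ∀ b : B, r (algebraMap B A b) = 0 → algebraMap B A b ∈ P := by
  obtain ⟨u, G, hG0, hG⟩ := exists_primitive_and_smul_mem_adjoin (S := MvPolynomial σ B) (A := A) K L
  obtain ⟨p, hpm, hpu, e, he0, he⟩ := exists_irreducible_of_isIntegral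
    (FaithfulSMul.algebraMap_injective (MvPolynomial σ B) A) u (Algebra.IsIntegral.isIntegral u)
  obtain ⟨m, hm⟩ := (MvPolynomial.ne_zero_iff).1 hG0
  have : Algebra.IsIntegral B (integralClosure B A) := inferInstance
  obtain ⟨e', hne', a, ha⟩ := (Algebra.IsAlgebraic.isAlgebraic (R := B) e).exists_nonzero_dvd
    (mem_nonZeroDivisors_of_ne_zero he0)
  refine ⟨p.coeffs.biUnion fun q => q.coeffs.image Subtype.val, ?_, coeff m G * e',
    mul_ne_zero hm hne', ?_⟩
  · intro θ hθ
    obtain ⟨q, -, h⟩ := Finset.mem_biUnion.1 hθ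
    obtain ⟨c, -, rfl⟩ := Finset.mem_image.1 h
    exact c.2
  · intro k _ _ r s hrs hsurj hF hΘ
    have hφ : p.map (map (σ := σ) (r.comp (algebraMap (integralClosure B A) A))) =
        p.map (map (s.comp (algebraMap (integralClosure B A) A))) := by
      ext1 n
      rw [Polynomial.coeff_map, Polynomial.coeff_map]
      by_cases hn : p.coeff n = 0
      · rw [hn, map_zero, map_zero]
      refine map_eq_map_of_forall_mem_coeffs _ _ _ fun c hc => hΘ _ ?_
      exact Finset.mem_biUnion.2 ⟨_, Polynomial.coeff_mem_coeffs hn, Finset.mem_image_of_mem _ hc⟩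
    rw [map_mul, map_mul, mul_ne_zero_iff] at hF
    have hGr : map (r.comp (algebraMap B A)) G ≠ 0 := fun h => hF.1 (by
      have := congrArg (coeff m) h
      rwa [coeff_map, coeff_zero] at this)
    have hre : (r.comp (algebraMap (integralClosure B A) A)) e ≠ 0 := fun h => hF.2 (by
      have h1 := congrArg (r.comp (algebraMap (integralClosure B A) A)) ha
      rw [map_mul, h, zero_mul] at h1
      exact h1)
    have hirr := he _ hre
    obtain ⟨P, hP, hPr, hPB, hPx⟩ := exists_prime_of_point p hpm u hpu G r hsurj hirr hGr
    obtain ⟨Q, hQ, hQs, -, hQx⟩ := exists_prime_of_point p hpm u hpu G s (hrs ▸ hsurj) (hφ ▸ hirr)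
      (hrs ▸ hGr)
    have hPQ : P = Q := by
      ext x
      obtain ⟨h, hh⟩ := hG x
      rw [hPx x h hh, hQx x h hh, hφ, hrs]
    exact ⟨P, hP, hPr, hPQ ▸ hQs, hPB⟩

end MvPolynomial

theorem exists_smul_eq_algebraMap_of_mem_adjoin {B A K L : Type*} [CommRing B] [IsDomain B] [CommRing A]
    [Algebra B A] [Field K] [Algebra B K] [IsFractionRing B K] [Field L] [Algebra A L]
    [Algebra B L] [IsScalarTower B A L] [Algebra K L] [IsScalarTower B K L] (s : Set A) (x : L)
    (hx : x ∈ Algebra.adjoin K (algebraMap A L '' s)) : ∃ b : B, b ≠ 0 ∧ ∃ a : A, b • x = algebraMap A L a := by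
  induction hx using Algebra.adjoin_induction with
  | mem x hx =>
    obtain ⟨a, -, rfl⟩ := hx
    exact ⟨1, one_ne_zero, a, one_smul _ _⟩
  | algebraMap c =>
    obtain ⟨a, b, hb, rfl⟩ := IsFractionRing.div_surjective (A := B) c
    have hb0 : algebraMap B K b ≠ 0 := fun h => nonZeroDivisors.ne_zero hb (by
      rwa [map_eq_zero_iff _ (IsFractionRing.injective B K)] at h)
    refine ⟨b, nonZeroDivisors.ne_zero hb, algebraMap B A a, ?_⟩
    rw [Algebra.smul_def, IsScalarTower.algebraMap_apply B K L, ← map_mul,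
      mul_div_cancel₀ _ hb0, ← IsScalarTower.algebraMap_apply B A L,
      ← IsScalarTower.algebraMap_apply B K L]
  | add x y _ _ hx hy =>
    obtain ⟨b, hb, a, h⟩ := hx
    obtain ⟨b', hb', a', h'⟩ := hy
    refine ⟨b * b', mul_ne_zero hb hb', algebraMap B A b' * a + algebraMap B A b * a', ?_⟩
    rw [map_add, map_mul, map_mul, ← h, ← h', ← IsScalarTower.algebraMap_apply B A L,
      ← IsScalarTower.algebraMap_apply B A L, Algebra.smul_def, Algebra.smul_def, Algebra.smul_def,
      map_mul]
    ring
  | mul x y _ _ hx hy =>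
    obtain ⟨b, hb, a, h⟩ := hx
    obtain ⟨b', hb', a', h'⟩ := hy
    exact ⟨b * b', mul_ne_zero hb hb', a * a', by rw [map_mul, ← h, ← h', smul_mul_smul_comm]⟩

theorem exists_algebraicIndependent_forall_isIntegralElem {B A K L : Type*} [CommRing B] [IsDomain B] [CommRing A]
    [Algebra B A] [Algebra.FiniteType B A] [Field K] [Algebra B K] [IsFractionRing B K] [Field L]
    [Algebra A L]
    [Algebra B L] [IsScalarTower B A L] [Algebra K L] [IsScalarTower B K L] :
    ∃ (d : ℕ) (t : Fin d → A), AlgebraicIndependent K (fun i => algebraMap A L (t i)) ∧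
      ∀ x : A, (MvPolynomial.aeval (R := K) (fun i => algebraMap A L (t i))).toRingHom.IsIntegralElem
        (algebraMap A L x) := by
  obtain ⟨s, hs⟩ := (Algebra.FiniteType.out : (⊤ : Subalgebra B A).FG)
  let R := Algebra.adjoin K (algebraMap A L '' (s : Set A))
  have hft : Algebra.FiniteType K R := by
    rw [← Subalgebra.fg_iff_finiteType]
    exact Subalgebra.fg_def.2 ⟨_, s.finite_toSet.image _, rfl⟩
  have hAR : ∀ x : A, algebraMap A L x ∈ R := by
    intro x
    have hx : x ∈ Algebra.adjoin B (s : Set A) := hs ▸ Algebra.mem_top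
    induction hx using Algebra.adjoin_induction with
    | mem x hx => exact Algebra.subset_adjoin (Set.mem_image_of_mem _ hx)
    | algebraMap b =>
      rw [← IsScalarTower.algebraMap_apply B A L, IsScalarTower.algebraMap_apply B K L]
      exact R.algebraMap_mem _
    | add x y _ _ hx hy => rw [map_add]; exact R.add_mem hx hy
    | mul x y _ _ hx hy => rw [map_mul]; exact R.mul_mem hx hy
  obtain ⟨d, g, hginj, hgint⟩ := exists_integral_inj_algHom_of_fg K R
  have hscale := fun i => exists_smul_eq_algebraMap_of_mem_adjoin (B := B) (K := K) _ _ (g (MvPolynomial.X i)).2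
  choose b hb a ha using hscale
  have hb0 : ∀ i, algebraMap B K (b i) ≠ 0 := fun i h => hb i (by
      rwa [map_eq_zero_iff _ (IsFractionRing.injective B K)] at h)
  let ψ : MvPolynomial (Fin d) K →ₐ[K] MvPolynomial (Fin d) K :=
    MvPolynomial.aeval fun i => algebraMap B K (b i) • MvPolynomial.X i
  let ψ' : MvPolynomial (Fin d) K →ₐ[K] MvPolynomial (Fin d) K :=
    MvPolynomial.aeval fun i => (algebraMap B K (b i))⁻¹ • MvPolynomial.X i
  have hψ : ψ'.comp ψ = AlgHom.id K _ := by
    ext i : 1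
    simp only [ψ, ψ', AlgHom.comp_apply, MvPolynomial.aeval_X, map_smul, smul_smul,
      mul_inv_cancel₀ (hb0 i), one_smul, AlgHom.id_apply]
  have hψ2 : ψ.comp ψ' = AlgHom.id K _ := by
    ext i : 1
    simp only [ψ, ψ', AlgHom.comp_apply, MvPolynomial.aeval_X, map_smul, smul_smul,
      inv_mul_cancel₀ (hb0 i), one_smul, AlgHom.id_apply]
  have hgψ : MvPolynomial.aeval (R := K) (fun i => algebraMap A L (a i)) = (R.val.comp g).comp ψ := by
    ext i : 1
    simp only [ψ, AlgHom.comp_apply, MvPolynomial.aeval_X, map_smul, ← ha]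
    rw [IsScalarTower.algebraMap_smul]; rfl
  refine ⟨d, a, ?_, fun x => ?_⟩
  · rw [algebraicIndependent_iff_injective_aeval, hgψ]
    refine (Subtype.val_injective.comp hginj).comp (Function.LeftInverse.injective (g := ψ') fun q => ?_)
    exact congrArg (fun h : _ →ₐ[K] _ => h q) hψ
  · obtain ⟨q, hqm, hq⟩ := hgint ⟨_, hAR x⟩
    refine ⟨q.map ψ'.toRingHom, hqm.map _, ?_⟩
    rw [Polynomial.eval₂_map]
    have : ((MvPolynomial.aeval (R := K) (fun i => algebraMap A L (a i))).toRingHom.comp ψ'.toRingHom) =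
        R.val.toRingHom.comp g.toRingHom := by
      rw [hgψ]
      refine RingHom.ext fun q => ?_
      exact congrArg (fun h : _ →ₐ[K] _ => R.val (g (h q))) hψ2
    rw [this]
    have h3 := congrArg R.val.toRingHom hq
    rw [Polynomial.hom_eval₂, map_zero] at h3
    exact h3

theorem exists_prime_of_prime_subalgebra {S A : Type*} [CommRing S] [CommRing A] [Algebra S A]
    (A₀ : Subalgebra S A) (φ : A₀) (hφ : ∀ x : A, ∃ n : ℕ, (φ : A) ^ n * x ∈ A₀) (P₀ : Ideal A₀)
    [hP₀ : P₀.IsPrime] (hφP : φ ∉ P₀) :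
    ∃ P : Ideal A, P.IsPrime ∧ ∀ x, x ∈ P ↔ ∃ n : ℕ, ∃ y ∈ P₀, (φ : A) ^ n * x = (y : A) := by
  let P : Ideal A :=
    { carrier := {x | ∃ n : ℕ, ∃ y ∈ P₀, (φ : A) ^ n * x = (y : A)}
      zero_mem' := ⟨0, 0, P₀.zero_mem, by simp⟩
      add_mem' := by
        rintro a b ⟨n, y, hy, h⟩ ⟨m, z, hz, h'⟩
        refine ⟨n + m, φ ^ m * y + φ ^ n * z, P₀.add_mem (P₀.mul_mem_left _ hy) (P₀.mul_mem_left _ hz), ?_⟩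
        push_cast
        rw [← h, ← h']; ring
      smul_mem' := by
        rintro c x ⟨n, y, hy, h⟩
        obtain ⟨m, hm⟩ := hφ c
        refine ⟨m + n, ⟨_, hm⟩ * y, P₀.mul_mem_left _ hy, ?_⟩
        push_cast
        rw [← h, smul_eq_mul]; ring }
  have hP : ∀ x, x ∈ P ↔ ∃ n : ℕ, ∃ y ∈ P₀, (φ : A) ^ n * x = (y : A) := fun x => Iff.rfl
  have hpow : ∀ n, φ ^ n ∉ P₀ := fun n h => hφP (hP₀.mem_of_pow_mem n h)
  refine ⟨P, ⟨?_, ?_⟩, hP⟩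
  · rw [Ne, Ideal.eq_top_iff_one, hP]
    rintro ⟨n, y, hy, h⟩
    rw [mul_one] at h
    have : φ ^ n = y := Subtype.ext (by simpa using h)
    exact hpow n (this ▸ hy)
  · intro x y hxy
    obtain ⟨n, z, hz, h⟩ := (hP _).1 hxy
    obtain ⟨a, ha⟩ := hφ x
    obtain ⟨b, hb⟩ := hφ y
    have h1 : φ ^ n * (⟨_, ha⟩ * ⟨_, hb⟩ : A₀) = φ ^ (a + b) * z := Subtype.ext (by
      push_cast
      rw [← h]; ring)
    have h2 : φ ^ n * (⟨_, ha⟩ * ⟨_, hb⟩ : A₀) ∈ P₀ := h1 ▸ P₀.mul_mem_left _ hz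
    rcases hP₀.mem_or_mem ((hP₀.mem_or_mem h2).resolve_left (hpow n)) with h3 | h3
    · exact Or.inl ⟨a, _, h3, rfl⟩
    · exact Or.inr ⟨b, _, h3, rfl⟩

theorem exists_finset_forall_exists_prime {B A : Type*} [CommRing B] [IsDomain B]
    [UniqueFactorizationMonoid B] [CommRing A] [IsDomain A] [CharZero A] [IsIntegrallyClosed A]
    [Algebra B A] [FaithfulSMul B A] [Algebra.FiniteType B A] :
    ∃ Θ : Finset A, (∀ θ ∈ Θ, IsIntegral B θ) ∧ ∃ F : B, F ≠ 0 ∧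
      ∀ {k : Type*} [Field k] [IsAlgClosed k] (r s : A →+* k),
        r.comp (algebraMap B A) = s.comp (algebraMap B A) →
        Function.Surjective (r.comp (algebraMap B A)) → r (algebraMap B A F) ≠ 0 →
        (∀ θ ∈ Θ, r θ = s θ) → ∃ P : Ideal A, P.IsPrime ∧ P ≤ RingHom.ker r ∧ P ≤ RingHom.ker s ∧
          ∀ b : B, r (algebraMap B A b) = 0 → algebraMap B A b ∈ P := by
  let K := FractionRing B
  let L := FractionRing A
  have hBA := FaithfulSMul.algebraMap_injective B A
  have hAL := IsFractionRing.injective A L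
  have hBL : Function.Injective (algebraMap B L) := by
    rw [IsScalarTower.algebraMap_eq B A L]; exact hAL.comp hBA
  have : FaithfulSMul B L := (faithfulSMul_iff_algebraMap_injective B L).2 hBL
  let _ : Algebra K L := FractionRing.liftAlgebra B L
  have : IsScalarTower B K L := FractionRing.isScalarTower_liftAlgebra B L
  obtain ⟨d, t, htK, htint⟩ := exists_algebraicIndependent_forall_isIntegralElem (B := B) (A := A)
    (K := K) (L := L)
  let S := MvPolynomial (Fin d) B
  have htB : AlgebraicIndependent B t := by
    have h1 : AlgebraicIndependent B (fun i => algebraMap A L (t i)) :=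
      htK.restrictScalars (IsFractionRing.injective B K)
    exact AlgebraicIndependent.of_comp (IsScalarTower.toAlgHom B A L) h1
  let _ : Algebra S A := (MvPolynomial.aeval (R := B) t).toRingHom.toAlgebra
  have hSBA : IsScalarTower B S A := IsScalarTower.of_algebraMap_eq fun b =>
    (MvPolynomial.aeval_C t b).symm
  have hSA : Function.Injective (algebraMap S A) := htB
  have : FaithfulSMul S A := (faithfulSMul_iff_algebraMap_injective S A).2 hSA
  have hSdef : ∀ b, algebraMap S A (MvPolynomial.C b) = algebraMap B A b :=
    fun b => MvPolynomial.aeval_C t b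
  have hmul : ∀ x : A, ∃ f : B, f ≠ 0 ∧ IsIntegral S (algebraMap B A f * x) := by
    intro x
    let SK := MvPolynomial (Fin d) K
    let _ : Algebra SK L :=
      (MvPolynomial.aeval (R := K) (fun i => algebraMap A L (t i))).toRingHom.toAlgebra
    let _ : Algebra S SK := MvPolynomial.algebraMvPolynomial
    have hloc : IsLocalization ((nonZeroDivisors B).map (MvPolynomial.C : B →+* S)) SK :=
      MvPolynomial.isLocalization (nonZeroDivisors B) K
    have : IsScalarTower S A L := inferInstance
    have : IsScalarTower S SK L := by
      refine IsScalarTower.of_algebraMap_eq' ?_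
      refine MvPolynomial.ringHom_ext (fun b => ?_) (fun i => ?_)
      · change algebraMap A L (algebraMap S A (MvPolynomial.C b)) = MvPolynomial.aeval _
          (MvPolynomial.map (algebraMap B K) (MvPolynomial.C b))
        rw [hSdef, MvPolynomial.map_C, MvPolynomial.aeval_C, ← IsScalarTower.algebraMap_apply B K L,
          ← IsScalarTower.algebraMap_apply B A L]
      · change algebraMap A L (MvPolynomial.aeval t (MvPolynomial.X i)) = MvPolynomial.aeval _
          (MvPolynomial.map (algebraMap B K) (MvPolynomial.X i))
        rw [MvPolynomial.map_X, MvPolynomial.aeval_X, MvPolynomial.aeval_X]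
    have hx : IsIntegral SK (algebraMap A L x) := htint x
    obtain ⟨⟨m, f, hf, rfl⟩, hm⟩ := hx.exists_multiple_integral_of_isLocalization
      ((nonZeroDivisors B).map (MvPolynomial.C : B →+* S)) _
    refine ⟨f, nonZeroDivisors.ne_zero hf, ?_⟩
    have h2 : IsIntegral S (algebraMap A L (algebraMap B A f * x)) := by
      rw [map_mul, ← hSdef, ← IsScalarTower.algebraMap_apply S A L, ← Algebra.smul_def]
      exact hm
    exact (isIntegral_algebraMap_iff hAL).1 h2
  obtain ⟨gens, hgens⟩ := (Algebra.FiniteType.out : (⊤ : Subalgebra B A).FG)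
  choose m hm0 hm using hmul
  let f := ∏ x ∈ gens, m x
  have hf0 : f ≠ 0 := Finset.prod_ne_zero_iff.2 fun x _ => hm0 x
  have hBint : ∀ b, IsIntegral S (algebraMap B A b) := fun b => by
    rw [← hSdef]; exact isIntegral_algebraMap
  have hpow : ∀ x : A, ∃ n : ℕ, (algebraMap B A f) ^ n * x ∈ integralClosure S A := by
    intro x
    have hx : x ∈ Algebra.adjoin B (gens : Set A) := hgens ▸ Algebra.mem_top
    induction hx using Algebra.adjoin_induction with
    | mem x hx =>
      refine ⟨1, ?_⟩
      have : f = (∏ y ∈ gens.erase x, m y) * m x := (Finset.prod_erase_mul _ _ hx).symm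
      rw [pow_one, this, map_mul, mul_assoc]
      exact (hBint _).mul (hm x)
    | algebraMap b => exact ⟨0, by rw [pow_zero, one_mul]; exact hBint b⟩
    | add x y _ _ hx hy =>
      obtain ⟨a, ha⟩ := hx
      obtain ⟨b, hb⟩ := hy
      refine ⟨a + b, ?_⟩
      have : algebraMap B A f ^ (a + b) * (x + y) = algebraMap B A f ^ b * (algebraMap B A f ^ a * x) +
        algebraMap B A f ^ a * (algebraMap B A f ^ b * y) := by ring
      rw [this]
      exact (((hBint f).pow b).mul ha).add (((hBint f).pow a).mul hb)
    | mul x y _ _ hx hy =>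
      obtain ⟨a, ha⟩ := hx
      obtain ⟨b, hb⟩ := hy
      refine ⟨a + b, ?_⟩
      have : algebraMap B A f ^ (a + b) * (x * y) = (algebraMap B A f ^ a * x) *
        (algebraMap B A f ^ b * y) := by ring
      rw [this]
      exact IsIntegral.mul ha hb
  have : IsIntegrallyClosed S := inferInstance
  let A0 := integralClosure S A
  have hA0closed : IsIntegrallyClosed A0 :=
    IsIntegrallyClosed.of_isIntegrallyClosed_of_isIntegrallyClosedIn A0 A
  have hA0A : ∀ b : B, ((algebraMap B A0 b : A0) : A) = algebraMap B A b := fun b => rfl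
  have hf0A : algebraMap B A f ≠ 0 := fun h => hf0 (hBA (by rw [h, map_zero]))
  have hf0L : algebraMap A L (algebraMap B A f) ≠ 0 := fun h => hf0A (hAL (by rw [h, map_zero]))
  have : FaithfulSMul A0 L := (faithfulSMul_iff_algebraMap_injective A0 L).2
    (hAL.comp Subtype.val_injective)
  have hfrac : IsFractionRing A0 L := by
    refine IsFractionRing.of_field A0 L fun z => ?_
    obtain ⟨a, b, hb, rfl⟩ := IsFractionRing.div_surjective (A := A) z
    obtain ⟨n, hn⟩ := hpow a
    obtain ⟨m, hm⟩ := hpow b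
    refine ⟨algebraMap B A0 f ^ m * ⟨_, hn⟩, algebraMap B A0 f ^ n * ⟨_, hm⟩, ?_⟩
    have h1 : algebraMap A0 L (algebraMap B A0 f ^ m * ⟨_, hn⟩) =
      algebraMap A L (algebraMap B A f ^ m * (algebraMap B A f ^ n * a)) := rfl
    have h2 : algebraMap A0 L (algebraMap B A0 f ^ n * ⟨_, hm⟩) =
      algebraMap A L (algebraMap B A f ^ n * (algebraMap B A f ^ m * b)) := rfl
    have hb0 : algebraMap A L b ≠ 0 := fun h => nonZeroDivisors.ne_zero hb (hAL (by rw [h, map_zero]))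
    rw [h1, h2]
    simp only [map_mul, map_pow]
    rw [div_eq_div_iff hb0 (mul_ne_zero (pow_ne_zero _ hf0L) (mul_ne_zero (pow_ne_zero _ hf0L) hb0))]
    ring
  have : FaithfulSMul S L := (faithfulSMul_iff_algebraMap_injective S L).2 (by
    rw [IsScalarTower.algebraMap_eq S A L]; exact hAL.comp hSA)
  let _ : Algebra (FractionRing S) L := FractionRing.liftAlgebra S L
  have : IsScalarTower S (FractionRing S) L := FractionRing.isScalarTower_liftAlgebra S L
  have hfin : FiniteDimensional (FractionRing S) L := by
    have : Algebra.FiniteType S A := Algebra.FiniteType.of_restrictScalars_finiteType B S A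
    have : Algebra.EssFiniteType S L := Algebra.EssFiniteType.comp S A L
    have : Algebra.EssFiniteType (FractionRing S) L := Algebra.EssFiniteType.of_comp S _ L
    have : Algebra.IsIntegral S A0 := inferInstance
    have : Algebra.IsAlgebraic S A0 := inferInstance
    have : Algebra.IsAlgebraic (FractionRing S) L := IsFractionRing.comap_isAlgebraic_iff (A := S) (K := FractionRing S) |>.1 (IsFractionRing.isAlgebraic_iff' S A0 L |>.1 inferInstance)
    exact Algebra.finite_of_essFiniteType_of_isAlgebraic
  have : CharZero B := ⟨fun a b h => by
    have := congrArg (algebraMap B A) h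
    rwa [map_natCast, map_natCast, Nat.cast_inj] at this⟩
  have : CharZero S := ⟨fun a b h => by
    have := congrArg (algebraMap S A) h
    rwa [map_natCast, map_natCast, Nat.cast_inj] at this⟩
  have : CharZero (FractionRing S) := inferInstance
  have : CharZero A0 := ⟨fun a b h => by
    have := congrArg (algebraMap A0 A) h
    rwa [map_natCast, map_natCast, Nat.cast_inj] at this⟩
  obtain ⟨Θ, hΘ, F, hF, h⟩ := MvPolynomial.exists_finset_forall_exists_prime_of_isIntegral
    (B := B) (A := A0) (σ := Fin d) (FractionRing S) L
  refine ⟨Θ.image Subtype.val, ?_, F * f, mul_ne_zero hF hf0, ?_⟩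
  · intro θ hθ
    obtain ⟨y, hy, rfl⟩ := Finset.mem_image.1 hθ
    exact (hΘ y hy).map (IsScalarTower.toAlgHom B A0 A)
  · intro k _ _ r s hrs hsurj hF hΘrs
    rw [map_mul, map_mul] at hF
    obtain ⟨P₀, hP₀, hr, hs, hP₀b⟩ := h (r.comp (algebraMap A0 A)) (s.comp (algebraMap A0 A))
      (by
        ext b
        exact RingHom.congr_fun hrs b) hsurj (left_ne_zero_of_mul hF)
      (fun θ hθ => hΘrs _ (Finset.mem_image_of_mem _ hθ))
    have hrf : r (algebraMap B A f) ≠ 0 := right_ne_zero_of_mul hF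
    have hsf : s (algebraMap B A f) ≠ 0 := by
      have := RingHom.congr_fun hrs f
      rw [RingHom.comp_apply, RingHom.comp_apply] at this
      rwa [← this]
    have hker : ∀ q : A →+* k, q (algebraMap B A f) ≠ 0 → P₀ ≤ RingHom.ker (q.comp (algebraMap A0 A)) →
        ∀ (n : ℕ) (x : A), ∀ y ∈ P₀, algebraMap B A f ^ n * x = (y : A) → x ∈ RingHom.ker q := by
      intro q hq hle n x y hy hxy
      have h0 : q (y : A) = 0 := hle hy
      rw [← hxy, map_mul, map_pow] at h0
      exact (mul_eq_zero.1 h0).resolve_left (pow_ne_zero _ hq)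
    obtain ⟨P, hP, hPmem⟩ := exists_prime_of_prime_subalgebra A0 (algebraMap B A0 f) hpow P₀
      (fun hmem => hrf (hr hmem))
    refine ⟨P, hP, fun x hx => ?_, fun x hx => ?_, fun b hb => ?_⟩
    · obtain ⟨n, y, hy, hxy⟩ := (hPmem x).1 hx
      exact hker r hrf hr n x y hy hxy
    · obtain ⟨n, y, hy, hxy⟩ := (hPmem x).1 hx
      exact hker s hsf hs n x y hy hxy
    · exact (hPmem _).2 ⟨0, algebraMap B A0 b, hP₀b b hb, by rw [pow_zero, one_mul]; rfl⟩

noncomputable section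

section
variable {k A Ω ι : Type*} [Field k] [CommRing A] [Field Ω] [Algebra k A]
  [Algebra A Ω] [FaithfulSMul A Ω] [Algebra k Ω] [IsScalarTower k A Ω]
  [Algebra (MvPolynomial ι k) A] [IsScalarTower k (MvPolynomial ι k) A]
  [FaithfulSMul (MvPolynomial ι k) A]

theorem algebraMap_mem_acl_iff {g : ι → Ω}
    (hg : ∀ i, algebraMap A Ω (algebraMap (MvPolynomial ι k) A (MvPolynomial.X i)) = g i) (x : A) :
    algebraMap A Ω x ∈ acl k (Set.range g) ↔ IsAlgebraic (MvPolynomial ι k) x := by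
  let q : MvPolynomial ι k →ₐ[k] Ω := MvPolynomial.aeval g
  have hq : ∀ b, algebraMap A Ω (algebraMap _ A b) = q b := by
    intro b
    have : (IsScalarTower.toAlgHom k A Ω).comp (IsScalarTower.toAlgHom k (MvPolynomial ι k) A) = q := by
      refine MvPolynomial.algHom_ext fun i => ?_
      rw [MvPolynomial.aeval_X]
      exact hg i
    exact DFunLike.congr_fun this b
  have hr : Algebra.adjoin k (Set.range g) = q.range := Algebra.adjoin_range_eq_range_aeval k g
  have hmem : ∀ b, q b ∈ Algebra.adjoin k (Set.range g) := fun b => hr ▸ ⟨b, rfl⟩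
  let f : MvPolynomial ι k →+* Algebra.adjoin k (Set.range g) := q.toRingHom.codRestrict _ hmem
  have hf : Function.Surjective f := by
    rintro ⟨y, hy⟩
    rw [hr] at hy
    obtain ⟨b, hb⟩ := hy
    exact ⟨b, Subtype.ext hb⟩
  rw [mem_acl]
  constructor
  · intro h
    exact h.of_ringHom_of_comp_eq f (algebraMap A Ω) hf (FaithfulSMul.algebraMap_injective A Ω)
      (RingHom.ext fun b => (hq b).symm)
  · intro h
    refine h.ringHom_of_comp_eq f (algebraMap A Ω) (fun a b hab => ?_)
      (RingHom.ext fun b => (hq b).symm)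
    have h1 : q a = q b := congrArg Subtype.val hab
    rw [← hq, ← hq] at h1
    exact FaithfulSMul.algebraMap_injective _ A (FaithfulSMul.algebraMap_injective A Ω h1)

end

section
variable {k A ι : Type*} [Field k] [CommRing A] [Algebra k A]
  [Algebra (MvPolynomial ι k) A] [IsScalarTower k (MvPolynomial ι k) A]

theorem exists_forall_prime_sub_mem [IsAlgClosed k] {x : A} (hx : IsAlgebraic (MvPolynomial ι k) x) :
    ∃ F : MvPolynomial ι k, F ≠ 0 ∧ ∀ lam : ι → k, MvPolynomial.eval lam F ≠ 0 → ∀ P : Ideal A,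
      P.IsPrime → (∀ b, MvPolynomial.eval lam b = 0 → algebraMap (MvPolynomial ι k) A b ∈ P) →
      ∃ c : k, x - algebraMap k A c ∈ P := by
  obtain ⟨f, hf, hfx⟩ := hx
  refine ⟨f.leadingCoeff, Polynomial.leadingCoeff_ne_zero.2 hf, fun lam hlam P hP h => ?_⟩
  let q := Ideal.Quotient.mk P
  have hq : ∀ b, q (algebraMap _ A b) = algebraMap k (A ⧸ P) (MvPolynomial.eval lam b) := by
    intro b
    have h1 := h (b - MvPolynomial.C (MvPolynomial.eval lam b)) (by simp)
    rw [map_sub] at h1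
    have h2 := (Ideal.Quotient.eq).2 h1
    refine h2.trans ?_
    rw [← MvPolynomial.algebraMap_eq, ← IsScalarTower.algebraMap_apply]
    rfl
  have h_int : IsAlgebraic k (q x) := by
    refine ⟨f.map (MvPolynomial.eval lam), fun h0 => hlam ?_, ?_⟩
    · have := congrArg (fun p => p.coeff f.natDegree) h0
      simpa [Polynomial.coeff_map] using this
    · rw [Polynomial.aeval_def, Polynomial.eval₂_map]
      have h3 : (algebraMap k (A ⧸ P)).comp (MvPolynomial.eval lam) = q.comp (algebraMap _ A) :=
        RingHom.ext fun b => (hq b).symm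
      rw [h3, ← Polynomial.hom_eval₂, ← Polynomial.aeval_def, hfx, map_zero]
  obtain ⟨c, hc⟩ := minpoly.mem_range_of_degree_eq_one k (q x)
    (IsAlgClosed.degree_eq_one_of_irreducible k (minpoly.irreducible h_int.isIntegral))
  exact ⟨c, (Ideal.Quotient.eq).1 hc.symm⟩

end

section
variable {k Ω β : Type*} [Field k] [CharZero k] [Field Ω] [Algebra k Ω]

/-- The product attached to a rigid triple is algebraic over the squared lengths. -/
theorem mul_sub_mem_acl {z w : β → Ω} {S : Set Ω} {a b c : β}
    (h1 : sqDist z w s(a, b) ∈ acl k S) (h2 : sqDist z w s(c, b) ∈ acl k S)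
    (h3 : sqDist z w s(a, c) ∈ acl k S) : (z a - z b) * (w c - w b) ∈ acl k S := by
  let x1 : acl k S := ⟨_, h1⟩
  let x2 : acl k S := ⟨_, h2⟩
  let x3 : acl k S := ⟨_, h3⟩
  have : IsAlgebraic (acl k S) ((z a - z b) * (w c - w b)) := by
    refine ⟨.X ^ 2 - .C (x1 + x2 - x3) * .X + .C (x1 * x2), ?_, ?_⟩
    · intro h0
      have := congrArg (fun p => Polynomial.coeff p 2) h0
      simp at this
    · have e1 : algebraMap (acl k S) Ω x1 = _ := sqDist_mk z w a b
      have e2 : algebraMap (acl k S) Ω x2 = _ := sqDist_mk z w c b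
      have e3 : algebraMap (acl k S) Ω x3 = _ := sqDist_mk z w a c
      simp only [map_add, map_sub, map_mul, map_pow, Polynomial.aeval_X, Polynomial.aeval_C, e1, e2, e3]
      ring
  obtain ⟨c, hc⟩ := exists_algebraMap_acl_eq this
  exact hc ▸ c.2

end

section
variable {k A Ω β ι : Type*} [Field k] [CommRing A] [Field Ω] [Algebra k A]
  [Algebra A Ω] [FaithfulSMul A Ω] [Algebra k Ω] [IsScalarTower k A Ω]
  [Algebra (MvPolynomial ι k) A] [IsScalarTower k (MvPolynomial ι k) A]
  [FaithfulSMul (MvPolynomial ι k) A] [IsAlgClosed k] [CharZero k]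
variable [DecidableEq β] {z w : β → A} {E : Finset (Sym2 β)} {ε : ι → Sym2 β}

open Laman

theorem exists_forall_prime_mul_sub_eq [Fintype β]
    (hP : GenericPlacement k (fun v => algebraMap A Ω (z v)) (fun v => algebraMap A Ω (w v)))
    (hE : Sparse E) (hε : Set.range ε = E)
    (hg : ∀ i, algebraMap A Ω (algebraMap (MvPolynomial ι k) A (MvPolynomial.X i)) =
      sqDist (fun v => algebraMap A Ω (z v)) (fun v => algebraMap A Ω (w v)) (ε i)) :
    ∃ F : MvPolynomial ι k, F ≠ 0 ∧ ∀ lam : ι → k, MvPolynomial.eval lam F ≠ 0 → ∀ P : Ideal A,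
      P.IsPrime → (∀ b, MvPolynomial.eval lam b = 0 → algebraMap (MvPolynomial ι k) A b ∈ P) →
      ∀ r s : A →ₐ[k] k, P ≤ RingHom.ker r → P ≤ RingHom.ker s → ∀ S, TightOn E S →
      ∀ a ∈ S, ∀ b ∈ S, ∀ c ∈ S, r ((z a - z b) * (w c - w b)) = s ((z a - z b) * (w c - w b)) := by
  have hrange : Set.range (fun i => sqDist (fun v => algebraMap A Ω (z v))
      (fun v => algebraMap A Ω (w v)) (ε i)) = sqDist (fun v => algebraMap A Ω (z v))
      (fun v => algebraMap A Ω (w v)) '' E := by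
    rw [← hε, ← Set.range_comp]; rfl
  have key : ∀ t : β × β × β, ∃ F : MvPolynomial ι k, F ≠ 0 ∧ ((∃ S, TightOn E S ∧ t.1 ∈ S ∧ t.2.1 ∈ S ∧
      t.2.2 ∈ S) → ∀ lam : ι → k, MvPolynomial.eval lam F ≠ 0 → ∀ P : Ideal A,
      P.IsPrime → (∀ b, MvPolynomial.eval lam b = 0 → algebraMap (MvPolynomial ι k) A b ∈ P) →
      ∃ c : k, (z t.1 - z t.2.1) * (w t.2.2 - w t.2.1) - algebraMap k A c ∈ P) := by
    rintro ⟨a, b, c⟩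
    by_cases h : ∃ S, TightOn E S ∧ a ∈ S ∧ b ∈ S ∧ c ∈ S
    · obtain ⟨S, hS, ha, hb, hc⟩ := h
      have h1 := mul_sub_mem_acl (hS.sqDist_mem_acl hP hE ha hb) (hS.sqDist_mem_acl hP hE hc hb)
        (hS.sqDist_mem_acl hP hE ha hc)
      rw [← map_sub, ← map_sub, ← map_mul, ← hrange, algebraMap_mem_acl_iff hg] at h1
      obtain ⟨F, hF, h2⟩ := exists_forall_prime_sub_mem h1
      exact ⟨F, hF, fun _ => h2⟩
    · exact ⟨1, one_ne_zero, fun h' => absurd h' h⟩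
  choose F hF0 hF using key
  refine ⟨∏ t, F t, Finset.prod_ne_zero_iff.2 fun t _ => hF0 t, ?_⟩
  intro lam hlam P hP hPb r s hr hs S hS a ha b hb c hc
  rw [map_prod, Finset.prod_ne_zero_iff] at hlam
  obtain ⟨d, hd⟩ := hF (a, b, c) ⟨S, hS, ha, hb, hc⟩ lam (hlam _ (Finset.mem_univ _)) P hP hPb
  have h1 : r _ = 0 := hr hd
  have h2 : s _ = 0 := hs hd
  rw [map_sub, sub_eq_zero, AlgHom.commutes] at h1 h2
  exact h1.trans h2.symm

end
end

noncomputable section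

section
variable {k A Ω β ι : Type*} [Field k] [CommRing A] [Field Ω] [Algebra k A]
  [Algebra A Ω] [Algebra k Ω] [IsAlgClosed k] [CharZero k]
variable [DecidableEq β] {z w : β → A} {E : Finset (Sym2 β)} {ε : ι → Sym2 β}

open Laman

/-- Rigid products take equal values at two placements agreeing on them in every tight set. -/
theorem Laman.map_mul_sub_eq_of_mem_acl
    (hP : GenericPlacement k (fun v => algebraMap A Ω (z v)) (fun v => algebraMap A Ω (w v)))
    (hE : Sparse E) {r s : A →ₐ[k] k}
    (h : ∀ S, TightOn E S → ∀ a ∈ S, ∀ b ∈ S, ∀ c ∈ S,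
      r ((z a - z b) * (w c - w b)) = s ((z a - z b) * (w c - w b))) {a b c : β}
    (h1 : sqDist (fun v => algebraMap A Ω (z v)) (fun v => algebraMap A Ω (w v)) s(a, b) ∈
      acl k (sqDist (fun v => algebraMap A Ω (z v)) (fun v => algebraMap A Ω (w v)) '' E))
    (h2 : sqDist (fun v => algebraMap A Ω (z v)) (fun v => algebraMap A Ω (w v)) s(c, b) ∈
      acl k (sqDist (fun v => algebraMap A Ω (z v)) (fun v => algebraMap A Ω (w v)) '' E))
    (h3 : sqDist (fun v => algebraMap A Ω (z v)) (fun v => algebraMap A Ω (w v)) s(a, c) ∈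
      acl k (sqDist (fun v => algebraMap A Ω (z v)) (fun v => algebraMap A Ω (w v)) '' E)) :
    r ((z a - z b) * (w c - w b)) = s ((z a - z b) * (w c - w b)) := by
  by_cases hab : a = b
  · simp [hab]
  by_cases hcb : c = b
  · simp [hcb]
  obtain ⟨S, hS, ha, hb⟩ := exists_tightOn hP hE hab h1
  by_cases hac : a = c
  · exact h S hS a ha b hb c (hac ▸ ha)
  obtain ⟨T, hT, hc, hb'⟩ := exists_tightOn hP hE hcb h2
  obtain ⟨R, hR, ha', hc'⟩ := exists_tightOn hP hE hac h3
  obtain ⟨W, hW, h4, h5, h6⟩ := TightOn.exists_of_triangle hE hS hR hT (Ne.symm hcb) ha hb ha' hc' hb' hc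
  exact h W hW a h4 b h5 c h6

theorem exists_forall_exists_prime_of_mul_sub_eq [IsDomain A] [FaithfulSMul A Ω]
    [IsScalarTower k A Ω]
    [Algebra (MvPolynomial ι k) A] [IsScalarTower k (MvPolynomial ι k) A]
    [FaithfulSMul (MvPolynomial ι k) A] [CharZero A] [IsIntegrallyClosed A]
    [Algebra.FiniteType k A]
    (hP : GenericPlacement k (fun v => algebraMap A Ω (z v)) (fun v => algebraMap A Ω (w v)))
    (hE : Sparse E) (hε : Set.range ε = E)
    (hg : ∀ i, algebraMap A Ω (algebraMap (MvPolynomial ι k) A (MvPolynomial.X i)) =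
      sqDist (fun v => algebraMap A Ω (z v)) (fun v => algebraMap A Ω (w v)) (ε i)) :
    ∃ F : MvPolynomial ι k, F ≠ 0 ∧ ∀ lam : ι → k, MvPolynomial.eval lam F ≠ 0 →
      ∀ r s : A →ₐ[k] k, (∀ i, r (algebraMap (MvPolynomial ι k) A (MvPolynomial.X i)) = lam i) →
      (∀ i, s (algebraMap (MvPolynomial ι k) A (MvPolynomial.X i)) = lam i) →
      (∀ S, TightOn E S → ∀ a ∈ S, ∀ b ∈ S, ∀ c ∈ S,
        r ((z a - z b) * (w c - w b)) = s ((z a - z b) * (w c - w b))) →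
      ∃ P : Ideal A, P.IsPrime ∧ P ≤ RingHom.ker r ∧ P ≤ RingHom.ker s ∧
        ∀ b, MvPolynomial.eval lam b = 0 → algebraMap (MvPolynomial ι k) A b ∈ P := by
  let Z : β → Ω := fun v => algebraMap A Ω (z v)
  let W : β → Ω := fun v => algebraMap A Ω (w v)
  have hrange : Set.range (fun i => sqDist Z W (ε i)) = sqDist Z W '' E := by
    rw [← hε, ← Set.range_comp]; rfl
  have hAΩ := FaithfulSMul.algebraMap_injective A Ω
  have : Algebra.FiniteType (MvPolynomial ι k) A :=
    Algebra.FiniteType.of_restrictScalars_finiteType k _ A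
  obtain ⟨Θ, hΘ, F, hF, hmain⟩ := exists_finset_forall_exists_prime (B := MvPolynomial ι k) (A := A)
  let RP : Set A := {x | ∃ a b c, sqDist Z W s(a, b) ∈ acl k (sqDist Z W '' E) ∧
    sqDist Z W s(c, b) ∈ acl k (sqDist Z W '' E) ∧
    sqDist Z W s(a, c) ∈ acl k (sqDist Z W '' E) ∧ x = (z a - z b) * (w c - w b)}
  have hRP : rigidProducts k Z W E = IsScalarTower.toAlgHom k A Ω '' RP := by
    ext x
    constructor
    · rintro ⟨a, b, c, h1, h2, h3, rfl⟩
      exact ⟨_, ⟨a, b, c, h1, h2, h3, rfl⟩, by simp [Z, W]⟩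
    · rintro ⟨_, ⟨a, b, c, h1, h2, h3, rfl⟩, rfl⟩
      exact ⟨a, b, c, h1, h2, h3, by simp [Z, W]⟩
  have hrat : RationalInProducts k Z W E := (independent_and_rational hP hE).2
  have hquot : ∀ θ : A, ∃ b : MvPolynomial ι k, b ≠ 0 ∧ (θ ∈ Θ → ∃ N ∈ Algebra.adjoin k RP,
      ∃ D ∈ Algebra.adjoin k RP, θ * D = N ∧ D ∣ algebraMap _ A b) := by
    intro θ
    by_cases hθ : θ ∈ Θ
    · have h1 : algebraMap A Ω θ ∈ acl k (sqDist Z W '' E) := by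
        rw [← hrange, algebraMap_mem_acl_iff hg]
        exact (hΘ θ hθ).isAlgebraic
      obtain ⟨N, hN, D, hD, hND⟩ := IntermediateField.mem_adjoin_iff_div.1 (hrat h1)
      rw [hRP, Algebra.adjoin_image] at hN hD
      obtain ⟨N, hN, rfl⟩ := hN
      obtain ⟨D, hD, rfl⟩ := hD
      change _ = algebraMap A Ω N / algebraMap A Ω D at hND
      by_cases hD0 : D = 0
      · rw [hD0, map_zero, div_zero] at hND
        have : θ = 0 := hAΩ (by rw [hND, map_zero])
        exact ⟨1, one_ne_zero, fun _ => ⟨0, zero_mem _, 1, one_mem _, by simp [this], one_dvd _⟩⟩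
      · have hDalg : IsAlgebraic (MvPolynomial ι k) D := by
          rw [← algebraMap_mem_acl_iff hg, hrange]
          have h2 : Algebra.adjoin k (rigidProducts k Z W E) ≤
              (acl k (sqDist Z W '' E)).toSubalgebra := by
            refine Algebra.adjoin_le ?_
            rintro _ ⟨a, b, c, h1, h2, h3, rfl⟩
            exact mul_sub_mem_acl h1 h2 h3
          rw [hRP, Algebra.adjoin_image] at h2
          exact h2 ⟨D, hD, rfl⟩
        obtain ⟨b, hb, hdvd⟩ := hDalg.exists_nonzero_dvd (mem_nonZeroDivisors_of_ne_zero hD0)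
        refine ⟨b, hb, fun _ => ⟨N, hN, D, hD, hAΩ ?_, hdvd⟩⟩
        rw [map_mul, hND, div_mul_cancel₀]
        exact fun h => hD0 (hAΩ (by rw [h, map_zero]))
    · exact ⟨1, one_ne_zero, fun h => absurd h hθ⟩
  choose b hb0 hb using hquot
  refine ⟨F * ∏ θ ∈ Θ, b θ, mul_ne_zero hF (Finset.prod_ne_zero_iff.2 fun θ _ => hb0 θ), ?_⟩
  intro lam hlam r s hr hs hrs
  rw [map_mul, map_prod] at hlam
  have hcomp : ∀ q : A →ₐ[k] k, (∀ i, q (algebraMap (MvPolynomial ι k) A (MvPolynomial.X i)) = lam i) →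
      ∀ b, q (algebraMap _ A b) = MvPolynomial.eval lam b := by
    intro q hq b
    have : q.comp (IsScalarTower.toAlgHom k (MvPolynomial ι k) A) = MvPolynomial.aeval lam := by
      refine MvPolynomial.algHom_ext fun i => ?_
      rw [MvPolynomial.aeval_X]
      exact hq i
    rw [← MvPolynomial.coe_aeval_eq_eval]
    exact DFunLike.congr_fun this b
  have hadj : ∀ x ∈ Algebra.adjoin k RP, r x = s x := by
    intro x hx
    have : Algebra.adjoin k RP ≤ AlgHom.equalizer r s := by
      refine Algebra.adjoin_le ?_
      rintro _ ⟨a, b, c, h1, h2, h3, rfl⟩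
      exact map_mul_sub_eq_of_mem_acl hP hE hrs h1 h2 h3
    exact this hx
  obtain ⟨P, hPp, hPr, hPs, hPb⟩ := hmain r.toRingHom s.toRingHom
    (RingHom.ext fun b => (hcomp r hr b).trans (hcomp s hs b).symm)
    (fun c => ⟨MvPolynomial.C c, (hcomp r hr _).trans (MvPolynomial.eval_C c)⟩)
    (by
      change r _ ≠ 0
      rw [hcomp r hr]; exact left_ne_zero_of_mul hlam) (by
      intro θ hθ
      obtain ⟨N, hN, D, hD, hND, x, hx⟩ := hb θ hθ
      have h1 : r D ≠ 0 := fun h0 => by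
        have := hcomp r hr (b θ)
        rw [hx, map_mul, h0, zero_mul] at this
        exact Finset.prod_ne_zero_iff.1 (right_ne_zero_of_mul hlam) θ hθ this.symm
      refine mul_right_cancel₀ h1 ?_
      change r θ * r D = s θ * r D
      conv_rhs => rw [hadj D hD]
      rw [← map_mul, ← map_mul, hND, hadj N hN])
  exact ⟨P, hPp, hPr, hPs, fun b hb => hPb b ((hcomp r hr b).trans hb)⟩

end
end

noncomputable section

section
variable {β : Type*}

open MvPolynomial

/-- The isotropic coordinate `x + i y` of a vertex. -/
def isoZ (v : β) : MvPolynomial (β × Fin 2) ℂ := X (v, 0) + C Complex.I * X (v, 1)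

/-- The isotropic coordinate `x - i y` of a vertex. -/
def isoW (v : β) : MvPolynomial (β × Fin 2) ℂ := X (v, 0) - C Complex.I * X (v, 1)

theorem C_I_mul_C_I {σ : Type*} : (C Complex.I * C Complex.I : MvPolynomial σ ℂ) = -1 := by
  rw [← C_mul, Complex.I_mul_I, C_neg, C_1]

theorem C_two_inv {σ : Type*} : (C (2⁻¹ : ℂ) * 2 : MvPolynomial σ ℂ) = 1 := by
  have : (2 : MvPolynomial σ ℂ) = C 2 := (map_ofNat C 2).symm
  rw [this, ← C_mul, inv_mul_cancel₀ two_ne_zero, C_1]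

theorem algebraicIndependent_iso :
    AlgebraicIndependent ℂ (Sum.elim (isoZ : β → _) isoW) := by
  let g : MvPolynomial (β × Fin 2) ℂ →ₐ[ℂ] MvPolynomial (β ⊕ β) ℂ := aeval fun p =>
    if p.2 = 0 then C (2⁻¹) * (X (Sum.inl p.1) + X (Sum.inr p.1))
      else -(C Complex.I * C (2⁻¹) * (X (Sum.inl p.1) - X (Sum.inr p.1)))
  refine Function.LeftInverse.injective (g := g) fun p => ?_
  have : g.comp (aeval (Sum.elim (isoZ : β → _) isoW)) = AlgHom.id ℂ _ := by
    refine algHom_ext fun i => ?_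
    have hI := C_I_mul_C_I (σ := β ⊕ β)
    have h2 := C_two_inv (σ := β ⊕ β)
    have hC : g (C Complex.I) = C Complex.I := aeval_C _ _
    rcases i with v | v
    · simp only [AlgHom.comp_apply, aeval_X, Sum.elim_inl, isoZ, map_add, map_mul, hC, g, if_true, AlgHom.id_apply, one_ne_zero, if_false]
      linear_combination (X (Sum.inl v)) * h2 - C 2⁻¹ * (X (Sum.inl v) - X (Sum.inr v)) * hI
    · simp only [AlgHom.comp_apply, aeval_X, Sum.elim_inr, isoW, map_sub, map_mul, hC, g, if_true, AlgHom.id_apply, one_ne_zero, if_false]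
      linear_combination (X (Sum.inr v)) * h2 + C 2⁻¹ * (X (Sum.inl v) - X (Sum.inr v)) * hI
  exact DFunLike.congr_fun this p

theorem adjoin_iso : Algebra.adjoin ℂ (Set.range (Sum.elim (isoZ : β → _) isoW)) = ⊤ := by
  rw [eq_top_iff, ← adjoin_range_X]
  refine Algebra.adjoin_le ?_
  rintro _ ⟨⟨v, j⟩, rfl⟩
  have hI := C_I_mul_C_I (σ := β × Fin 2)
  have h2 := C_two_inv (σ := β × Fin 2)
  have hz : isoZ v ∈ Algebra.adjoin ℂ (Set.range (Sum.elim (isoZ : β → _) isoW)) :=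
    Algebra.subset_adjoin ⟨Sum.inl v, rfl⟩
  have hw : isoW v ∈ Algebra.adjoin ℂ (Set.range (Sum.elim (isoZ : β → _) isoW)) :=
    Algebra.subset_adjoin ⟨Sum.inr v, rfl⟩
  have hC : ∀ c, C c ∈ Algebra.adjoin ℂ (Set.range (Sum.elim (isoZ : β → _) isoW)) := fun c =>
    Subalgebra.algebraMap_mem _ c
  fin_cases j
  · have : (X (v, 0) : MvPolynomial (β × Fin 2) ℂ) = C 2⁻¹ * (isoZ v + isoW v) := by
      rw [isoZ, isoW]
      linear_combination -(X (v, 0)) * h2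
    exact this ▸ mul_mem (hC _) (add_mem hz hw)
  · have : (X (v, 1) : MvPolynomial (β × Fin 2) ℂ) = C (-Complex.I) * (C 2⁻¹ * (isoZ v - isoW v)) := by
      rw [isoZ, isoW, C_neg]
      linear_combination -(X (v, 1)) * h2 + X (v, 1) * C 2⁻¹ * 2 * hI
    exact this ▸ mul_mem (hC _) (mul_mem (hC _) (sub_mem hz hw))

theorem genericPlacement_iso :
    GenericPlacement ℂ (fun v : β => algebraMap _ (FractionRing (MvPolynomial (β × Fin 2) ℂ)) (isoZ v))
      (fun v => algebraMap _ (FractionRing (MvPolynomial (β × Fin 2) ℂ)) (isoW v)) := by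
  let Ω := FractionRing (MvPolynomial (β × Fin 2) ℂ)
  let j : MvPolynomial (β × Fin 2) ℂ →ₐ[ℂ] Ω := IsScalarTower.toAlgHom _ _ _
  have hj : Function.Injective j := IsFractionRing.injective _ _
  have he : Sum.elim (fun v : β => algebraMap _ Ω (isoZ v)) (fun v : β => algebraMap _ Ω (isoW v)) =
    j ∘ Sum.elim isoZ isoW := by
    funext i
    rcases i with i | i <;> rfl
  have hr : Algebra.adjoin ℂ (Set.range (Sum.elim (fun v : β => algebraMap _ Ω (isoZ v))
      (fun v : β => algebraMap _ Ω (isoW v)))) = j.range := by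
    rw [he, Set.range_comp, Algebra.adjoin_image, adjoin_iso, Algebra.map_top]
  refine ⟨?_, fun x hx => ?_⟩
  · rw [he]
    exact algebraicIndependent_iso.map' hj
  · rw [hr] at hx ⊢
    have h1 : IsIntegral (MvPolynomial (β × Fin 2) ℂ) x := by
      obtain ⟨p, hp, hpx⟩ := hx
      obtain ⟨q, hq, -, hqm⟩ := Polynomial.lifts_and_natDegree_eq_and_monic (f := j.rangeRestrict.toRingHom) (p := p)
        (Polynomial.mem_lifts _ |>.2 (Polynomial.map_surjective _ j.rangeRestrict_surjective p)) hp
      refine ⟨q, hqm, ?_⟩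
      rw [← hq, Polynomial.eval₂_map] at hpx
      exact hpx
    obtain ⟨y, hy⟩ := IsIntegrallyClosed.isIntegral_iff.1 h1
    exact ⟨y, hy⟩

theorem eval_coords_isoZ (r : β → ℂ × ℂ) (v : β) :
    aeval (coords r) (isoZ v) = (r v).1 + Complex.I * (r v).2 := by
  simp [isoZ, coords]

theorem eval_coords_isoW (r : β → ℂ × ℂ) (v : β) :
    aeval (coords r) (isoW v) = (r v).1 - Complex.I * (r v).2 := by
  simp [isoW, coords]

theorem IsTransf.mul_sub_eq {t : ℂ × ℂ → ℂ × ℂ} (ht : IsTransf t) {r s : β → ℂ × ℂ} {a b c : β}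
    (ha : t (r a) = s a) (hb : t (r b) = s b) (hc : t (r c) = s c) :
    aeval (coords r) ((isoZ a - isoZ b) * (isoW c - isoW b)) =
      aeval (coords s) ((isoZ a - isoZ b) * (isoW c - isoW b)) := by
  obtain ⟨p, q, u, v, hpq, ht⟩ := ht
  have hI : Complex.I * Complex.I = -1 := Complex.I_mul_I
  simp only [map_mul, map_sub, eval_coords_isoZ, eval_coords_isoW, ← ha, ← hb, ← hc, ht]
  generalize Complex.I = i at *
  have h1 : ∀ a b : ℂ × ℂ, (p * a.1 - q * a.2 + u + i * (q * a.1 + p * a.2 + v)) -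
    (p * b.1 - q * b.2 + u + i * (q * b.1 + p * b.2 + v)) =
    (p + i * q) * (a.1 + i * a.2 - (b.1 + i * b.2)) := by
    intro a b; linear_combination (-q * (a.2 - b.2)) * hI
  have h2 : ∀ a b : ℂ × ℂ, (p * a.1 - q * a.2 + u - i * (q * a.1 + p * a.2 + v)) -
    (p * b.1 - q * b.2 + u - i * (q * b.1 + p * b.2 + v)) =
    (p - i * q) * (a.1 - i * a.2 - (b.1 - i * b.2)) := by
    intro a b; linear_combination (-q * (a.2 - b.2)) * hI
  rw [h1, h2]
  have h3 : (p + i * q) * (p - i * q) = 1 := by linear_combination hpq - q ^ 2 * hI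
  linear_combination (-((r a).1 + i * (r a).2 - ((r b).1 + i * (r b).2)) *
    ((r c).1 - i * (r c).2 - ((r b).1 - i * (r b).2))) * h3

theorem exists_isTransf_of_mul_sub_eq {S : Set β} {r s : β → ℂ × ℂ}
    (h : ∀ a ∈ S, ∀ b ∈ S, ∀ c ∈ S, aeval (coords r) ((isoZ a - isoZ b) * (isoW c - isoW b)) =
      aeval (coords s) ((isoZ a - isoZ b) * (isoW c - isoW b))) {a b : β} (ha : a ∈ S) (hb : b ∈ S)
    (hab : aeval (coords r) ((isoZ a - isoZ b) * (isoW a - isoW b)) ≠ 0) :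
    ∃ t, IsTransf t ∧ ∀ v ∈ S, t (r v) = s v := by
  have hI : Complex.I * Complex.I = -1 := Complex.I_mul_I
  have hI0 : Complex.I ≠ 0 := Complex.I_ne_zero
  simp only [map_mul, map_sub, eval_coords_isoZ, eval_coords_isoW] at h hab
  generalize Complex.I = i at *
  obtain ⟨zr, hzr⟩ : ∃ f : β → ℂ, ∀ v, f v = (r v).1 + i * (r v).2 := ⟨_, fun _ => rfl⟩
  obtain ⟨wr, hwr⟩ : ∃ f : β → ℂ, ∀ v, f v = (r v).1 - i * (r v).2 := ⟨_, fun _ => rfl⟩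
  obtain ⟨zs, hzs⟩ : ∃ f : β → ℂ, ∀ v, f v = (s v).1 + i * (s v).2 := ⟨_, fun _ => rfl⟩
  obtain ⟨ws, hws⟩ : ∃ f : β → ℂ, ∀ v, f v = (s v).1 - i * (s v).2 := ⟨_, fun _ => rfl⟩
  simp only [← hzr, ← hzs, ← hwr, ← hws] at h hab
  have hab' := hab
  rw [h a ha b hb a ha] at hab'
  have hz := left_ne_zero_of_mul hab
  have hw := right_ne_zero_of_mul hab
  have hz' := left_ne_zero_of_mul hab'
  have hw' := right_ne_zero_of_mul hab'
  obtain ⟨u, hu⟩ : ∃ u, u = (zs a - zs b) / (zr a - zr b) := ⟨_, rfl⟩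
  obtain ⟨u', hu'⟩ : ∃ u', u' = (ws a - ws b) / (wr a - wr b) := ⟨_, rfl⟩
  have huu : u * u' = 1 := by
    rw [hu, hu', div_mul_div_comm, h a ha b hb a ha, div_self hab']
  have hZ : ∀ v ∈ S, zs v = zs b + u * (zr v - zr b) := by
    intro v hv
    have h1 : u * (zr a - zr b) = zs a - zs b := by rw [hu, div_mul_cancel₀ _ hz]
    have h2 := h v hv b hb a ha
    have h3 := h a ha b hb a ha
    have h4 : (zs a - zs b) * ((ws a - ws b) * (zs v - zs b - u * (zr v - zr b))) = 0 := by
      linear_combination (-(zs a - zs b)) * h2 + u * (zr v - zr b) * h3 + (wr a - wr b) * (zr v - zr b) * (-h1)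
    have h5 := (mul_eq_zero.1 ((mul_eq_zero.1 h4).resolve_left hz')).resolve_left hw'
    linear_combination h5
  have hW : ∀ v ∈ S, ws v = ws b + u' * (wr v - wr b) := by
    intro v hv
    have h1 : u' * (wr a - wr b) = ws a - ws b := by rw [hu', div_mul_cancel₀ _ hw]
    have h2 := h a ha b hb v hv
    have h3 := h a ha b hb a ha
    have h4 : (ws a - ws b) * ((zs a - zs b) * (ws v - ws b - u' * (wr v - wr b))) = 0 := by
      linear_combination (-(ws a - ws b)) * h2 + u' * (wr v - wr b) * h3 + (zr a - zr b) * (wr v - wr b) * (-h1)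
    have h5 := (mul_eq_zero.1 ((mul_eq_zero.1 h4).resolve_left hw')).resolve_left hz'
    linear_combination h5
  refine ⟨fun x => ((u + u') / 2 * x.1 - (-i * (u - u') / 2) * x.2 +
    ((s b).1 - ((u + u') / 2 * (r b).1 - (-i * (u - u') / 2) * (r b).2)),
    (-i * (u - u') / 2) * x.1 + (u + u') / 2 * x.2 +
    ((s b).2 - ((-i * (u - u') / 2) * (r b).1 + (u + u') / 2 * (r b).2))),
    ⟨_, _, _, _, ?_, fun x => rfl⟩, fun v hv => ?_⟩
  · linear_combination huu + (u - u') ^ 2 / 4 * hI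
  · have h1 := hZ v hv
    have h2 := hW v hv
    rw [hzs, hzs, hzr, hzr] at h1
    rw [hws, hws, hwr, hwr] at h2
    ext
    · dsimp only
      linear_combination (-1 / 2) * h1 - (1 / 2) * h2
    · dsimp only
      refine mul_left_cancel₀ hI0 ?_
      linear_combination (-1 / 2) * h1 + (1 / 2) * h2 - (u - u') / 2 * ((r v).1 - (r b).1) * hI

end
end

noncomputable section

section
variable {α : Type*} {V : Finset α} {E : Finset (Sym2 α)}

/-- The edges of a graph as unordered pairs of elements of the vertex set. -/
def IsGraph.lift (hE : IsGraph V E) (e : {e // e ∈ E}) : Sym2 ↥V :=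
  e.1.attachWith (hE e.1 e.2).2

theorem IsGraph.map_lift (hE : IsGraph V E) (e : {e // e ∈ E}) :
    (hE.lift e).map Subtype.val = e.1 := Sym2.attachWith_map_subtypeVal _

theorem IsGraph.lift_injective (hE : IsGraph V E) : Function.Injective hE.lift := fun e f h =>
  Subtype.ext (by rw [← hE.map_lift e, h, hE.map_lift])

end

section
variable {α : Type*} [DecidableEq α] {V : Finset α} {E : Finset (Sym2 α)}

open Laman

theorem IsSparse.isSubgraph (hE : IsSparse V E) {U : Finset α} (hU : U ⊆ V) :
    IsSubgraph U (E ∩ U.sym2) V E :=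
  ⟨fun e he => ⟨(hE.1 e (Finset.mem_inter.1 he).1).1, Finset.mem_sym2_iff.1 (Finset.mem_inter.1 he).2⟩,
    hU, Finset.inter_subset_left⟩

theorem IsSparse.sparse (hE : IsSparse V E) : Sparse E := by
  refine ⟨fun e he => (hE.1 e he).1, fun S hS => ?_⟩
  have h1 : spanned E S = (E ∩ (S ∩ V).sym2).card := by
    refine congrArg Finset.card (Finset.ext fun e => ?_)
    simp only [Finset.mem_inter, Finset.mem_sym2_iff]
    exact ⟨fun h => ⟨h.1, fun v hv => ⟨h.2 v hv, (hE.1 e h.1).2 v hv⟩⟩,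
      fun h => ⟨h.1, fun v hv => (h.2 v hv).1⟩⟩
  have hle : (S ∩ V).card ≤ S.card := Finset.card_le_card Finset.inter_subset_left
  by_cases h : 2 ≤ (S ∩ V).card
  · have := hE.2 _ _ (hE.isSubgraph (Finset.inter_subset_right (s₁ := S))) h
    omega
  · have h0 : (E ∩ (S ∩ V).sym2).card = 0 := by
      rw [Finset.card_eq_zero, Finset.eq_empty_iff_forall_notMem]
      intro e he
      obtain ⟨h1, h2⟩ := Finset.mem_inter.1 he
      induction e with
      | _ a b =>
        rw [Finset.mk_mem_sym2_iff] at h2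
        exact h (two_le_card_of_mem (fun hab => (hE.1 _ h1).1 (by simp [hab])) h2.1 h2.2)
    omega

theorem IsSparse.isTight (hE : IsSparse V E) {U : Finset α} (hU : U ⊆ V) (h : TightOn E U) :
    IsTight U (E ∩ U.sym2) := by
  have hs := hE.isSubgraph hU
  refine ⟨⟨hs.1, fun V' E' h' hc => hE.2 V' E' ⟨h'.1, h'.2.1.trans hU, h'.2.2.trans hs.2.2⟩ hc⟩,
    Or.inr ?_⟩
  have h2 := h.2
  rw [spanned] at h2
  omega

theorem IsMaxTight.tightOn (hE : IsSparse V E) {U : Finset α} {D : Finset (Sym2 α)}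
    (h : IsMaxTight U D V E) (hU : 2 ≤ U.card) : TightOn E U := by
  refine ⟨hU, ?_⟩
  have h1 : (D.card : ℤ) = 2 * U.card - 3 := h.2.1.2.resolve_left (by omega)
  have h2 : D.card ≤ spanned E U := Finset.card_le_card fun e he =>
    Finset.mem_inter.2 ⟨h.1.2.2 he, Finset.mem_sym2_iff.2 (h.1.1 e he).2⟩
  have h3 := hE.sparse.2 U hU
  omega

theorem Laman.TightOn.exists_mem (h : TightOn E V) :
    ∃ a b, s(a, b) ∈ E ∧ a ∈ V ∧ b ∈ V := by
  obtain ⟨h1, h2⟩ := h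
  obtain ⟨e, he⟩ := Finset.card_pos.1 (show 0 < (E ∩ V.sym2).card by rw [spanned] at h2; omega)
  obtain ⟨h3, h4⟩ := Finset.mem_inter.1 he
  induction e with
  | _ a b =>
    rw [Finset.mk_mem_sym2_iff] at h4
    exact ⟨a, b, h3, h4⟩

theorem IsMaxTightDecomp.exists_subset {I : Type*} {Vi : I → Finset α} {Ei : I → Finset (Sym2 α)}
    (hD : IsMaxTightDecomp V E Vi Ei) (hE : IsSparse V E) {U : Finset α} (hU : U ⊆ V)
    (h : TightOn E U) : ∃ i, U ⊆ Vi i := by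
  obtain ⟨a, b, hab, ha, hb⟩ := h.exists_mem
  obtain ⟨i, hi⟩ := hD.2.2.1 _ hab
  have hM := hD.1 i
  have hne : a ≠ b := fun h => (hE.1 _ hab).1 (by simp [h])
  have ha' : a ∈ Vi i := (hM.1.1 _ hi).2 a (by simp)
  have hb' : b ∈ Vi i := (hM.1.1 _ hi).2 b (by simp)
  have hT := hM.tightOn hE (two_le_card_of_mem hne ha' hb')
  have hW := h.union hE.sparse hT (two_le_card_of_mem hne (Finset.mem_inter.2 ⟨ha, ha'⟩)
    (Finset.mem_inter.2 ⟨hb, hb'⟩))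
  have hWV := Finset.union_subset hU hM.1.2.1
  have := (hM.2.2 _ _ (hE.isSubgraph hWV) (hE.isTight hWV hW) Finset.subset_union_right
    (fun e he => Finset.mem_inter.2 ⟨hM.1.2.2 he, Finset.mem_sym2_iff.2 fun v hv =>
      Finset.mem_union_right _ ((hM.1.1 e he).2 v hv)⟩)).1
  exact ⟨i, this ▸ Finset.subset_union_left⟩

theorem IsGraph.spanned_lift (hE : IsGraph V E) (S : Finset ↥V) :
    spanned (Finset.univ.image hE.lift) S = spanned E (S.map ⟨Subtype.val, Subtype.val_injective⟩) := by
  refine Finset.card_bij (fun e _ => e.map Subtype.val) ?_ ?_ ?_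
  · intro e he
    obtain ⟨h1, h2⟩ := Finset.mem_inter.1 he
    obtain ⟨f, -, rfl⟩ := Finset.mem_image.1 h1
    refine Finset.mem_inter.2 ⟨by rw [hE.map_lift]; exact f.2, Finset.mem_sym2_iff.2 fun v hv => ?_⟩
    obtain ⟨u, hu, rfl⟩ := Sym2.mem_map.1 hv
    exact Finset.mem_map.2 ⟨u, Finset.mem_sym2_iff.1 h2 u hu, rfl⟩
  · intro e _ f _ h
    exact Sym2.map.injective Subtype.val_injective h
  · intro e he
    obtain ⟨h1, h2⟩ := Finset.mem_inter.1 he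
    refine ⟨hE.lift ⟨e, h1⟩, Finset.mem_inter.2 ⟨Finset.mem_image_of_mem _ (Finset.mem_univ _),
      Finset.mem_sym2_iff.2 fun v hv => ?_⟩, hE.map_lift _⟩
    have h3 : (v : α) ∈ (hE.lift ⟨e, h1⟩).map Subtype.val := Sym2.mem_map.2 ⟨v, hv, rfl⟩
    rw [hE.map_lift] at h3
    obtain ⟨u, hu, huv⟩ := Finset.mem_map.1 (Finset.mem_sym2_iff.1 h2 _ h3)
    exact (Subtype.ext huv : u = v) ▸ hu

theorem IsGraph.tightOn_lift_iff (hE : IsGraph V E) {S : Finset ↥V} :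
    TightOn (Finset.univ.image hE.lift) S ↔
      TightOn E (S.map ⟨Subtype.val, Subtype.val_injective⟩) := by
  rw [TightOn, TightOn, hE.spanned_lift, Finset.card_map]

theorem IsSparse.sparse_lift (hE : IsSparse V E) : Sparse (Finset.univ.image hE.1.lift) := by
  refine ⟨fun e he hd => ?_, fun S hS => ?_⟩
  · obtain ⟨f, -, rfl⟩ := Finset.mem_image.1 he
    refine (hE.1 _ f.2).1 ?_
    rw [← hE.1.map_lift]
    exact hd.map
  · rw [hE.1.spanned_lift]
    have := hE.sparse.2 (S.map ⟨Subtype.val, Subtype.val_injective⟩) (by rwa [Finset.card_map])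
    rwa [Finset.card_map] at this

theorem extendR_apply (r : ↥V → ℂ × ℂ) (v : ↥V) : extendR V r v = r v := by
  simp [extendR]

theorem sd_eq_mul (x y : ℂ × ℂ) : sd x y = ((x.1 + Complex.I * x.2) - (y.1 + Complex.I * y.2)) *
    ((x.1 - Complex.I * x.2) - (y.1 - Complex.I * y.2)) := by
  rw [sd]
  linear_combination (x.2 - y.2) ^ 2 * Complex.I_mul_I

end
end

noncomputable section

section
variable {β : Type*}

open MvPolynomial

/-- The squared length of a pair of vertices as a polynomial in the coordinates. -/
def edgePoly : Sym2 β → MvPolynomial (β × Fin 2) ℂ :=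
  Sym2.lift ⟨fun u v => (isoZ u - isoZ v) * (isoW u - isoW v), fun u v => by ring⟩

theorem algebraMap_edgePoly {Ω : Type*} [Field Ω] [Algebra (MvPolynomial (β × Fin 2) ℂ) Ω] (e : Sym2 β) :
    algebraMap _ Ω (edgePoly e) = sqDist (fun v => algebraMap _ Ω (isoZ v))
      (fun v => algebraMap (MvPolynomial (β × Fin 2) ℂ) Ω (isoW v)) e := by
  induction e with
  | _ u v => simp [edgePoly]

theorem aeval_edgePoly (r : β → ℂ × ℂ) (u v : β) :
    aeval (coords r) (edgePoly s(u, v)) = sd (r u) (r v) := by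
  rw [sd_eq_mul, ← eval_coords_isoZ, ← eval_coords_isoZ, ← eval_coords_isoW, ← eval_coords_isoW]
  simp [edgePoly]

/-- The ideal of a fiber lies in every prime containing the defining equations. -/
theorem vanishingIdeal_le_of_isPrime [Finite β] {ι : Type*} {S : Set (β → ℂ × ℂ)}
    (p : ι → MvPolynomial (β × Fin 2) ℂ)
    (hS : ∀ r, (∀ i, eval (coords r) (p i) = 0) → r ∈ S) {P : Ideal (MvPolynomial (β × Fin 2) ℂ)}
    (hP : P.IsPrime) (hp : ∀ i, p i ∈ P) : _root_.vanishingIdeal S ≤ P := by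
  intro f hf
  have h1 : f ∈ (Ideal.span (Set.range p)).radical := by
    rw [← MvPolynomial.vanishingIdeal_zeroLocus_eq_radical (K := ℂ)]
    intro x hx
    let r : β → ℂ × ℂ := fun v => (x (v, 0), x (v, 1))
    have hr : coords r = x := by
      funext ⟨v, j⟩
      fin_cases j <;> simp [coords, r]
    have hrS : r ∈ S := hS r fun i => by
      rw [hr]
      exact hx _ (Ideal.subset_span ⟨i, rfl⟩)
    have := hf r hrS
    rw [hr] at this
    exact this
  refine (hP.radical_le_iff.2 ?_) h1
  rw [Ideal.span_le]
  rintro _ ⟨i, rfl⟩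
  exact hp i

end
end

/-- For a sparse graph with max-tight decomposition and a
general edge length assignment `λ`, two `λ`-compatible realizations `r, s`
belong to a common irreducible component of `E_G⁻¹(λ)` if and only if for each
max-tight subgraph `(Vi i, Ei i)` there is a transformation `t ∈ T` with
`t ∘ (r|_{Vi i}) = s|_{Vi i}`. -/
theorem same_component_iff_equal_up_to_transformation
    {α I : Type*} [DecidableEq α]
    (V : Finset α) (E : Finset (Sym2 α))
    (Vi : I → Finset α) (Ei : I → Finset (Sym2 α))
    (hSparse : IsSparse V E)
    (hDecomp : IsMaxTightDecomp V E Vi Ei) :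
    ∃ F : MvPolynomial {e // e ∈ E} ℂ, F ≠ 0 ∧
      ∀ lam : {e // e ∈ E} → ℂ, MvPolynomial.eval lam F ≠ 0 →
        ∀ r ∈ fiber V E lam, ∀ s ∈ fiber V E lam,
          ((∃ P ∈ (vanishingIdeal (fiber V E lam)).minimalPrimes,
              ∀ p ∈ P, MvPolynomial.eval (coords r) p = 0 ∧
                MvPolynomial.eval (coords s) p = 0) ↔
            (∀ i : I, ∃ t, IsTransf t ∧
              ∀ (v : α) (hvi : v ∈ Vi i) (hv : v ∈ V),
                t (r ⟨v, hv⟩) = s ⟨v, hv⟩)) := by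
  let A := MvPolynomial (↥V × Fin 2) ℂ
  let Ω := FractionRing A
  let B := MvPolynomial {e // e ∈ E} ℂ
  let ε := hSparse.1.lift
  let E' := Finset.univ.image ε
  let Z : ↥V → Ω := fun v => algebraMap A Ω (isoZ v)
  let W : ↥V → Ω := fun v => algebraMap A Ω (isoW v)
  have hE' : Laman.Sparse E' := hSparse.sparse_lift
  have hP : GenericPlacement ℂ Z W := genericPlacement_iso
  have hε : Set.range ε = E' := by rw [Finset.coe_image, Finset.coe_univ, Set.image_univ]
  let q : B →ₐ[ℂ] A := MvPolynomial.aeval fun e => edgePoly (ε e)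
  have hqX : ∀ e, q (MvPolynomial.X e) = edgePoly (ε e) := fun e => MvPolynomial.aeval_X _ _
  have hqΩ : ∀ e, algebraMap A Ω (q (MvPolynomial.X e)) = sqDist Z W (ε e) := fun e => by
    rw [hqX]; exact algebraMap_edgePoly _
  have hqinj : Function.Injective q := by
    have h1 := (Laman.independent_and_rational hP hE').1
    have h2 : AlgebraicIndependent ℂ (fun e => sqDist Z W (ε e)) :=
      AlgebraicIndependent.comp h1 (fun e => ⟨ε e, hε ▸ Set.mem_range_self e⟩)
        (fun e f h => hSparse.1.lift_injective (congrArg Subtype.val h))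
    have h3 : AlgebraicIndependent ℂ (fun e => edgePoly (ε e)) := by
      refine AlgebraicIndependent.of_comp (IsScalarTower.toAlgHom ℂ A Ω) ?_
      convert h2 using 2 with e
      exact algebraMap_edgePoly _
    exact h3
  let _ : Algebra B A := q.toRingHom.toAlgebra
  have : IsScalarTower ℂ B A := IsScalarTower.of_algebraMap_eq fun c => (q.commutes c).symm
  have : FaithfulSMul B A := (faithfulSMul_iff_algebraMap_injective B A).2 hqinj
  obtain ⟨F₁, hF₁, h₁⟩ := exists_forall_prime_mul_sub_eq (z := isoZ) (w := isoW) hP hE' hε hqΩ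
  obtain ⟨F₂, hF₂, h₂⟩ := exists_forall_exists_prime_of_mul_sub_eq (z := isoZ) (w := isoW) hP hE' hε hqΩ
  refine ⟨F₁ * F₂ * ∏ e, MvPolynomial.X e, mul_ne_zero (mul_ne_zero hF₁ hF₂)
    (Finset.prod_ne_zero_iff.2 fun e _ => MvPolynomial.X_ne_zero e), ?_⟩
  intro lam hlam
  rw [map_mul, map_mul, map_prod] at hlam
  have hlam₁ := left_ne_zero_of_mul (left_ne_zero_of_mul hlam)
  have hlam₂ := right_ne_zero_of_mul (left_ne_zero_of_mul hlam)
  have hlam₃ : ∀ e, lam e ≠ 0 := fun e => by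
    have := Finset.prod_ne_zero_iff.1 (right_ne_zero_of_mul hlam) e (Finset.mem_univ e)
    rwa [MvPolynomial.eval_X] at this
  have hedge : ∀ (r : ↥V → ℂ × ℂ) e, MvPolynomial.aeval (coords r) (q (MvPolynomial.X e)) =
      edgeMap V E r e := by
    intro r e
    have h1 := hSparse.1.map_lift e
    rw [hqX, edgeMap, ← h1]
    change MvPolynomial.aeval (coords r) (edgePoly (hSparse.1.lift e)) = _
    induction hSparse.1.lift e with
    | _ u v =>
      rw [aeval_edgePoly, Sym2.map_mk]
      change _ = sd (extendR V r u) (extendR V r v)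
      rw [extendR_apply, extendR_apply]
  have hmem : ∀ r : ↥V → ℂ × ℂ, r ∈ fiber V E lam ↔
      ∀ e, MvPolynomial.aeval (coords r) (q (MvPolynomial.X e)) = lam e := by
    intro r
    simp only [hedge]
    exact funext_iff
  have hcomp : ∀ r ∈ fiber V E lam, ∀ b, MvPolynomial.aeval (coords r) (q b) =
      MvPolynomial.eval lam b := by
    intro r hr b
    have : (MvPolynomial.aeval (coords r)).comp q = MvPolynomial.aeval lam :=
      MvPolynomial.algHom_ext fun e => by
        rw [MvPolynomial.aeval_X]
        exact (hmem r).1 hr e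
    rw [← MvPolynomial.coe_aeval_eq_eval]
    exact DFunLike.congr_fun this b
  intro r hr s hs
  constructor
  · rintro ⟨P, hPmin, hPrs⟩ i
    have hprod := h₁ lam hlam₁ P hPmin.1.1 (fun b hb => hPmin.1.2 fun x hx => by
        rw [← MvPolynomial.coe_aeval_eq_eval]
        exact (hcomp x hx b).trans hb) (MvPolynomial.aeval (coords r)) (MvPolynomial.aeval (coords s))
      (fun p hp => (hPrs p hp).1) (fun p hp => (hPrs p hp).2)
    by_cases hi : 2 ≤ (Vi i).card
    · have hM := hDecomp.1 i
      let S : Finset ↥V := Finset.univ.filter fun v => (v : α) ∈ Vi i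
      have hS : S.map ⟨Subtype.val, Subtype.val_injective⟩ = Vi i := by
        ext v
        simp only [Finset.mem_map, S, Finset.mem_filter, Finset.mem_univ, true_and,
          Function.Embedding.coeFn_mk]
        exact ⟨fun ⟨u, hu, huv⟩ => huv ▸ hu, fun hv => ⟨⟨v, hM.1.2.1 hv⟩, hv, rfl⟩⟩
      have hT : Laman.TightOn E' S := by
        rw [hSparse.1.tightOn_lift_iff, hS]
        exact hM.tightOn hSparse hi
      obtain ⟨a, b, hab, ha, hb⟩ := hT.exists_mem
      obtain ⟨e, -, he⟩ := Finset.mem_image.1 hab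
      obtain ⟨t, ht, h⟩ := exists_isTransf_of_mul_sub_eq (S := (S : Set ↥V)) (hprod S hT) ha hb (by
        have h1 := (hmem r).1 hr e
        rw [hqX, he] at h1
        exact fun h0 => hlam₃ e (h1.symm.trans h0))
      exact ⟨t, ht, fun v hvi hv => h ⟨v, hv⟩ (Finset.mem_coe.2 (Finset.mem_filter.2
        ⟨Finset.mem_univ _, hvi⟩))⟩
    · by_cases hne : ∃ v : ↥V, (v : α) ∈ Vi i
      · obtain ⟨v, hv⟩ := hne
        refine ⟨fun x => (1 * x.1 - 0 * x.2 + ((s v).1 - (r v).1),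
          0 * x.1 + 1 * x.2 + ((s v).2 - (r v).2)), ⟨1, 0, _, _, by norm_num, fun x => rfl⟩, ?_⟩
        intro u hu hu'
        have huv : u = v := Finset.card_le_one.1 (by omega) u hu v hv
        subst huv
        ext <;> simp
      · exact ⟨_, ⟨1, 0, 0, 0, by norm_num, fun x => rfl⟩, fun v hvi hv => absurd ⟨⟨v, hv⟩, hvi⟩ hne⟩
  · intro h
    obtain ⟨P, hPp, hPr, hPs, hPb⟩ := h₂ lam hlam₂ (MvPolynomial.aeval (coords r))
      (MvPolynomial.aeval (coords s)) ((hmem r).1 hr) ((hmem s).1 hs) (by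
        intro S hS a ha b hb c hc
        rw [hSparse.1.tightOn_lift_iff] at hS
        obtain ⟨i, hi⟩ := hDecomp.exists_subset hSparse (fun v hv => by
          obtain ⟨u, -, rfl⟩ := Finset.mem_map.1 hv
          exact u.2) hS
        obtain ⟨t, ht, hrs⟩ := h i
        have hrs' : ∀ v ∈ S, t (r v) = s v := fun v hv => hrs v
          (hi (Finset.mem_map.2 ⟨v, hv, rfl⟩)) v.2
        exact ht.mul_sub_eq (hrs' a ha) (hrs' b hb) (hrs' c hc))
    have hle : vanishingIdeal (fiber V E lam) ≤ P := by
      refine vanishingIdeal_le_of_isPrime (ι := {e // e ∈ E})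
        (fun e => q (MvPolynomial.X e - MvPolynomial.C (lam e))) (fun x hx => ?_) hPp
        (fun e => hPb _ (by simp))
      rw [hmem]
      intro e
      have h1 : MvPolynomial.aeval (coords x) (q (MvPolynomial.X e - MvPolynomial.C (lam e))) = 0 :=
        hx e
      rw [map_sub, map_sub, sub_eq_zero] at h1
      rw [h1, ← MvPolynomial.algebraMap_eq, AlgHom.commutes, AlgHom.commutes]
      rfl
    obtain ⟨Q, hQ, hQP⟩ := Ideal.exists_minimalPrimes_le hle
    exact ⟨Q, hQ, fun p hp => ⟨hPr (hQP hp), hPs (hQP hp)⟩⟩
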